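/- arXiv:1712.06143 — 2 statements merged into one kernel-verified Lean document; each statement's English description precedes it below -/
import Mathlib

section
/- If G is a 3-connected cubic graph and Δ is a triangle in G on more than 4 vertices, then the graph G_Δ obtained by contracting Δ is 3-connected and cubic; hence any counterexample to Tait's conjecture (3-connected cubic planar non-Hamiltonian graph) containing a triangle yields a smaller counterexample. -/
/-- A graph is cubic (3-regular) if every vertex has exactly 3 neighbors. -/
def IsCubic {V : Type} (G : SimpleGraph V) : Prop :=
  ∀ v : V, (G.neighborSet v).ncard = 3

/-- A graph is 3-connected: it has at least 4 vertices and removing any set of at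
most 2 vertices leaves a connected graph. -/
def ThreeConnected {V : Type} (G : SimpleGraph V) : Prop :=
  4 ≤ Nat.card V ∧ ∀ S : Set V, S.ncard ≤ 2 → (G.induce Sᶜ).Connected

/-- The involution of darts of a simple graph, as a permutation. -/
def dartFlip {V : Type} (G : SimpleGraph V) : Equiv.Perm G.Dart :=
  ⟨SimpleGraph.Dart.symm, SimpleGraph.Dart.symm,
    SimpleGraph.Dart.symm_symm, SimpleGraph.Dart.symm_symm⟩

/-- The face setoid of a rotation system `rot`: orbits of the face permutation. -/
def faceSetoid {V : Type} (G : SimpleGraph V) (rot : Equiv.Perm G.Dart) :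
    Setoid G.Dart :=
  ⟨Equiv.Perm.SameCycle ((dartFlip G).trans rot : Equiv.Perm G.Dart),
    ⟨fun x => Equiv.Perm.SameCycle.refl _ x, Equiv.Perm.SameCycle.symm,
      Equiv.Perm.SameCycle.trans⟩⟩

/-- `G` is planar: it admits a rotation system whose face count satisfies
Euler's formula for genus 0. -/
def IsPlanar {V : Type} [Fintype V] (G : SimpleGraph V) : Prop :=
  ∃ rot : Equiv.Perm G.Dart,
    (∀ d : G.Dart, (rot d).toProd.1 = d.toProd.1) ∧
    (∀ d d' : G.Dart, d.toProd.1 = d'.toProd.1 → rot.SameCycle d d') ∧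
    Nat.card V + Nat.card (Quotient (faceSetoid G rot)) =
      Nat.card G.Dart / 2 + 1 + Nat.card G.ConnectedComponent

/-- The contraction of the triangle `{a, b, c}` of `G` to the single vertex `a`. -/
def contractTriangle {V : Type} (G : SimpleGraph V) (a b c : V) :
    SimpleGraph {x : V // x ≠ b ∧ x ≠ c} :=
  SimpleGraph.fromRel (fun x y =>
    G.Adj x.1 y.1 ∨ (x.1 = a ∧ (G.Adj b y.1 ∨ G.Adj c y.1)))

section TriangleContraction

open Equiv Equiv.Perm


/-- number of cycles (including fixed points) -/
noncomputable def cyc {D : Type} (π : Equiv.Perm D) : ℕ := Nat.card (Quotient (SameCycle.setoid π))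

lemma cyc_merge_card {D : Type} [Finite D] (r r' : Setoid D) (x y : D) (hxy : ¬ r x y)
    (h : ∀ u v, r' u v ↔ r u v ∨ ((r u x ∨ r u y) ∧ (r v x ∨ r v y))) :
    Nat.card (Quotient r) = Nat.card (Quotient r') + 1 := by
  classical
  have hle : ∀ u v, r u v → r' u v := fun u v huv => (h u v).2 (Or.inl huv)
  let f : {q : Quotient r // q ≠ Quotient.mk r y} → Quotient r' :=
    fun q => Quotient.map' (s₁ := r) (s₂ := r') id hle q.1
  have hf : Function.Bijective f := by
    constructor
    · rintro ⟨q1, h1⟩ ⟨q2, h2⟩ heq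
      induction q1 using Quotient.inductionOn with | _ u =>
      induction q2 using Quotient.inductionOn with | _ v =>
      have h1' : ¬ r u y := fun hh => h1 (Quotient.sound hh)
      have h2' : ¬ r v y := fun hh => h2 (Quotient.sound hh)
      have : r' u v := Quotient.exact heq
      rw [h] at this
      refine Subtype.ext (Quotient.sound ?_)
      change r u v
      rcases this with h3 | ⟨h3 | h3, h4 | h4⟩
      · exact h3
      · exact r.trans' h3 (r.symm' h4)
      · exact absurd h4 h2'
      · exact absurd h3 h1'
      · exact absurd h3 h1'
    · intro q
      induction q using Quotient.inductionOn with | _ u =>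
      by_cases hu : r u y
      · refine ⟨⟨Quotient.mk r x, fun hh => hxy (Quotient.exact hh)⟩, Quotient.sound ?_⟩
        exact (h x u).2 (Or.inr ⟨Or.inl (r.refl' x), Or.inr hu⟩)
      · exact ⟨⟨Quotient.mk r u, fun hh => hu (Quotient.exact hh)⟩, rfl⟩
  have h1 := Nat.card_congr (Equiv.ofBijective f hf)
  have h2 : Nat.card {q : Quotient r // q ≠ Quotient.mk r y} + 1 = Nat.card (Quotient r) := by
    have := Fintype.ofFinite (Quotient r)
    rw [Nat.card_eq_fintype_card, Nat.card_eq_fintype_card, Fintype.card_subtype_compl,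
      Fintype.card_subtype_eq]
    have : 0 < Fintype.card (Quotient r) := Fintype.card_pos_iff.2 ⟨Quotient.mk r y⟩
    omega
  omega

lemma sameCycle_of_step {D : Type} [Finite D] (π : Perm D) (r : Setoid D) (h : ∀ u, r u (π u))
    {u v : D} (huv : SameCycle π u v) : r u v := by
  obtain ⟨n, rfl⟩ := huv.exists_nat_pow_eq
  induction n with
  | zero => exact r.refl' u
  | succ n ih =>
    rw [pow_succ', Perm.mul_apply]
    exact r.trans' (ih ⟨n, rfl⟩) (h _)

lemma merge_xy {D : Type} [Finite D] [DecidableEq D] (π : Perm D) (x y : D) (h : ¬ SameCycle π x y) :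
    SameCycle (π * swap x y) y x := by
  classical
  by_contra hn
  have key : ∀ n : ℕ, SameCycle (π * swap x y) y ((π ^ (n+1)) x) := by
    intro n
    induction n with
    | zero =>
      refine ⟨1, ?_⟩
      simp
    | succ n ih =>
      refine ih.trans ⟨1, ?_⟩
      have h1 : (π ^ (n+1)) x ≠ x := fun hh => hn (by rwa [hh] at ih)
      have h2 : (π ^ (n+1)) x ≠ y := fun hh => h ⟨(n+1 : ℕ), by rw [zpow_natCast]; exact hh⟩
      rw [zpow_one, Perm.mul_apply, swap_apply_of_ne_of_ne h1 h2, pow_succ' π (n+1), Perm.mul_apply]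
  have h1 := key (orderOf π - 1)
  rw [Nat.sub_add_cancel (orderOf_pos π), pow_orderOf_eq_one] at h1
  exact hn h1

lemma sameCycle_merge {D : Type} [Finite D] [DecidableEq D] (π : Perm D) (x y : D) (h : ¬ SameCycle π x y) (u v : D) :
    SameCycle (π * swap x y) u v ↔ SameCycle π u v ∨
      ((SameCycle π u x ∨ SameCycle π u y) ∧ (SameCycle π v x ∨ SameCycle π v y)) := by
  classical
  have hyx := merge_xy π x y h
  have hle : ∀ u v, SameCycle π u v → SameCycle (π * swap x y) u v := by
    intro u v
    refine sameCycle_of_step π (SameCycle.setoid (π * swap x y)) ?_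
    intro u
    change SameCycle (π * swap x y) u (π u)
    by_cases hx : u = x
    · subst hx
      exact hyx.symm.trans ⟨1, by simp⟩
    by_cases hy : u = y
    · subst hy
      exact hyx.trans ⟨1, by simp⟩
    · exact ⟨1, by simp [swap_apply_of_ne_of_ne hx hy]⟩
  constructor
  · let r : Setoid D := ⟨fun u v => SameCycle π u v ∨
      ((SameCycle π u x ∨ SameCycle π u y) ∧ (SameCycle π v x ∨ SameCycle π v y)), by
        refine ⟨fun u => Or.inl (SameCycle.refl _ _), ?_, ?_⟩
        · rintro u v (h | ⟨h1, h2⟩)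
          · exact Or.inl h.symm
          · exact Or.inr ⟨h2, h1⟩
        · rintro u v w (h | ⟨h1, h2⟩) (h' | ⟨h1', h2'⟩)
          · exact Or.inl (h.trans h')
          · exact Or.inr ⟨h1'.imp h.trans h.trans, h2'⟩
          · exact Or.inr ⟨h1, h2.imp h'.symm.trans h'.symm.trans⟩
          · exact Or.inr ⟨h1, h2'⟩⟩
    refine sameCycle_of_step _ r ?_
    intro u
    have hs : ∀ w, SameCycle π w (π w) := fun w => ⟨1, by simp⟩
    by_cases hx : u = x
    · subst hx
      refine Or.inr ⟨Or.inl (SameCycle.refl _ _), Or.inr ?_⟩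
      simpa using (hs y).symm
    by_cases hy : u = y
    · subst hy
      refine Or.inr ⟨Or.inr (SameCycle.refl _ _), Or.inl ?_⟩
      simpa using (hs x).symm
    · refine Or.inl ?_
      simpa [swap_apply_of_ne_of_ne hx hy] using hs u
  · rintro (h1 | ⟨h1, h2⟩)
    · exact hle _ _ h1
    · have aux : ∀ w, (SameCycle π w x ∨ SameCycle π w y) → SameCycle (π * swap x y) w x := by
        rintro w (hw | hw)
        · exact hle _ _ hw
        · exact (hle _ _ hw).trans hyx
      exact (aux u h1).trans (aux v h2).symm

lemma cyc_merge {D : Type} [Finite D] [DecidableEq D] (π : Perm D) (x y : D) (h : ¬ SameCycle π x y) :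
    cyc π = cyc (π * swap x y) + 1 :=
  cyc_merge_card _ _ x y h (sameCycle_merge π x y h)

lemma split_not {D : Type} [Finite D] [DecidableEq D] (π : Perm D) (x y : D) (hne : x ≠ y) (h : SameCycle π x y) :
    ¬ SameCycle (π * swap x y) x y := by
  classical
  intro hcon
  have hp : ∃ n : ℕ, (π ^ n) x = y := h.exists_nat_pow_eq
  have hk := Nat.find_spec hp
  have hmin : ∀ m, m < Nat.find hp → (π ^ m) x ≠ y := fun m hm => Nat.find_min hp hm
  set k := Nat.find hp with hkdef
  have hk0 : 1 ≤ k := by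
    rcases Nat.eq_zero_or_pos k with h0 | h0
    · rw [h0] at hk; exact absurd hk hne
    · exact h0
  have hx : ∀ j, 1 ≤ j → j ≤ k → (π ^ j) x ≠ x := by
    intro j h1 h2 h3
    rcases h2.eq_or_lt with h4 | h4
    · rw [h4] at h3; exact hne (h3.symm.trans hk)
    · refine hmin (k - j) (by omega) ?_
      have : (π ^ (k - j)) ((π ^ j) x) = y := by
        rw [← Perm.mul_apply, ← pow_add, Nat.sub_add_cancel h2]; exact hk
      rwa [h3] at this
  obtain ⟨n, hn⟩ := hcon.symm.exists_nat_pow_eq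
  have inv : ∀ n : ℕ, ∃ j, 1 ≤ j ∧ j ≤ k ∧ ((π * swap x y) ^ n) y = (π ^ j) x := by
    intro n
    induction n with
    | zero => exact ⟨k, hk0, le_rfl, by simp [hk]⟩
    | succ n ih =>
      obtain ⟨j, h1, h2, h3⟩ := ih
      rw [pow_succ', Perm.mul_apply, h3]
      rcases h2.eq_or_lt with h4 | h4
      · refine ⟨1, le_rfl, hk0, ?_⟩
        rw [h4, hk]; simp
      · refine ⟨j + 1, by omega, h4, ?_⟩
        rw [Perm.mul_apply, swap_apply_of_ne_of_ne (hx j h1 h2) (hmin j h4), pow_succ' π j,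
          Perm.mul_apply]
  obtain ⟨j, h1, h2, h3⟩ := inv n
  exact hx j h1 h2 (h3.symm.trans hn)

lemma cyc_split {D : Type} [Finite D] [DecidableEq D] (π : Perm D) (x y : D) (hne : x ≠ y)
    (h : SameCycle π x y) : cyc (π * swap x y) = cyc π + 1 := by
  have h1 := cyc_merge _ x y (split_not π x y hne h)
  rwa [mul_assoc, swap_mul_self, mul_one] at h1

lemma cyc_le {D : Type} [Finite D] [DecidableEq D] (π : Perm D) (x y : D) :
    cyc (π * swap x y) ≤ cyc π + 1 := by
  by_cases hne : x = y
  · subst hne; rw [swap_self]; exact Nat.le_succ _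
  by_cases h : SameCycle π x y
  · exact (cyc_split π x y hne h).le
  · have := cyc_merge π x y h; omega

/-- after a split every element of the old cycle is in one of the two halves -/
lemma split_mem {D : Type} [Finite D] [DecidableEq D] (π : Perm D) (x y z : D) (hne : x ≠ y)
    (h : SameCycle π x y) (hz : SameCycle π x z) :
    SameCycle (π * swap x y) x z ∨ SameCycle (π * swap x y) y z := by
  have h1 := sameCycle_merge _ x y (split_not π x y hne h) x z
  rw [mul_assoc, swap_mul_self, mul_one] at h1
  rcases h1.1 hz with h2 | ⟨-, h2 | h2⟩
  · exact Or.inl h2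
  · exact Or.inl h2.symm
  · exact Or.inr h2.symm

lemma cyc_three {D : Type} [Finite D] [DecidableEq D] (π : Perm D) (x y z : D) (hxy : x ≠ y)
    (hxz : x ≠ z) (hyz : y ≠ z) (h : SameCycle π x y) (hz : SameCycle π x z) :
    cyc (π * swap x y * swap x z) = cyc π + 2 ∨ cyc (π * swap y x * swap y z) = cyc π + 2 := by
  have h1 := cyc_split π x y hxy h
  rcases split_mem π x y z hxy h hz with h2 | h2
  · left; rw [cyc_split _ x z hxz h2, h1]
  · right; rw [swap_comm y x, cyc_split _ y z hyz h2, h1]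

/-- Euler's inequality (nonnegativity of genus). -/
lemma genus_nonneg {D : Type} [Fintype D] [DecidableEq D] (σ : Perm D) (n : ℕ) :
    ∀ α : Perm D, α * α = 1 → α.support.card ≤ n → 
    cyc (σ * α) + cyc σ ≤
      2 * Nat.card (Quotient (SameCycle.setoid σ ⊔ SameCycle.setoid α)) + α.support.card / 2 := by
  induction n with
  | zero =>
    intro α _ h
    have h1 : α = 1 := by simpa using h
    subst h1
    have : SameCycle.setoid σ ⊔ SameCycle.setoid (1 : Perm D) = SameCycle.setoid σ := by
      refine sup_eq_left.2 ?_
      intro u v huv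
      have : SameCycle (1 : Perm D) u v := huv
      rw [sameCycle_one] at this
      subst this
      exact SameCycle.refl _ _
    rw [this, mul_one]
    unfold cyc; omega
  | succ n ih =>
    intro α hα hn
    by_cases h1 : α = 1
    · subst h1; exact ih 1 (by simp) (by simp)
    obtain ⟨x, hx⟩ : ∃ x, α x ≠ x := by
      by_contra hcon
      push Not at hcon
      exact h1 (Equiv.ext hcon)
    have hinv : ∀ d, α (α d) = d := fun d => by
      rw [← Perm.mul_apply, hα]; rfl
    set y := α x with hy
    have hyx : α y = x := hinv x
    set β := α * swap x y with hβ
    have hβx : β x = x := by simp [hβ, hyx]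
    have hβy : β y = y := by simp [hβ, hy]
    have hβd : ∀ d, d ≠ x → d ≠ y → β d = α d := fun d h1 h2 => by
      simp [hβ, swap_apply_of_ne_of_ne h1 h2]
    have hβ2 : β * β = 1 := by
      ext d
      by_cases h1 : d = x
      · subst h1; simp [hβx]
      by_cases h2 : d = y
      · rw [h2]; simp [hβy]
      · rw [Perm.mul_apply, hβd d h1 h2, hβd, hinv]; · rfl
        · intro h; exact h2 (by rw [hy, ← h, hinv])
        · intro h; exact h1 (by rw [← hyx, ← h, hinv])
    have hsupp : β.support.card + 2 = α.support.card := by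
      have : α.support = insert x (insert y β.support) := by
        ext d
        simp only [mem_support, Finset.mem_insert]
        by_cases h1 : d = x
        · rw [h1]; simpa using hx
        by_cases h2 : d = y
        · simp [h2, hyx, hx.symm]
        · simp [h1, h2, hβd d h1 h2]
      rw [this, Finset.card_insert_of_notMem, Finset.card_insert_of_notMem]
      · simp [hβy]
      · simp [hβx, hx.symm]
    have hαβ : α = β * swap x y := by rw [hβ, mul_assoc, swap_mul_self, mul_one]
    have ih' := ih β hβ2 (by omega)
    set R := SameCycle.setoid σ ⊔ SameCycle.setoid β with hR
    have hσR : ∀ u v, SameCycle σ u v → R u v := fun u v h => (le_sup_left : _ ≤ R) h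
    have hβR : ∀ u v, SameCycle β u v → R u v := fun u v h => (le_sup_right : _ ≤ R) h
    set R' := SameCycle.setoid σ ⊔ SameCycle.setoid α with hR'
    have hσR' : ∀ u v, SameCycle σ u v → R' u v := fun u v h => (le_sup_left : _ ≤ R') h
    have hαR' : ∀ u v, SameCycle α u v → R' u v := fun u v h => (le_sup_right : _ ≤ R') h
    have hst : ∀ (f : Perm D) u, SameCycle f u (f u) := fun f u => ⟨1, by simp⟩
    have hRR' : R ≤ R' := by
      refine sup_le le_sup_left ?_
      intro u v huv
      refine sameCycle_of_step β R' ?_ huv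
      intro u
      by_cases h1 : u = x
      · rw [h1, hβx]
      by_cases h2 : u = y
      · rw [h2, hβy]
      · rw [hβd u h1 h2]; exact hαR' _ _ (hst _ _)
    have hxyR' : R' x y := hαR' _ _ (hst α x)
    have hchar : ∀ u v, R' u v ↔ R u v ∨ ((R u x ∨ R u y) ∧ (R v x ∨ R v y)) := by
      intro u v
      constructor
      · let r : Setoid D := ⟨fun u v => R u v ∨ ((R u x ∨ R u y) ∧ (R v x ∨ R v y)), by
          refine ⟨fun u => Or.inl (R.refl' _), ?_, ?_⟩
          · rintro u v (h | ⟨h1, h2⟩)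
            · exact Or.inl (R.symm' h)
            · exact Or.inr ⟨h2, h1⟩
          · rintro u v w (h | ⟨h1, h2⟩) (h' | ⟨h1', h2'⟩)
            · exact Or.inl (R.trans' h h')
            · exact Or.inr ⟨h1'.imp (R.trans' h) (R.trans' h), h2'⟩
            · exact Or.inr ⟨h1, h2.imp (R.trans' (R.symm' h')) (R.trans' (R.symm' h'))⟩
            · exact Or.inr ⟨h1, h2'⟩⟩
        have : R' ≤ r := by
          refine sup_le ?_ ?_
          · intro u v huv; exact Or.inl (hσR _ _ huv)
          · intro u v huv
            refine sameCycle_of_step α r ?_ huv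
            intro u
            by_cases h1 : u = x
            · rw [h1]; exact Or.inr ⟨Or.inl (R.refl' _), Or.inr (R.refl' _)⟩
            by_cases h2 : u = y
            · rw [h2, hyx]; exact Or.inr ⟨Or.inr (R.refl' _), Or.inl (R.refl' _)⟩
            · rw [← hβd u h1 h2]; exact Or.inl (hβR _ _ (hst _ _))
        exact fun h => this h
      · have aux : ∀ w, (R w x ∨ R w y) → R' w x := by
          rintro w (h | h)
          · exact hRR' h
          · exact R'.trans' (hRR' h) (R'.symm' hxyR')
        rintro (h | ⟨h1, h2⟩)
        · exact hRR' h
        · exact R'.trans' (aux u h1) (R'.symm' (aux v h2))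
    have hle : cyc (σ * α) ≤ cyc (σ * β) + 1 := by
      rw [hαβ, ← mul_assoc]; exact cyc_le _ _ _
    by_cases hxy : R x y
    · have : R' = R := by
        refine le_antisymm ?_ hRR'
        intro u v huv
        have aux : ∀ w, (R w x ∨ R w y) → R w x := by
          rintro w (h | h)
          · exact h
          · exact R.trans' h (R.symm' hxy)
        rcases (hchar u v).1 huv with h | ⟨h1, h2⟩
        · exact h
        · exact R.trans' (aux u h1) (R.symm' (aux v h2))
      rw [this]
      omega
    · have h2 := cyc_merge_card R R' x y hxy hchar
      have h3 : ¬ SameCycle (σ * β) x y := by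
        intro h
        refine hxy (sameCycle_of_step _ R ?_ h)
        intro u
        exact R.trans' (hβR _ _ (hst β u)) (hσR _ _ (hst σ _))
      have h4 := cyc_merge (σ * β) x y h3
      rw [mul_assoc, ← hαβ] at h4
      omega

/-- Retraction lemma. -/
lemma sameCycle_retract {D E : Type} [Finite D] [Finite E] (π : Perm D) (π' : Perm E) (i : E → D)
    (r : D → E) (h1 : ∀ e, r (i e) = e) (h3 : ∀ d, SameCycle π' (r d) (r (π d)))
    (h4 : ∀ e, SameCycle π (i e) (i (π' e))) (u v : E) :
    SameCycle π' u v ↔ SameCycle π (i u) (i v) := by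
  constructor
  · exact sameCycle_of_step π' ((SameCycle.setoid π).comap i) h4
  · intro h
    have := sameCycle_of_step π ((SameCycle.setoid π').comap r) h3 h
    have h5 : SameCycle π' (r (i u)) (r (i v)) := this
    rwa [h1, h1] at h5

lemma cyc_retract {D E : Type} [Finite D] [Finite E] (π : Perm D) (π' : Perm E) (i : E → D)
    (r : D → E) (h1 : ∀ e, r (i e) = e) (h2 : ∀ d, SameCycle π (i (r d)) d)
    (h3 : ∀ d, SameCycle π' (r d) (r (π d)))
    (h4 : ∀ e, SameCycle π (i e) (i (π' e))) : cyc π' = cyc π := by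
  have key := sameCycle_retract π π' i r h1 h3 h4
  refine Nat.card_congr (Equiv.ofBijective
    (Quotient.map' (s₁ := SameCycle.setoid π') (s₂ := SameCycle.setoid π) i
      (fun u v h => (key u v).1 h)) ⟨?_, ?_⟩)
  · intro q1 q2 h
    induction q1 using Quotient.inductionOn with | _ u =>
    induction q2 using Quotient.inductionOn with | _ v =>
    exact Quotient.sound ((key u v).2 (Quotient.exact h))
  · intro q
    induction q using Quotient.inductionOn with | _ d =>
    exact ⟨Quotient.mk _ (r d), Quotient.sound (h2 d)⟩


/-- membership in the triangle -/
def inT {V : Type} (a b c v : V) : Prop := v = a ∨ v = b ∨ v = c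

/-- The structure of the triangle in the graph. -/
structure TriData {V : Type} (G : SimpleGraph V) (a b c : V) (out : V → V) : Prop where
  hab : G.Adj a b
  hbc : G.Adj b c
  hac : G.Adj a c
  out_adj : ∀ z, inT a b c z → G.Adj z (out z)
  out_not : ∀ z, inT a b c z → ¬ inT a b c (out z)
  out_uniq : ∀ z w, inT a b c z → ¬ inT a b c w → G.Adj z w → w = out z
  out_inj : ∀ z w, inT a b c z → inT a b c w → out z = out w → z = w

lemma cut_of_connected {V : Type} (G : SimpleGraph V) (s X : Set V) (h : (G.induce s).Connected)
    (hX : X ⊆ s) (x y : V) (hx : x ∈ X) (hy : y ∈ s) (hy' : y ∉ X) :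
    ∃ u ∈ X, ∃ v ∈ s, v ∉ X ∧ G.Adj u v := by
  by_contra hcon
  push Not at hcon
  obtain ⟨p⟩ := h.preconnected ⟨x, hX hx⟩ ⟨y, hy⟩
  have : ∀ (u v : s) (p : (G.induce s).Walk u v), u.1 ∈ X → v.1 ∈ X := by
    intro u v p
    induction p with
    | nil => exact id
    | cons hadj p ih =>
      intro hu
      apply ih
      by_contra hv
      exact hcon _ hu _ (Subtype.property _) hv hadj
  exact hy' (this _ _ p hx)

lemma connected_of_cut {V : Type} (G : SimpleGraph V) (s : Set V) (hs : s.Nonempty)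
    (h : ∀ X : Set V, X ⊆ s → X.Nonempty → (s \ X).Nonempty →
      ∃ u ∈ X, ∃ v ∈ s, v ∉ X ∧ G.Adj u v) : (G.induce s).Connected := by
  have : Nonempty s := hs.to_subtype
  refine ⟨?_⟩
  intro x y
  by_contra hxy
  let X : Set V := {v | ∃ hv : v ∈ s, (G.induce s).Reachable x ⟨v, hv⟩}
  obtain ⟨u, ⟨hu, hu'⟩, v, hv, hv', hadj⟩ := h X (fun v hv => hv.1) ⟨x.1, x.2, SimpleGraph.Reachable.refl _⟩
    ⟨y.1, y.2, fun hy => hxy hy.2⟩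
  refine hv' ⟨hv, hu'.trans (SimpleGraph.Adj.reachable ?_)⟩
  exact hadj

lemma ncard_pair_le {V : Type} (x y : V) : ({x, y} : Set V).ncard ≤ 2 := by
  refine (Set.ncard_insert_le _ _).trans ?_
  simp

lemma third_nbr {V : Type} [Finite V] (G : SimpleGraph V) (hcubic : IsCubic G) (a b c : V)
    (hab : G.Adj a b) (hbc : b ≠ c) (hac : G.Adj a c) :
    ∃ w, G.Adj a w ∧ w ≠ b ∧ w ≠ c ∧ ∀ v, G.Adj a v → v = b ∨ v = c ∨ v = w := by
  have h := hcubic a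
  rw [Set.ncard_eq_three] at h
  obtain ⟨x, y, z, hxy, hxz, hyz, hN⟩ := h
  have hN' : ∀ v, G.Adj a v ↔ v = x ∨ v = y ∨ v = z := by
    intro v
    rw [← SimpleGraph.mem_neighborSet, hN]; simp
  have hb := (hN' b).1 hab
  have hc := (hN' c).1 hac
  have hx := (hN' x).2 (by simp)
  have hy := (hN' y).2 (by simp)
  have hz := (hN' z).2 (by simp)
  rcases hb with rfl | rfl | rfl <;> rcases hc with rfl | rfl | rfl
  all_goals first
    | exact absurd rfl hbc
    | (refine ⟨x, hx, ?_, ?_, ?_⟩ <;> first | assumption | (symm; assumption) | (intro v hv; rcases (hN' v).1 hv with h | h | h <;> simp [h]) ; done)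
    | (refine ⟨y, hy, ?_, ?_, ?_⟩ <;> first | assumption | (symm; assumption) | (intro v hv; rcases (hN' v).1 hv with h | h | h <;> simp [h]) ; done)
    | (refine ⟨z, hz, ?_, ?_, ?_⟩ <;> first | assumption | (symm; assumption) | (intro v hv; rcases (hN' v).1 hv with h | h | h <;> simp [h]) ; done)

/-- two triangle vertices do not share an outer neighbour -/
lemma no_shared {V : Type} [Finite V] (G : SimpleGraph V) (h3 : ThreeConnected G)
    (a b c w : V) (hcard : 4 < Nat.card V)
    (ha : ∀ v, G.Adj a v → v = b ∨ v = c ∨ v = w) (hb : ∀ v, G.Adj b v → v = a ∨ v = c ∨ v = w)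
    (hac : a ≠ c) (hbc : b ≠ c) (haw : a ≠ w) (hbw : b ≠ w) : False := by
  classical
  have := Fintype.ofFinite V
  obtain ⟨y, hy⟩ : ∃ y, y ∉ ({a, b, c, w} : Finset V) := by
    by_contra hcon
    push Not at hcon
    have h1 : Fintype.card V ≤ ({a, b, c, w} : Finset V).card :=
      Finset.card_le_card (fun v _ => hcon v)
    have h2 : ({a, b, c, w} : Finset V).card ≤ 4 := Finset.card_le_four
    rw [Nat.card_eq_fintype_card] at hcard
    omega
  simp only [Finset.mem_insert, Finset.mem_singleton, not_or] at hy
  obtain ⟨u, hu, v, hv, hv', hadj⟩ := cut_of_connected G ({c, w} : Set V)ᶜ {a, b}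
    (h3.2 {c, w} (ncard_pair_le c w)) (by
      rintro v (rfl | rfl) <;> simp [*]) a y (by simp) (by simp [hy]) (by simp [hy])
  simp only [Set.mem_compl_iff, Set.mem_insert_iff, Set.mem_singleton_iff, not_or] at hu hv hv'
  rcases hu with rfl | rfl
  · rcases ha v hadj with h | h | h <;> simp_all
  · rcases hb v hadj with h | h | h <;> simp_all

lemma exists_triData {V : Type} [Finite V] (G : SimpleGraph V) (h3 : ThreeConnected G)
    (hcubic : IsCubic G) (a b c : V) (hab : G.Adj a b) (hbc : G.Adj b c) (hac : G.Adj a c)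
    (hcard : 4 < Nat.card V) : ∃ out, TriData G a b c out := by
  classical
  obtain ⟨a', h1, h2, h3', h4⟩ := third_nbr G hcubic a b c hab hbc.ne hac
  obtain ⟨b', k1, k2, k3, k4⟩ := third_nbr G hcubic b a c hab.symm hac.ne hbc
  obtain ⟨c', l1, l2, l3, l4⟩ := third_nbr G hcubic c a b hac.symm hab.ne hbc.symm
  have e1 : a' ≠ b' := by
    rintro rfl
    exact no_shared G h3 a b c a' hcard h4 k4 hac.ne hbc.ne h1.ne k1.ne
  have e2 : a' ≠ c' := by
    rintro rfl
    exact no_shared G h3 a c b a' hcard (fun v hv => by have := h4 v hv; tauto) l4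
      hab.ne hbc.ne.symm h1.ne l1.ne
  have e3 : b' ≠ c' := by
    rintro rfl
    exact no_shared G h3 b c a b' hcard (fun v hv => by have := k4 v hv; tauto)
      (fun v hv => by have := l4 v hv; tauto) hab.ne.symm hac.ne.symm k1.ne l1.ne
  have n1 := hab.ne
  have n2 := hbc.ne
  have n3 := hac.ne
  have m1 := h1.ne
  have m2 := k1.ne
  have m3 := l1.ne
  refine ⟨fun z => if z = a then a' else if z = b then b' else c', hab, hbc, hac, ?_, ?_, ?_, ?_⟩
  · rintro z (rfl | rfl | rfl)
    · simpa using h1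
    · simpa [n1.symm] using k1
    · simpa [n2.symm, n3.symm] using l1
  · unfold inT
    rintro z (rfl | rfl | rfl) <;> grind
  · unfold inT
    rintro z w (rfl | rfl | rfl) <;> grind
  · unfold inT
    rintro z w (rfl | rfl | rfl) (rfl | rfl | rfl) <;> grind

lemma TriData.adj_of_ne {V : Type} {G : SimpleGraph V} {a b c : V} {out : V → V}
    (h : TriData G a b c out) {x y : V} (hx : inT a b c x) (hy : inT a b c y) (hne : x ≠ y) :
    G.Adj x y := by
  have h1 := h.hab
  have h2 := h.hbc
  have h3 := h.hac
  rcases hx with rfl | rfl | rfl <;> rcases hy with rfl | rfl | rfl <;>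
    first | assumption | (symm; assumption) | exact absurd rfl hne

open Classical in
/-- collapse map -/
noncomputable def col {V : Type} {a b c : V} (hab : a ≠ b) (hac : a ≠ c) (v : V) :
    {x : V // x ≠ b ∧ x ≠ c} :=
  if h : v ≠ b ∧ v ≠ c then ⟨v, h⟩ else ⟨a, hab, hac⟩

lemma col_out {V : Type} {a b c : V} (hab : a ≠ b) (hac : a ≠ c) {v : V} (h : ¬ inT a b c v) :
    (col hab hac v).1 = v := by
  unfold inT at h
  unfold col
  rw [dif_pos (by tauto)]

lemma col_in {V : Type} {a b c : V} (hab : a ≠ b) (hac : a ≠ c) {v : V} (h : inT a b c v) :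
    (col hab hac v).1 = a := by
  unfold col
  rcases h with rfl | rfl | rfl <;> simp [hab, hac]

lemma col_val {V : Type} {a b c : V} (hab : a ≠ b) (hac : a ≠ c) (v : {x : V // x ≠ b ∧ x ≠ c}) :
    col hab hac v.1 = v := by
  unfold col
  rw [dif_pos v.2]

lemma inT_val_iff {V : Type} {a b c : V} (v : {x : V // x ≠ b ∧ x ≠ c}) :
    inT a b c v.1 ↔ v.1 = a := by
  have := v.2
  unfold inT; tauto

lemma inT_col_iff {V : Type} {a b c : V} (hab : a ≠ b) (hac : a ≠ c) (v : V) :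
    inT a b c v ↔ (col hab hac v).1 = a := by
  constructor
  · exact col_in hab hac
  · intro h
    by_contra hv
    rw [col_out hab hac hv] at h
    exact hv (Or.inl h)

lemma contract_adj_iff {V : Type} {G : SimpleGraph V} {a b c : V}
    (hab : a ≠ b) (hac : a ≠ c) (x y : {x : V // x ≠ b ∧ x ≠ c}) :
    (contractTriangle G a b c).Adj x y ↔
      ∃ u v, G.Adj u v ∧ ¬ (inT a b c u ∧ inT a b c v) ∧ col hab hac u = x ∧ col hab hac v = y := by
  unfold contractTriangle
  rw [SimpleGraph.fromRel_adj]
  have ca : col hab hac a = (⟨a, hab, hac⟩ : {x : V // x ≠ b ∧ x ≠ c}) :=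
    Subtype.ext (col_in hab hac (by simp [inT]))
  have cb : col hab hac b = (⟨a, hab, hac⟩ : {x : V // x ≠ b ∧ x ≠ c}) :=
    Subtype.ext (col_in hab hac (by simp [inT]))
  have cc : col hab hac c = (⟨a, hab, hac⟩ : {x : V // x ≠ b ∧ x ≠ c}) :=
    Subtype.ext (col_in hab hac (by simp [inT]))
  constructor
  · rintro ⟨hne, h⟩
    have hn : ¬ (x.1 = a ∧ y.1 = a) := fun h => hne (Subtype.ext (h.1.trans h.2.symm))
    have key : ∀ u v, G.Adj u v → col hab hac u = x → col hab hac v = y →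
        ∃ u v, G.Adj u v ∧ ¬ (inT a b c u ∧ inT a b c v) ∧ col hab hac u = x ∧ col hab hac v = y := by
      intro u v h1 h2 h3
      refine ⟨u, v, h1, ?_, h2, h3⟩
      rw [inT_col_iff hab hac, inT_col_iff hab hac, h2, h3]
      exact hn
    rcases h with (h | ⟨h1, h | h⟩) | (h | ⟨h1, h | h⟩)
    · exact key _ _ h (col_val _ _ _) (col_val _ _ _)
    · exact key _ _ h (by rw [cb]; exact Subtype.ext h1.symm) (col_val _ _ _)
    · exact key _ _ h (by rw [cc]; exact Subtype.ext h1.symm) (col_val _ _ _)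
    · exact key _ _ h.symm (col_val _ _ _) (col_val _ _ _)
    · exact key _ _ h.symm (col_val _ _ _) (by rw [cb]; exact Subtype.ext h1.symm)
    · exact key _ _ h.symm (col_val _ _ _) (by rw [cc]; exact Subtype.ext h1.symm)
  · rintro ⟨u, v, hadj, hn, rfl, rfl⟩
    constructor
    · intro he
      by_cases hu : inT a b c u
      · have hv : ¬ inT a b c v := fun hv => hn ⟨hu, hv⟩
        have := congrArg Subtype.val he
        rw [col_in hab hac hu, col_out hab hac hv] at this
        exact hv (Or.inl this.symm)
      · by_cases hv : inT a b c v
        · have := congrArg Subtype.val he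
          rw [col_in hab hac hv, col_out hab hac hu] at this
          exact hu (Or.inl this)
        · have := congrArg Subtype.val he
          rw [col_out hab hac hv, col_out hab hac hu] at this
          exact hadj.ne this
    · by_cases hu : inT a b c u
      · have hv : ¬ inT a b c v := fun hv => hn ⟨hu, hv⟩
        rw [col_in hab hac hu, col_out hab hac hv]
        rcases hu with rfl | rfl | rfl <;> tauto
      · rw [col_out hab hac hu]
        by_cases hv : inT a b c v
        · rw [col_in hab hac hv]
          have := hadj.symm
          rcases hv with rfl | rfl | rfl <;> tauto
        · rw [col_out hab hac hv]; tauto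

lemma contract_card {V : Type} [Finite V] {a b c : V} (hbc : b ≠ c) :
    Nat.card {x : V // x ≠ b ∧ x ≠ c} + 2 = Nat.card V := by
  classical
  have := Fintype.ofFinite V
  have h1 : Nat.card {x : V // x ≠ b ∧ x ≠ c} = (({b, c} : Finset V)ᶜ).card := by
    rw [Nat.card_eq_fintype_card, Fintype.card_subtype]
    congr 1
    ext x; simp
  have h2 := Finset.card_compl_add_card ({b, c} : Finset V)
  rw [Finset.card_pair hbc] at h2
  rw [h1, h2, Nat.card_eq_fintype_card]

lemma contract_cubic {V : Type} [Finite V] {G : SimpleGraph V} {a b c : V} {out : V → V}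
    (hcubic : IsCubic G) (h : TriData G a b c out) : IsCubic (contractTriangle G a b c) := by
  have hab := h.hab.ne
  have hac := h.hac.ne
  have hbc := h.hbc.ne
  intro x
  by_cases hx : x.1 = a
  · have : (contractTriangle G a b c).neighborSet x =
        (fun z => col hab hac (out z)) '' {a, b, c} := by
      ext y
      rw [SimpleGraph.mem_neighborSet, contract_adj_iff hab hac]
      constructor
      · rintro ⟨u, v, hadj, hn, rfl, rfl⟩
        have hu := (inT_col_iff hab hac u).2 hx
        have hv : ¬ inT a b c v := fun hv => hn ⟨hu, hv⟩
        exact ⟨u, hu, by rw [h.out_uniq u v hu hv hadj]⟩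
      · rintro ⟨z, hz, rfl⟩
        have hz : inT a b c z := hz
        exact ⟨z, out z, h.out_adj z hz, fun hh => h.out_not z hz hh.2,
          Subtype.ext ((col_in hab hac hz).trans hx.symm), rfl⟩
    rw [this, Set.InjOn.ncard_image, Set.ncard_eq_three]
    · exact ⟨a, b, c, hab, hac, hbc, rfl⟩
    · intro z hz w hw hzw
      have hz : inT a b c z := hz
      have hw : inT a b c w := hw
      apply h.out_inj z w hz hw
      have := congrArg Subtype.val hzw
      simpa only [col_out hab hac (h.out_not z hz), col_out hab hac (h.out_not w hw)] using this
  · have hxT : ¬ inT a b c x.1 := fun hh => hx ((inT_val_iff x).1 hh)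
    have : (contractTriangle G a b c).neighborSet x = col hab hac '' G.neighborSet x.1 := by
      ext y
      rw [SimpleGraph.mem_neighborSet, contract_adj_iff hab hac]
      constructor
      · rintro ⟨u, v, hadj, hn, rfl, rfl⟩
        have hu : ¬ inT a b c u := fun hu => hx (col_in hab hac hu)
        refine ⟨v, ?_, rfl⟩
        rw [col_out hab hac hu]
        exact hadj
      · rintro ⟨v, hv, rfl⟩
        exact ⟨x.1, v, hv, fun hh => hxT hh.1, col_val _ _ _, rfl⟩
    rw [this, Set.InjOn.ncard_image, hcubic]
    intro u hu v hv huv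
    have huv := congrArg Subtype.val huv
    have hu : G.Adj x.1 u := hu
    have hv : G.Adj x.1 v := hv
    by_cases hu' : inT a b c u <;> by_cases hv' : inT a b c v
    · exact h.out_inj u v hu' hv' ((h.out_uniq u _ hu' hxT hu.symm).symm.trans
        (h.out_uniq v _ hv' hxT hv.symm))
    · rw [col_in hab hac hu', col_out hab hac hv'] at huv
      exact absurd (Or.inl huv.symm) hv'
    · rw [col_in hab hac hv', col_out hab hac hu'] at huv
      exact absurd (Or.inl huv) hu'
    · rwa [col_out hab hac hv', col_out hab hac hu'] at huv

lemma card_ge_six {V : Type} [Finite V] {G : SimpleGraph V} {a b c : V} {out : V → V}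
    (h : TriData G a b c out) : 6 ≤ Nat.card V := by
  classical
  have := Fintype.ofFinite V
  have hab := h.hab.ne
  have hac := h.hac.ne
  have hbc := h.hbc.ne
  have ha := h.out_not a (by simp [inT])
  have hb := h.out_not b (by simp [inT])
  have hc := h.out_not c (by simp [inT])
  have i1 : out a ≠ out b := fun hh => hab (h.out_inj a b (by simp [inT]) (by simp [inT]) hh)
  have i2 : out a ≠ out c := fun hh => hac (h.out_inj a c (by simp [inT]) (by simp [inT]) hh)
  have i3 : out b ≠ out c := fun hh => hbc (h.out_inj b c (by simp [inT]) (by simp [inT]) hh)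
  unfold inT at ha hb hc
  have h1 : ({a, b, c, out a, out b, out c} : Finset V).card = 6 := by
    repeat rw [Finset.card_insert_of_notMem (by simp; grind)]
    simp
  rw [Nat.card_eq_fintype_card, ← h1]
  exact Finset.card_le_univ _

lemma contract_three_connected {V : Type} [Finite V] {G : SimpleGraph V} {a b c : V} {out : V → V}
    (h3 : ThreeConnected G) (h : TriData G a b c out) :
    ThreeConnected (contractTriangle G a b c) := by
  classical
  have hab := h.hab.ne
  have hac := h.hac.ne
  have hbc := h.hbc.ne
  have hc6 := card_ge_six h
  have hcc := contract_card (V := V) (a := a) hbc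
  refine ⟨by omega, ?_⟩
  intro S hS
  have hSne : Sᶜ.Nonempty := by
    by_contra hcon
    rw [Set.not_nonempty_iff_eq_empty, Set.compl_empty_iff] at hcon
    rw [hcon, Set.ncard_univ] at hS
    omega
  refine connected_of_cut _ _ hSne ?_
  rintro X hXS ⟨x, hx⟩ ⟨y, hyS, hyX⟩
  have key : ∀ u v, G.Adj u v → col hab hac u ∈ X → col hab hac v ∈ Sᶜ → col hab hac v ∉ X →
      ∃ u ∈ X, ∃ v ∈ Sᶜ, v ∉ X ∧ (contractTriangle G a b c).Adj u v := by
    intro u v huv h1 h2 h3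
    refine ⟨_, h1, _, h2, h3, (contract_adj_iff hab hac _ _).2 ⟨u, v, huv, ?_, rfl, rfl⟩⟩
    rintro ⟨hu, hv⟩
    exact h3 (by
      rwa [show col hab hac v = col hab hac u from
        Subtype.ext ((col_in hab hac hv).trans (col_in hab hac hu).symm)])
  let a0 : {x : V // x ≠ b ∧ x ≠ c} := ⟨a, hab, hac⟩
  by_cases haS : a0 ∈ S
  · -- removing the contracted vertex
    by_contra hcon
    let S0 : Set V := Subtype.val '' (S \ {a0})
    have hS0 : S0.ncard ≤ 1 := by
      refine (Set.ncard_image_le (Set.toFinite _)).trans ?_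
      have := Set.ncard_sdiff_singleton_add_one haS
      omega
    have hS0T : ∀ v, v ∈ S0 ↔ ¬ inT a b c v ∧ col hab hac v ∈ S := by
      intro v
      constructor
      · rintro ⟨w, ⟨hw, hw'⟩, rfl⟩
        refine ⟨?_, by rwa [col_val]⟩
        rw [inT_val_iff]
        exact fun hh => hw' (Subtype.ext hh)
      · rintro ⟨h1, h2⟩
        refine ⟨_, ⟨h2, ?_⟩, col_out hab hac h1⟩
        intro hh
        exact h1 ((inT_col_iff hab hac v).2 (congrArg Subtype.val hh))
    -- if a side `Z` touches the triangle in at most one vertex then contradiction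
    have side : ∀ Z : Set {x : V // x ≠ b ∧ x ≠ c}, Z ⊆ Sᶜ → Z.Nonempty →
        (∀ u v, G.Adj u v → col hab hac u ∈ Z → col hab hac v ∈ Sᶜ → col hab hac v ∈ Z) →
        ∀ t, inT a b c t →
        (∀ z, inT a b c z → col hab hac (out z) ∈ Z → z = t) → False := by
      rintro Z hZS ⟨x, hx⟩ hclosed t ht hone
      have hZT : ∀ v, col hab hac v ∈ Z → ¬ inT a b c v := by
        intro v hv hvT
        refine hZS hv ?_
        rwa [show col hab hac v = a0 from Subtype.ext (col_in hab hac hvT)]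
      obtain ⟨t', ht', htt'⟩ : ∃ t', inT a b c t' ∧ t' ≠ t := by
        by_cases hta : t = a
        · exact ⟨b, by simp [inT], by rw [hta]; exact hab.symm⟩
        · exact ⟨a, by simp [inT], fun hh => hta hh.symm⟩
      obtain ⟨u, hu, v, hv, hv', hadj⟩ := cut_of_connected G (insert t S0)ᶜ {v | col hab hac v ∈ Z}
        (h3.2 _ ((Set.ncard_insert_le _ _).trans (by omega)))
        (by
          rintro v hv (rfl | hvS)
          · exact hZT _ hv ht
          · exact hZS hv ((hS0T v).1 hvS).2) x.1 t' (by simpa [col_val] using hx)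
        (by
          rintro (hh | hh)
          · exact htt' hh
          · exact ((hS0T _).1 hh).1 ht') (fun hh => hZT _ hh ht')
      have huT := hZT u hu
      by_cases hvT : inT a b c v
      · have h5 := h.out_uniq v u hvT huT hadj.symm
        have h6 : v = t := hone v hvT (h5 ▸ hu)
        exact hv (Or.inl h6)
      · refine hv' (hclosed u v hadj hu ?_)
        intro hS
        exact hv (Or.inr ((hS0T v).2 ⟨hvT, hS⟩))
    have sideX := side X hXS ⟨x, hx⟩ (fun u v huv hu hv => by
      by_contra hv'
      exact hcon (key u v huv hu hv hv'))
    have sideY := side (Sᶜ \ X) Set.sdiff_subset ⟨y, hyS, hyX⟩ (fun u v huv hu hv => by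
      refine ⟨hv, fun hv' => ?_⟩
      exact hcon (key v u huv.symm hv' hu.1 hu.2))
    have Ta : inT a b c a := by simp [inT]
    have Tb : inT a b c b := by simp [inT]
    have Tc : inT a b c c := by simp [inT]
    have red : ∀ (Z : Set {x : V // x ≠ b ∧ x ≠ c}) t,
        (a ≠ t → col hab hac (out a) ∉ Z) → (b ≠ t → col hab hac (out b) ∉ Z) →
        (c ≠ t → col hab hac (out c) ∉ Z) →
        (∀ z, inT a b c z → col hab hac (out z) ∈ Z → z = t) := by
      intro Z t h1 h2 h3 z hz hzZ
      by_contra hne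
      rcases hz with rfl | rfl | rfl
      · exact h1 hne hzZ
      · exact h2 hne hzZ
      · exact h3 hne hzZ
    by_cases A : col hab hac (out a) ∈ X <;> by_cases B : col hab hac (out b) ∈ X <;>
      by_cases C : col hab hac (out c) ∈ X
    · exact sideY a Ta (red _ _ (fun hh => absurd rfl hh) (fun _ hh => hh.2 B)
        (fun _ hh => hh.2 C))
    · exact sideY c Tc (red _ _ (fun _ hh => hh.2 A) (fun _ hh => hh.2 B)
        (fun hh => absurd rfl hh))
    · exact sideY b Tb (red _ _ (fun _ hh => hh.2 A) (fun hh => absurd rfl hh)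
        (fun _ hh => hh.2 C))
    · exact sideX a Ta (red _ _ (fun hh => absurd rfl hh) (fun _ => B)
        (fun _ => C))
    · exact sideY a Ta (red _ _ (fun hh => absurd rfl hh) (fun _ hh => hh.2 B)
        (fun _ hh => hh.2 C))
    · exact sideX b Tb (red _ _ (fun _ => A) (fun hh => absurd rfl hh)
        (fun _ => C))
    · exact sideX c Tc (red _ _ (fun _ => A) (fun _ => B)
        (fun hh => absurd rfl hh))
    · exact sideX a Ta (red _ _ (fun hh => absurd rfl hh) (fun _ => B)
        (fun _ => C))
  · obtain ⟨u, hu, v, hv, hv', hadj⟩ := cut_of_connected G (Subtype.val '' S)ᶜ {v | col hab hac v ∈ X}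
      (h3.2 _ ((Set.ncard_image_le (Set.toFinite _)).trans hS)) (by
        rintro v hv ⟨w, hw, rfl⟩
        refine hXS hv ?_
        rwa [col_val]) x.1 y.1 (by simpa [col_val] using hx)
        (by
          rintro ⟨w, hw, hh⟩
          exact hyS (by rwa [← Subtype.ext hh])) (by simpa [col_val] using hyX)
    refine key u v hadj hu ?_ hv'
    intro hvS
    by_cases hvT : inT a b c v
    · rw [show col hab hac v = a0 from Subtype.ext (col_in hab hac hvT)] at hvS
      exact haS hvS
    · exact hv ⟨_, hvS, col_out hab hac hvT⟩


lemma lift_walk {V : Type} {G : SimpleGraph V} {a b c : V} (hab : a ≠ b) (hac : a ≠ c)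
    {y x : {x : V // x ≠ b ∧ x ≠ c}} (q : (contractTriangle G a b c).Walk y x)
    (hq : ∀ v ∈ q.support, v.1 ≠ a) :
    ∃ P : G.Walk y.1 x.1, P.support = q.support.map Subtype.val := by
  induction q with
  | nil => exact ⟨SimpleGraph.Walk.nil, by simp⟩
  | @cons u v w hadj q ih =>
    obtain ⟨P, hP⟩ := ih (fun v hv => hq v (by simp [hv]))
    have hu : u.1 ≠ a := hq u (by simp)
    have hv : v.1 ≠ a := hq v (by simp)
    obtain ⟨s, t, hst, -, rfl, rfl⟩ := (contract_adj_iff hab hac _ _).1 hadj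
    have hs : ¬ inT a b c s := fun h => hu (col_in hab hac h)
    have ht : ¬ inT a b c t := fun h => hv (col_in hab hac h)
    have hadj' : G.Adj (col hab hac s).1 (col hab hac t).1 := by
      rwa [col_out hab hac hs, col_out hab hac ht]
    exact ⟨SimpleGraph.Walk.cons hadj' P, by simp [hP]⟩

lemma ham_of_path {V : Type} [Fintype V] [DecidableEq V] {G : SimpleGraph V} {u t w y x : V}
    (P : G.Walk y x) (hP : P.IsPath) (hcov : ∀ v, v ∈ P.support ∨ v = u ∨ v = t ∨ v = w)
    (hu : u ∉ P.support) (ht : t ∉ P.support) (hw : w ∉ P.support)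
    (hut : G.Adj u t) (htw : G.Adj t w) (huw : u ≠ w) (hwy : G.Adj w y) (hxu : G.Adj x u) :
    G.IsHamiltonian := by
  intro _
  let Q : G.Walk t u := SimpleGraph.Walk.cons htw (SimpleGraph.Walk.cons hwy (P.concat hxu))
  have hQs : Q.support = t :: w :: (P.support ++ [u]) := by
    simp [Q, SimpleGraph.Walk.support_concat]
  have hQ : Q.IsPath := by
    rw [SimpleGraph.Walk.isPath_def, hQs]
    have := hP.support_nodup
    have h1 := hut.ne
    have h2 := htw.ne
    simp only [List.nodup_cons, List.mem_cons, List.mem_append, List.nodup_append]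
    grind
  have hcov' : ∀ v, v ∈ Q.support := by
    intro v
    rw [hQs]
    have := hcov v
    simp only [List.mem_cons, List.mem_append]
    tauto
  have hy : y ∈ P.support := P.start_mem_support
  have hx : x ∈ P.support := P.end_mem_support
  refine ⟨u, SimpleGraph.Walk.cons hut Q, ?_⟩
  rw [SimpleGraph.Walk.isHamiltonianCycle_isCycle_and_isHamiltonian_tail,
    SimpleGraph.Walk.cons_isCycle_iff]
  refine ⟨⟨hQ, ?_⟩, ?_⟩
  · intro hmem
    simp only [Q, SimpleGraph.Walk.edges_cons, SimpleGraph.Walk.edges_concat, List.mem_cons,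
      List.concat_eq_append, List.mem_append, List.not_mem_nil, or_false] at hmem
    rcases hmem with h | h | h | h
    · simp only [Sym2.eq_iff] at h
      grind
    · simp only [Sym2.eq_iff] at h
      grind
    · exact ht (SimpleGraph.Walk.snd_mem_support_of_mem_edges _ h)
    · simp only [Sym2.eq_iff] at h
      grind
  · rw [SimpleGraph.Walk.IsPath.isHamiltonian_iff]
    · intro v; simpa using hcov' v
    · simpa using hQ

lemma contract_ham {V : Type} [Fintype V] [DecidableEq V] {G : SimpleGraph V} {a b c : V}
    {out : V → V} (h : TriData G a b c out) (hH : (contractTriangle G a b c).IsHamiltonian) :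
    G.IsHamiltonian := by
  have hab := h.hab.ne
  have hac := h.hac.ne
  have hbc := h.hbc.ne
  have hc6 := card_ge_six h
  have hcc := contract_card (V := V) (a := a) hbc
  have hnt : Nontrivial {x : V // x ≠ b ∧ x ≠ c} := by
    rw [← Finite.one_lt_card_iff_nontrivial]; omega
  let a0 : {x : V // x ≠ b ∧ x ≠ c} := ⟨a, hab, hac⟩
  obtain ⟨p, hp⟩ := hH.exists_isHamiltonianCycle a0
  rw [SimpleGraph.Walk.isHamiltonianCycle_isCycle_and_isHamiltonian_tail] at hp
  obtain ⟨hp1, hp2⟩ := hp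
  cases p with
  | nil => exact absurd hp1 (by simp)
  | @cons _ x _ hax q =>
  rw [SimpleGraph.Walk.cons_isCycle_iff] at hp1
  obtain ⟨hq, hqe⟩ := hp1
  have hcov : ∀ v, v ∈ q.support := by
    intro v; simpa using hp2.mem_support v
  have hrp : q.reverse.IsPath := hq.reverse
  have hre : s(a0, x) ∉ q.reverse.edges := by simpa using hqe
  have hrc : ∀ v, v ∈ q.reverse.support := by simpa using hcov
  generalize q.reverse = r at hrp hre hrc
  cases r with
  | nil => exact absurd rfl hax.ne
  | @cons _ y _ hay r =>
  rw [SimpleGraph.Walk.cons_isPath_iff] at hrp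
  obtain ⟨hr, har⟩ := hrp
  have hxy : x ≠ y := by
    rintro rfl
    exact hre (by simp)
  have hra : ∀ v ∈ r.support, v.1 ≠ a := by
    intro v hv hva
    exact har ((show v = a0 from Subtype.ext hva) ▸ hv)
  obtain ⟨P, hP⟩ := lift_walk hab hac r hra
  have hnb : ∀ z, (contractTriangle G a b c).Adj a0 z → z.1 ≠ a → ∃ u, inT a b c u ∧ G.Adj u z.1 ∧ z.1 = out u := by
    intro z hz hza
    obtain ⟨u, v, huv, hn, h1, rfl⟩ := (contract_adj_iff hab hac _ _).1 hz
    have hu : inT a b c u := (inT_col_iff hab hac u).2 (by rw [h1])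
    have hv : ¬ inT a b c v := fun hv => hn ⟨hu, hv⟩
    rw [col_out hab hac hv]
    exact ⟨u, hu, huv, h.out_uniq u v hu hv huv⟩
  obtain ⟨u, huT, hux, hxo⟩ := hnb x hax (fun hh => hax.ne (Subtype.ext hh.symm))
  obtain ⟨w, hwT, hwy, hyo⟩ := hnb y hay (fun hh => hay.ne (Subtype.ext hh.symm))
  have huw : u ≠ w := by
    rintro rfl
    exact hxy (Subtype.ext (hxo.trans hyo.symm))
  obtain ⟨t, htT, htu, htw, hall⟩ : ∃ t, inT a b c t ∧ t ≠ u ∧ t ≠ w ∧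
      ∀ v, inT a b c v → v = u ∨ v = t ∨ v = w := by
    unfold inT at *
    rcases huT with rfl | rfl | rfl <;> rcases hwT with rfl | rfl | rfl
    all_goals first
      | exact absurd rfl huw
      | (refine ⟨a, ?_⟩; grind)
      | (refine ⟨b, ?_⟩; grind)
      | (refine ⟨c, ?_⟩; grind)
  have hPT : ∀ v, v ∈ P.support ↔ ¬ inT a b c v := by
    intro v
    rw [hP, List.mem_map]
    constructor
    · rintro ⟨v, hv, rfl⟩ hvT
      exact hra v hv ((inT_val_iff v).1 hvT)
    · intro hv
      refine ⟨col hab hac v, ?_, col_out hab hac hv⟩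
      have := hrc (col hab hac v)
      rw [SimpleGraph.Walk.support_cons, List.mem_cons] at this
      rcases this with h1 | h1
      · exact absurd ((inT_col_iff hab hac v).2 (by rw [h1])) hv
      · exact h1
  refine ham_of_path (u := u) (t := t) (w := w) P ?_ ?_ (fun hh => (hPT u).1 hh huT)
    (fun hh => (hPT t).1 hh htT) (fun hh => (hPT w).1 hh hwT) (h.adj_of_ne huT htT htu.symm)
    (h.adj_of_ne htT hwT htw) huw hwy hux.symm
  · rw [SimpleGraph.Walk.isPath_def, hP]
    exact hr.support_nodup.map Subtype.val_injective
  · intro v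
    by_cases hv : inT a b c v
    · exact Or.inr (hall v hv)
    · exact Or.inl ((hPT v).2 hv)


/-- darts inside the triangle -/
def triD {V : Type} {G : SimpleGraph V} (a b c : V) (d : G.Dart) : Prop :=
  inT a b c d.fst ∧ inT a b c d.snd

/-- the maps between darts of the graph and darts of the contraction -/
structure DartMaps {V : Type} (G : SimpleGraph V) (a b c : V) (hab : a ≠ b) (hac : a ≠ c)
    (r : G.Dart → (contractTriangle G a b c).Dart) (i : (contractTriangle G a b c).Dart → G.Dart) :
    Prop where
  ri : ∀ e, r (i e) = e
  nti : ∀ e, ¬ triD a b c (i e)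
  ir : ∀ d, ¬ triD a b c d → i (r d) = d
  fst : ∀ d, (r d).fst = col hab hac d.fst
  snd : ∀ d, ¬ triD a b c d → (r d).snd = col hab hac d.snd
  tri : ∀ d d', triD a b c d → ¬ triD a b c d' → d'.fst = d.fst → r d = r d'

lemma nontri_unique {V : Type} {G : SimpleGraph V} {a b c : V} {out : V → V}
    (h : TriData G a b c out) (d d' : G.Dart) (hd : ¬ triD a b c d) (hd' : ¬ triD a b c d')
    (hT : inT a b c d.fst) (hf : d'.fst = d.fst) : d = d' := by
  have h1 : ¬ inT a b c d.snd := fun hh => hd ⟨hT, hh⟩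
  have h2 : ¬ inT a b c d'.snd := fun hh => hd' ⟨hf ▸ hT, hh⟩
  have e1 := h.out_uniq _ _ hT h1 d.adj
  have e2 := h.out_uniq _ _ (hf ▸ hT) h2 d'.adj
  refine SimpleGraph.Dart.ext _ _ (Prod.ext hf.symm ?_)
  rw [e1, e2, hf]

lemma triD_symm {V : Type} {G : SimpleGraph V} {a b c : V} (d : G.Dart) :
    triD a b c d.symm ↔ triD a b c d := by
  unfold triD; exact and_comm

lemma exists_dartMaps {V : Type} {G : SimpleGraph V} {a b c : V} {out : V → V}
    (h : TriData G a b c out) :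
    ∃ r i, DartMaps G a b c h.hab.ne h.hac.ne r i := by
  classical
  have hab := h.hab.ne
  have hac := h.hac.ne
  let ex : G.Dart → G.Dart := fun d =>
    if hd : triD a b c d then ⟨(d.fst, out d.fst), h.out_adj _ hd.1⟩ else d
  have hex1 : ∀ d, ¬ triD a b c d → ex d = d := fun d hd => dif_neg hd
  have hex2 : ∀ d, triD a b c d → (ex d).snd = out d.fst := fun d hd => by
    simp only [ex, dif_pos hd]
  have hex3 : ∀ d, (ex d).fst = d.fst := fun d => by
    by_cases hd : triD a b c d
    · simp only [ex, dif_pos hd]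
    · rw [hex1 d hd]
  have hexn : ∀ d, ¬ triD a b c (ex d) := by
    intro d
    by_cases hd : triD a b c d
    · intro hh
      have := hh.2
      rw [hex2 d hd] at this
      exact h.out_not _ hd.1 this
    · rwa [hex1 d hd]
  let r : G.Dart → (contractTriangle G a b c).Dart := fun d =>
    ⟨(col hab hac (ex d).fst, col hab hac (ex d).snd),
      (contract_adj_iff hab hac _ _).2 ⟨_, _, (ex d).adj, hexn d, rfl, rfl⟩⟩
  have hsur : ∀ e, ∃ d, ¬ triD a b c d ∧ r d = e := by
    intro e
    obtain ⟨u, v, huv, hn, h1, h2⟩ := (contract_adj_iff hab hac _ _).1 e.adj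
    have hn' : ¬ triD a b c (⟨(u, v), huv⟩ : G.Dart) := hn
    refine ⟨⟨(u, v), huv⟩, hn', ?_⟩
    refine SimpleGraph.Dart.ext _ _ (Prod.ext ?_ ?_)
    · change col hab hac (ex _).fst = e.fst
      rw [hex1 _ hn']; exact h1
    · change col hab hac (ex _).snd = e.snd
      rw [hex1 _ hn']; exact h2
  choose i hi1 hi2 using hsur
  have hinj : ∀ d d', ¬ triD a b c d → ¬ triD a b c d' → r d = r d' → d = d' := by
    intro d d' hd hd' he
    have e1 : col hab hac (ex d).fst = col hab hac (ex d').fst := congrArg (fun e => e.fst) he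
    have e2 : col hab hac (ex d).snd = col hab hac (ex d').snd := congrArg (fun e => e.snd) he
    rw [hex1 d hd, hex1 d' hd'] at e1 e2
    have caseIn : ∀ d d' : G.Dart, ¬ triD a b c d → ¬ triD a b c d' →
        col hab hac d.fst = col hab hac d'.fst → 
        col hab hac d.snd = col hab hac d'.snd → inT a b c d.fst → d = d' := by
      intro d d' hd hd' e1 e2 hT
      have hT' : inT a b c d'.fst := (inT_col_iff hab hac _).2 (by
        rw [← e1]; exact col_in hab hac hT)
      have h1 : ¬ inT a b c d.snd := fun hh => hd ⟨hT, hh⟩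
      have h2 : ¬ inT a b c d'.snd := fun hh => hd' ⟨hT', hh⟩
      have e3 := congrArg Subtype.val e2
      rw [col_out hab hac h1, col_out hab hac h2] at e3
      have f1 := h.out_uniq _ _ hT h1 d.adj
      have f2 := h.out_uniq _ _ hT' h2 d'.adj
      have := h.out_inj _ _ hT hT' (by rw [← f1, ← f2, e3])
      exact nontri_unique h d d' hd hd' hT this.symm
    by_cases hT : inT a b c d.fst
    · exact caseIn d d' hd hd' e1 e2 hT
    by_cases hT2 : inT a b c d.snd
    · have := caseIn d.symm d'.symm (by rwa [triD_symm]) (by rwa [triD_symm]) e2 e1 hT2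
      rw [← d.symm_symm, this, d'.symm_symm]
    · have hT' : ¬ inT a b c d'.fst := by
        rw [inT_col_iff hab hac, ← e1, ← inT_col_iff hab hac]; exact hT
      have hT2' : ¬ inT a b c d'.snd := by
        rw [inT_col_iff hab hac, ← e2, ← inT_col_iff hab hac]; exact hT2
      have e1 := congrArg Subtype.val e1
      have e2 := congrArg Subtype.val e2
      rw [col_out hab hac hT, col_out hab hac hT'] at e1
      rw [col_out hab hac hT2, col_out hab hac hT2'] at e2
      exact SimpleGraph.Dart.ext _ _ (Prod.ext e1 e2)
  refine ⟨r, i, hi2, hi1, ?_, ?_, ?_, ?_⟩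
  · intro d hd
    exact hinj _ _ (hi1 _) hd (hi2 _)
  · intro d
    change col hab hac (ex d).fst = _
    rw [hex3]
  · intro d hd
    change col hab hac (ex d).snd = _
    rw [hex1 d hd]
  · intro d d' hd hd' hf
    have : ex d = d' := nontri_unique h _ _ (hexn d) hd' (by rw [hex3]; exact hd.1)
      (by rw [hex3, hf])
    have h2 : ex d' = ex d := by rw [this, hex1 d' hd']
    refine SimpleGraph.Dart.ext _ _ (Prod.ext ?_ ?_)
    · change col hab hac (ex d).fst = col hab hac (ex d').fst
      rw [h2]
    · change col hab hac (ex d).snd = col hab hac (ex d').snd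
      rw [h2]

open Classical in
/-- flip of the darts outside the triangle -/
noncomputable def flipH {V : Type} (G : SimpleGraph V) (a b c : V) : Equiv.Perm G.Dart :=
  Function.Involutive.toPerm (fun d => if triD a b c d then d else d.symm) (by
    intro d
    by_cases hd : triD a b c d
    · simp [hd]
    · simp [hd, triD_symm])

lemma flipH_tri {V : Type} {G : SimpleGraph V} {a b c : V} (d : G.Dart) (hd : triD a b c d) :
    flipH G a b c d = d := if_pos hd

lemma flipH_nontri {V : Type} {G : SimpleGraph V} {a b c : V} (d : G.Dart) (hd : ¬ triD a b c d) :
    flipH G a b c d = d.symm := if_neg hd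

lemma flipH_sq {V : Type} (G : SimpleGraph V) (a b c : V) : flipH G a b c * flipH G a b c = 1 := by
  ext1 d
  rw [Perm.mul_apply]
  by_cases hd : triD a b c d
  · rw [flipH_tri d hd, flipH_tri d hd]; rfl
  · rw [flipH_nontri d hd, flipH_nontri _ (by rwa [triD_symm]), SimpleGraph.Dart.symm_symm]; rfl

lemma dartFlip_eq {V : Type} {G : SimpleGraph V} [DecidableEq G.Dart] {a b c : V} (x y z : V)
    (hT : ∀ v, inT a b c v ↔ v = x ∨ v = y ∨ v = z)
    (hxy : G.Adj x y) (hxz : G.Adj x z) (hyz : G.Adj y z) :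
    dartFlip G = flipH G a b c *
      swap (⟨(x, y), hxy⟩ : G.Dart) ⟨(y, x), hxy.symm⟩ *
      swap (⟨(x, z), hxz⟩ : G.Dart) ⟨(z, x), hxz.symm⟩ *
      swap (⟨(y, z), hyz⟩ : G.Dart) ⟨(z, y), hyz.symm⟩ := by
  have n1 := hxy.ne
  have n2 := hxz.ne
  have n3 := hyz.ne
  ext1 d
  have hd0 : dartFlip G d = d.symm := rfl
  rw [hd0, Perm.mul_apply, Perm.mul_apply, Perm.mul_apply]
  by_cases hd : triD a b c d
  · have key : ∀ e, triD a b c e → e = d.symm → d.symm = flipH G a b c e := by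
      intro e he h
      rw [flipH_tri e he, h]
    obtain ⟨⟨u, v⟩, huv⟩ := d
    have hne : u ≠ v := huv.ne
    have h1 : u = x ∨ u = y ∨ u = z := (hT _).1 hd.1
    have h2 : v = x ∨ v = y ∨ v = z := (hT _).1 hd.2
    have hs := (triD_symm _).2 hd
    have hsw : (swap (⟨(x, y), hxy⟩ : G.Dart) ⟨(y, x), hxy.symm⟩)
      ((swap (⟨(x, z), hxz⟩ : G.Dart) ⟨(z, x), hxz.symm⟩)
      ((swap (⟨(y, z), hyz⟩ : G.Dart) ⟨(z, y), hyz.symm⟩) ⟨(u, v), huv⟩)) =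
        (⟨(u, v), huv⟩ : G.Dart).symm := by
      rcases h1 with rfl | rfl | rfl <;> rcases h2 with rfl | rfl | rfl <;>
        first
        | exact absurd rfl hne
        | simp [swap_apply_def, SimpleGraph.Dart.ext_iff, n1, n2, n3, n1.symm, n2.symm, n3.symm]
    rw [hsw]
    exact key _ hs rfl
  · have hne : ∀ u v (huv : G.Adj u v), inT a b c u → inT a b c v → d ≠ ⟨(u, v), huv⟩ := by
      rintro u v huv hu hv rfl
      exact hd ⟨hu, hv⟩
    have Tx := (hT x).2 (by simp)
    have Ty := (hT y).2 (by simp)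
    have Tz := (hT z).2 (by simp)
    rw [swap_apply_of_ne_of_ne (hne _ _ _ Ty Tz) (hne _ _ _ Tz Ty),
      swap_apply_of_ne_of_ne (hne _ _ _ Tx Tz) (hne _ _ _ Tz Tx),
      swap_apply_of_ne_of_ne (hne _ _ _ Tx Ty) (hne _ _ _ Ty Tx), flipH_nontri d hd]

instance dart_finite {V : Type} [Finite V] (G : SimpleGraph V) : Finite G.Dart :=
  Finite.of_injective (fun d : G.Dart => d.toProd) SimpleGraph.Dart.toProd_injective

lemma cubic_dart_card {V : Type} [Finite V] (G : SimpleGraph V) (h : IsCubic G) :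
    Nat.card G.Dart = 3 * Nat.card V := by
  classical
  have := Fintype.ofFinite V
  rw [Nat.card_eq_fintype_card, G.dart_card_eq_sum_degrees, Nat.card_eq_fintype_card,
    Finset.sum_congr rfl (fun v _ => ?_), Finset.sum_const, Finset.card_univ, smul_eq_mul, mul_comm]
  rw [← SimpleGraph.card_neighborSet_eq_degree, ← h v, Set.ncard_eq_toFinset_card', Set.toFinset_card]

lemma conn_card {V : Type} (G : SimpleGraph V) (h3 : ThreeConnected G) :
    Nat.card G.ConnectedComponent = 1 := by
  have h := h3.2 ∅ (by simp)
  rw [Set.compl_empty] at h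
  have hc : G.Connected := (SimpleGraph.induceUnivIso G).connected_iff.1 h
  have := hc.preconnected.subsingleton_connectedComponent
  have := hc.nonempty
  rw [Nat.card_eq_one_iff_unique]
  exact ⟨inferInstance, ⟨G.connectedComponentMk (Classical.arbitrary V)⟩⟩


lemma sc_step {D : Type} (π : Perm D) (d : D) : SameCycle π d (π d) := ⟨1, by simp⟩

lemma rot_pow_fst {V : Type} {G : SimpleGraph V} (σ : Perm G.Dart) (h1 : ∀ d, (σ d).fst = d.fst)
    (n : ℕ) (d : G.Dart) : ((σ ^ n) d).fst = d.fst := by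
  induction n with
  | zero => rfl
  | succ n ih => rw [pow_succ', Perm.mul_apply, h1, ih]

/-- inside a triangle vertex all darts are in the same cycle of the face permutation of `H` -/
lemma tri_cycle {V : Type} [Finite V] {G : SimpleGraph V} {a b c : V} {out : V → V}
    (h : TriData G a b c out) (σ : Perm G.Dart) (h1 : ∀ d, (σ d).fst = d.fst)
    (h2 : ∀ d d', d.fst = d'.fst → SameCycle σ d d') (d z : G.Dart) (hT : inT a b c d.fst)
    (hz : ¬ triD a b c z) (hf : z.fst = d.fst) : SameCycle (σ * flipH G a b c) d z := by
  by_contra hcon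
  have key : ∀ n : ℕ, SameCycle (σ * flipH G a b c) d ((σ ^ n) d) := by
    intro n
    induction n with
    | zero => exact SameCycle.refl _ _
    | succ n ih =>
      have hn : (σ ^ n) d ≠ z := fun hh => hcon (hh ▸ ih)
      have hfst := rot_pow_fst σ h1 n d
      have htri : triD a b c ((σ ^ n) d) := by
        by_contra hnt
        exact hn (nontri_unique h _ _ hnt hz (by rw [hfst]; exact hT) (by rw [hfst, hf]))
      refine ih.trans ?_
      have := sc_step (σ * flipH G a b c) ((σ ^ n) d)
      rw [Perm.mul_apply, flipH_tri _ htri] at this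
      rwa [pow_succ', Perm.mul_apply]
  obtain ⟨n, hn⟩ := (h2 d z hf.symm).exists_nat_pow_eq
  exact hcon (hn ▸ key n)

lemma vertex_cycle {V : Type} [Finite V] {G : SimpleGraph V} {a b c : V} {out : V → V}
    (h : TriData G a b c out) (σ : Perm G.Dart) (h1 : ∀ d, (σ d).fst = d.fst)
    (h2 : ∀ d d', d.fst = d'.fst → SameCycle σ d d') (d d' : G.Dart) (hT : inT a b c d.fst)
    (hf : d'.fst = d.fst) : SameCycle (σ * flipH G a b c) d d' := by
  let z : G.Dart := ⟨(d.fst, out d.fst), h.out_adj _ hT⟩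
  have hz : ¬ triD a b c z := fun hh => h.out_not _ hT hh.2
  exact (tri_cycle h σ h1 h2 d z hT hz rfl).trans
    (tri_cycle h σ h1 h2 d' z (hf ▸ hT) hz hf.symm).symm

lemma cyc_rot_ge {V : Type} [Finite V] {G : SimpleGraph V} (hcubic : IsCubic G)
    (σ : Perm G.Dart) (h1 : ∀ d, (σ d).fst = d.fst) : Nat.card V ≤ cyc σ := by
  let f : Quotient (SameCycle.setoid σ) → V := Quotient.lift (fun d : G.Dart => d.fst) (by
    intro d d' hdd
    have : SameCycle σ d d' := hdd
    obtain ⟨n, rfl⟩ := this.exists_nat_pow_eq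
    exact (rot_pow_fst σ h1 n d).symm)
  refine Nat.card_le_card_of_surjective f ?_
  intro v
  have : (G.neighborSet v).Nonempty := by
    rw [← Set.ncard_pos, hcubic v]; omega
  obtain ⟨w, hw⟩ := this
  exact ⟨Quotient.mk _ ⟨(v, w), hw⟩, rfl⟩

lemma orbits_one {V : Type} [Finite V] {G : SimpleGraph V} {a b c : V} {out : V → V}
    (h3 : ThreeConnected G) (h : TriData G a b c out) (σ : Perm G.Dart)
    (h2 : ∀ d d', d.fst = d'.fst → SameCycle σ d d') :
    Nat.card (Quotient (SameCycle.setoid σ ⊔ SameCycle.setoid (flipH G a b c))) = 1 := by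
  set R := SameCycle.setoid σ ⊔ SameCycle.setoid (flipH G a b c) with hR
  have hσR : ∀ u v : G.Dart, u.fst = v.fst → R u v := fun u v huv =>
    (le_sup_left : _ ≤ R) (h2 u v huv)
  have hαR : ∀ u : G.Dart, ¬ triD a b c u → R u u.symm := fun u hu =>
    (le_sup_right : _ ≤ R) (by
      have := sc_step (flipH G a b c) u
      rw [flipH_nontri u hu] at this
      exact this)
  have Ta : inT a b c a := by simp [inT]
  let d0 : G.Dart := ⟨(a, out a), h.out_adj a Ta⟩
  have hmain : ∀ v, v ≠ b → v ≠ c → ∀ d : G.Dart, d.fst = v → R d d0 := by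
    by_contra hcon
    push Not at hcon
    obtain ⟨y, hyb, hyc, d, hd, hdR⟩ := hcon
    obtain ⟨u, hu, v, hv, hv', hadj⟩ := cut_of_connected G ({b, c} : Set V)ᶜ
      {v | (v ≠ b ∧ v ≠ c) ∧ ∀ d : G.Dart, d.fst = v → R d d0}
      (h3.2 _ (ncard_pair_le b c)) (by
        rintro v ⟨hv, -⟩
        simpa using hv) a y ⟨⟨h.hab.ne, h.hac.ne⟩, fun d hd => hσR _ _ hd⟩ (by simp [hyb, hyc])
        (fun hh => hdR (hh.2 d hd))
    have hvbc : v ≠ b ∧ v ≠ c := by simpa using hv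
    refine hv' ⟨hvbc, fun d hd => ?_⟩
    let e : G.Dart := ⟨(u, v), hadj⟩
    have he : ¬ triD a b c e := by
      rintro ⟨h1, h2⟩
      have h1 : u = a ∨ u = b ∨ u = c := h1
      have h2 : v = a ∨ v = b ∨ v = c := h2
      have := hu.1
      have := hadj.ne
      grind
    exact R.trans' (hσR d e.symm hd) (R.trans' (R.symm' (hαR e he)) (hu.2 e rfl))
  have hall : ∀ d, R d d0 := by
    intro d
    by_cases hd : inT a b c d.fst
    · let e : G.Dart := ⟨(d.fst, out d.fst), h.out_adj _ hd⟩
      have ho := h.out_not _ hd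
      have he : ¬ triD a b c e := fun hh => ho hh.2
      refine R.trans' (hσR d e rfl) (R.trans' (hαR e he) (hmain (out d.fst) ?_ ?_ _ rfl))
      · rintro hh; exact ho (Or.inr (Or.inl hh))
      · rintro hh; exact ho (Or.inr (Or.inr hh))
    · refine hmain d.fst ?_ ?_ d rfl
      · rintro hh; exact hd (Or.inr (Or.inl hh))
      · rintro hh; exact hd (Or.inr (Or.inr hh))
  rw [Nat.card_eq_one_iff_unique]
  refine ⟨⟨?_⟩, ⟨Quotient.mk _ d0⟩⟩
  intro q1 q2
  induction q1 using Quotient.inductionOn with | _ u =>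
  induction q2 using Quotient.inductionOn with | _ v =>
  exact Quotient.sound (R.trans' (hall u) (R.symm' (hall v)))

lemma supp_card_le {V : Type} [Finite V] {G : SimpleGraph V} [Fintype G.Dart] [DecidableEq G.Dart]
    {a b c : V} {hab : a ≠ b} {hac : a ≠ c}
    {r : G.Dart → (contractTriangle G a b c).Dart} {i : (contractTriangle G a b c).Dart → G.Dart}
    (hm : DartMaps G a b c hab hac r i) :
    (flipH G a b c).support.card ≤ Nat.card (contractTriangle G a b c).Dart := by
  classical
  have := Fintype.ofFinite (contractTriangle G a b c).Dart
  rw [Nat.card_eq_fintype_card]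
  have hs : ∀ d ∈ (flipH G a b c).support, ¬ triD a b c d := by
    intro d hd ht
    exact (mem_support.1 hd) (flipH_tri d ht)
  refine Finset.card_le_card_of_injOn r (fun d _ => Finset.mem_univ _) ?_
  intro d hd d' hd' he
  rw [← hm.ir d (hs d hd), ← hm.ir d' (hs d' hd'), he]

lemma inT_swap {V : Type} {a b c : V} (v : V) : inT a b c v ↔ v = a ∨ v = c ∨ v = b := by
  unfold inT; tauto

lemma face_facts {V : Type} [Finite V] {G : SimpleGraph V} {a b c : V} {out : V → V}
    (h3 : ThreeConnected G) (hcubic : IsCubic G) (h : TriData G a b c out) (σ : Perm G.Dart)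
    (h1 : ∀ d, (σ d).fst = d.fst) (h2 : ∀ d d', d.fst = d'.fst → SameCycle σ d d')
    (hE : Nat.card V + cyc (σ * dartFlip G) = Nat.card G.Dart / 2 + 1 + 1) :
    cyc (σ * dartFlip G) = cyc (σ * flipH G a b c) + 3 ∧
    SameCycle (σ * flipH G a b c) ⟨(a, b), h.hab⟩ ⟨(b, a), h.hab.symm⟩ ∧
    SameCycle (σ * flipH G a b c) ⟨(a, c), h.hac⟩ ⟨(c, a), h.hac.symm⟩ := by
  classical
  have := Fintype.ofFinite G.Dart
  obtain ⟨r, i, hm⟩ := exists_dartMaps h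
  have hc6 := card_ge_six h
  have hcc := contract_card (V := V) (a := a) h.hbc.ne
  have hg := genus_nonneg σ _ (flipH G a b c) (flipH_sq G a b c) le_rfl
  rw [orbits_one h3 h σ h2] at hg
  have hs := supp_card_le hm
  rw [cubic_dart_card _ (contract_cubic hcubic h)] at hs
  rw [cubic_dart_card _ hcubic] at hE
  have hr := cyc_rot_ge hcubic σ h1
  have bound : ∀ x y z (hT : ∀ v, inT a b c v ↔ v = x ∨ v = y ∨ v = z)
      (hxy : G.Adj x y) (_ : G.Adj x z) (_ : G.Adj y z),
      cyc (σ * dartFlip G) ≤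
        cyc (σ * flipH G a b c * swap (⟨(x, y), hxy⟩ : G.Dart) ⟨(y, x), hxy.symm⟩) + 2 := by
    intro x y z hT hxy hxz hyz
    rw [dartFlip_eq x y z hT hxy hxz hyz, ← mul_assoc, ← mul_assoc, ← mul_assoc]
    have e1 := cyc_le (σ * flipH G a b c * swap (⟨(x, y), hxy⟩ : G.Dart) ⟨(y, x), hxy.symm⟩ *
      swap (⟨(x, z), hxz⟩ : G.Dart) ⟨(z, x), hxz.symm⟩) (⟨(y, z), hyz⟩ : G.Dart) ⟨(z, y), hyz.symm⟩
    have e2 := cyc_le (σ * flipH G a b c * swap (⟨(x, y), hxy⟩ : G.Dart) ⟨(y, x), hxy.symm⟩)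
      (⟨(x, z), hxz⟩ : G.Dart) ⟨(z, x), hxz.symm⟩
    omega
  have b1 := bound a b c (fun v => Iff.rfl) h.hab h.hac h.hbc
  have b2 := bound a c b inT_swap h.hac h.hab h.hbc.symm
  refine ⟨?_, ?_, ?_⟩
  · have := cyc_le (σ * flipH G a b c) (⟨(a, b), h.hab⟩ : G.Dart) ⟨(b, a), h.hab.symm⟩
    omega
  · by_contra hcon
    have := cyc_merge _ _ _ hcon
    omega
  · by_contra hcon
    have := cyc_merge _ _ _ hcon
    omega

/-- The rotation of the contraction that fixes the darts at the contracted vertex. -/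
lemma exists_rot0 {V : Type} [Finite V] {G : SimpleGraph V} {a b c : V} {hab : a ≠ b} {hac : a ≠ c}
    {r : G.Dart → (contractTriangle G a b c).Dart} {i : (contractTriangle G a b c).Dart → G.Dart}
    (hm : DartMaps G a b c hab hac r i) (σ : Perm G.Dart) (h1 : ∀ d, (σ d).fst = d.fst) :
    ∃ ρ : Perm (contractTriangle G a b c).Dart,
      (∀ e, e.fst.1 = a → ρ e = e) ∧ (∀ e, e.fst.1 ≠ a → ρ e = r (σ (i e))) := by
  classical
  let f : (contractTriangle G a b c).Dart → (contractTriangle G a b c).Dart :=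
    fun e => if e.fst.1 = a then e else r (σ (i e))
  have hfi : ∀ e, e.fst = col hab hac (i e).fst := fun e => by rw [← hm.fst, hm.ri]
  have f1 : ∀ e, e.fst.1 = a → f e = e := fun e he => if_pos he
  have f2 : ∀ e, e.fst.1 ≠ a → f e = r (σ (i e)) := fun e he => if_neg he
  have f3 : ∀ e, (f e).fst = e.fst := by
    intro e
    by_cases he : e.fst.1 = a
    · rw [f1 e he]
    · rw [f2 e he, hm.fst, h1, ← hfi]
  have f4 : ∀ e, e.fst.1 ≠ a → i (f e) = σ (i e) := by
    intro e he
    rw [f2 e he, hm.ir]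
    rintro ⟨hh, -⟩
    rw [h1, inT_col_iff hab hac, ← hfi] at hh
    exact he hh
  have hinj : Function.Injective f := by
    intro e e' hee
    have hf : e.fst = e'.fst := by rw [← f3 e, ← f3 e', hee]
    by_cases he : e.fst.1 = a
    · rwa [f1 e he, f1 e' (hf ▸ he)] at hee
    · have h5 := f4 e he
      have h6 := f4 e' (hf ▸ he)
      rw [hee, h6] at h5
      have := σ.injective h5
      rw [← hm.ri e, ← hm.ri e', this]
  exact ⟨Equiv.ofBijective f (Finite.injective_iff_bijective.1 hinj), f1, f2⟩

lemma contract_planar {V : Type} [Fintype V] [DecidableEq V] {G : SimpleGraph V} {a b c : V}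
    {out : V → V} (h3 : ThreeConnected G) (hcubic : IsCubic G) (h : TriData G a b c out)
    (hpl : IsPlanar G) : IsPlanar (contractTriangle G a b c) := by
  classical
  obtain ⟨σ, h1, h2, hE⟩ := hpl
  have h1 : ∀ d, (σ d).fst = d.fst := h1
  have h2 : ∀ d d' : G.Dart, d.fst = d'.fst → SameCycle σ d d' := h2
  have hab := h.hab.ne
  have hac := h.hac.ne
  have hbc := h.hbc.ne
  have hE : Nat.card V + cyc (σ * dartFlip G) = Nat.card G.Dart / 2 + 1 + 1 := by
    rw [conn_card G h3] at hE; exact hE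
  obtain ⟨hF, sab, sac⟩ := face_facts h3 hcubic h σ h1 h2 hE
  obtain ⟨r, i, hm⟩ := exists_dartMaps h
  obtain ⟨ρ, hρ1, hρ2⟩ := exists_rot0 hm σ h1
  set φ := σ * flipH G a b c with hφ
  let α' := dartFlip (contractTriangle G a b c)
  have hα' : ∀ e, α' e = e.symm := fun _ => rfl
  have hfi : ∀ e, e.fst = col hab hac (i e).fst := fun e => by rw [← hm.fst, hm.ri]
  have hTi : ∀ e, inT a b c (i e).fst ↔ e.fst.1 = a := fun e => by
    rw [inT_col_iff hab hac, ← hfi]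
  have hrT : ∀ d, inT a b c d.fst ↔ (r d).fst.1 = a := fun d => by
    rw [inT_col_iff hab hac, ← hm.fst]
  have hsymm : ∀ d, ¬ triD a b c d → (r d).symm = r d.symm := by
    intro d hd
    have hd' : ¬ triD a b c d.symm := by rwa [triD_symm]
    refine SimpleGraph.Dart.ext _ _ (Prod.ext ?_ ?_)
    · exact (hm.snd d hd).trans (hm.fst d.symm).symm
    · exact (hm.fst d).trans (hm.snd d.symm hd').symm
  -- darts at a triangle vertex all retract to the same dart
  have hsame : ∀ d d', inT a b c d.fst → d'.fst = d.fst → r d = r d' := by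
    intro d d' hT hf
    by_cases hd : triD a b c d <;> by_cases hd' : triD a b c d'
    · let z : G.Dart := ⟨(d.fst, out d.fst), h.out_adj _ hT⟩
      have hz : ¬ triD a b c z := fun hh => h.out_not _ hT hh.2
      rw [hm.tri d z hd hz rfl, hm.tri d' z hd' hz hf.symm]
    · exact hm.tri d d' hd hd' hf
    · exact (hm.tri d' d hd' hd hf.symm).symm
    · rw [nontri_unique h d d' hd hd' hT hf]
  have p1 : ∀ d, SameCycle φ (i (r d)) d := by
    intro d
    by_cases hd : triD a b c d
    · have hf : (i (r d)).fst = d.fst := by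
        let z : G.Dart := ⟨(d.fst, out d.fst), h.out_adj _ hd.1⟩
        have hz : ¬ triD a b c z := fun hh => h.out_not _ hd.1 hh.2
        rw [hm.tri d z hd hz rfl, hm.ir z hz]
      exact (vertex_cycle h σ h1 h2 d (i (r d)) hd.1 hf).symm
    · rw [hm.ir d hd]
  have p2 : ∀ d, triD a b c d → r (φ d) = r d := by
    intro d hd
    rw [hφ, Perm.mul_apply, flipH_tri d hd]
    exact (hsame d (σ d) hd.1 (h1 d)).symm
  have p3 : ∀ d, ¬ triD a b c d → r (φ d) = (ρ * α') (r d) := by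
    intro d hd
    have hd' : ¬ triD a b c d.symm := by rwa [triD_symm]
    rw [hφ, Perm.mul_apply, Perm.mul_apply, flipH_nontri d hd, hα', hsymm d hd]
    by_cases hT : inT a b c d.symm.fst
    · rw [hρ1 _ ((hrT _).1 hT)]
      exact (hsame _ _ hT (h1 _)).symm
    · rw [hρ2 _ (fun hh => hT ((hrT _).2 hh)), hm.ir _ hd']
  have q3 : ∀ d, SameCycle (ρ * α') (r d) (r (φ d)) := by
    intro d
    by_cases hd : triD a b c d
    · rw [p2 d hd]
    · rw [p3 d hd]; exact sc_step _ _
  have q4 : ∀ e, SameCycle φ (i e) (i ((ρ * α') e)) := by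
    intro e
    have : (ρ * α') e = r (φ (i e)) := by rw [p3 _ (hm.nti e), hm.ri]
    rw [this]
    exact (sc_step φ (i e)).trans (p1 _).symm
  have hcyc : cyc (ρ * α') = cyc φ := cyc_retract φ (ρ * α') i r hm.ri p1 q3 q4
  have hsc := sameCycle_retract φ (ρ * α') i r hm.ri q3 q4
  have Ta : inT a b c a := by simp [inT]
  have Tb : inT a b c b := by simp [inT]
  have Tc : inT a b c c := by simp [inT]
  -- outgoing darts
  let Z : ∀ z, inT a b c z → G.Dart := fun z hz => ⟨(z, out z), h.out_adj z hz⟩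
  have hZ : ∀ z hz, ¬ triD a b c (Z z hz) := fun z hz hh => h.out_not z hz hh.2
  let W : ∀ z, inT a b c z → (contractTriangle G a b c).Dart := fun z hz => r (Z z hz).symm
  have hiW : ∀ z hz, i (W z hz) = (Z z hz).symm := fun z hz =>
    hm.ir _ (by rw [triD_symm]; exact hZ z hz)
  have hWs : ∀ z hz, (W z hz).symm = r (Z z hz) := fun z hz => by
    change (r (Z z hz).symm).symm = _
    rw [hsymm _ (by rw [triD_symm]; exact hZ z hz), SimpleGraph.Dart.symm_symm]
  have hZZ : ∀ z hz, SameCycle φ (Z z hz).symm (Z z hz) := by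
    intro z hz
    have h5 := sc_step φ (Z z hz).symm
    rw [hφ, Perm.mul_apply, flipH_nontri _ (by rw [triD_symm]; exact hZ z hz),
      SimpleGraph.Dart.symm_symm, ← hφ] at h5
    refine h5.trans (vertex_cycle h σ h1 h2 (Z z hz) _ hz (h1 _)).symm
  have hWab : SameCycle (ρ * α') (W a Ta) (W b Tb) := by
    rw [hsc, hiW a Ta, hiW b Tb]
    exact ((hZZ a Ta).trans (vertex_cycle h σ h1 h2 (Z a Ta) ⟨(a, b), h.hab⟩ Ta rfl)).trans
      (sab.trans ((vertex_cycle h σ h1 h2 (Z b Tb) ⟨(b, a), h.hab.symm⟩ Tb rfl).symm.trans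
        (hZZ b Tb).symm))
  have hWac : SameCycle (ρ * α') (W a Ta) (W c Tc) := by
    rw [hsc, hiW a Ta, hiW c Tc]
    exact ((hZZ a Ta).trans (vertex_cycle h σ h1 h2 (Z a Ta) ⟨(a, c), h.hac⟩ Ta rfl)).trans
      (sac.trans ((vertex_cycle h σ h1 h2 (Z c Tc) ⟨(c, a), h.hac.symm⟩ Tc rfl).symm.trans
        (hZZ c Tc).symm))
  have hWne : ∀ z w hz hw, z ≠ w → W z hz ≠ W w hw := by
    intro z w hz hw hne he
    have := congrArg i he
    rw [hiW z hz, hiW w hw] at this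
    exact hne (congrArg (fun d : G.Dart => d.snd) this)
  -- choose the orientation
  obtain ⟨x, y, z, hx, hy, hz, hxy, hxz, hyz, hall, hc⟩ : ∃ x y z,
      ∃ (hx : inT a b c x) (hy : inT a b c y) (hz : inT a b c z), x ≠ y ∧ x ≠ z ∧ y ≠ z ∧
        (∀ v, inT a b c v → v = x ∨ v = y ∨ v = z) ∧
        cyc (ρ * α' * swap (W x hx) (W y hy) * swap (W x hx) (W z hz)) = cyc (ρ * α') + 2 := by
    rcases cyc_three (ρ * α') (W a Ta) (W b Tb) (W c Tc) (hWne _ _ Ta Tb hab) (hWne _ _ Ta Tc hac)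
      (hWne _ _ Tb Tc hbc) hWab hWac with h5 | h5
    · exact ⟨a, b, c, Ta, Tb, Tc, hab, hac, hbc, fun v hv => hv, h5⟩
    · exact ⟨b, a, c, Tb, Ta, Tc, hab.symm, hbc, hac, fun v hv => by unfold inT at hv; tauto, h5⟩
  have hcomm : ∀ u v, swap (α' u) (α' v) * α' = α' * swap u v := fun u v =>
    (Equiv.mul_swap_eq_swap_mul α' u v).symm
  set X := r (Z x hx) with hX
  set Y := r (Z y hy) with hY
  set U := r (Z z hz) with hU
  have eX : α' (W x hx) = X := hWs x hx
  have eY : α' (W y hy) = Y := hWs y hy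
  have eU : α' (W z hz) = U := hWs z hz
  have fX : X.fst.1 = a := (hrT _).1 hx
  have fY : Y.fst.1 = a := (hrT _).1 hy
  have fU : U.fst.1 = a := (hrT _).1 hz
  have nXY : X ≠ Y := by rw [← eX, ← eY]; exact α'.injective.ne (hWne _ _ hx hy hxy)
  have nXU : X ≠ U := by rw [← eX, ← eU]; exact α'.injective.ne (hWne _ _ hx hz hxz)
  have nYU : Y ≠ U := by rw [← eY, ← eU]; exact α'.injective.ne (hWne _ _ hy hz hyz)
  let rot := ρ * swap X Y * swap X U
  have rX : rot X = U := by
    simp only [rot, Perm.mul_apply, swap_apply_left]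
    rw [swap_apply_of_ne_of_ne nXU.symm nYU.symm, hρ1 _ fU]
  have rU : rot U = Y := by
    simp only [rot, Perm.mul_apply, swap_apply_right, swap_apply_left]
    rw [hρ1 _ fY]
  have rY : rot Y = X := by
    simp only [rot, Perm.mul_apply]
    rw [swap_apply_of_ne_of_ne nXY.symm nYU, swap_apply_right, hρ1 _ fX]
  have rO : ∀ e, e.fst.1 ≠ a → rot e = r (σ (i e)) := by
    intro e he
    have k1 : e ≠ X := fun hh => he (hh ▸ fX)
    have k2 : e ≠ Y := fun hh => he (hh ▸ fY)
    have k3 : e ≠ U := fun hh => he (hh ▸ fU)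
    simp only [rot, Perm.mul_apply]
    rw [swap_apply_of_ne_of_ne k1 k3, swap_apply_of_ne_of_ne k1 k2, hρ2 e he]
  have hat : ∀ e, e.fst.1 = a → e = X ∨ e = Y ∨ e = U := by
    intro e he
    have hT := (hTi e).2 he
    have he' : e = r (Z _ hT) := (hm.ri e).symm.trans (hsame (i e) (Z _ hT) hT rfl)
    rcases hall _ hT with h5 | h5 | h5
    · left; rw [he', hX]; exact hsame _ _ hT h5.symm
    · right; left; rw [he', hY]; exact hsame _ _ hT h5.symm
    · right; right; rw [he', hU]; exact hsame _ _ hT h5.symm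
  have rfst : ∀ e, (rot e).fst = e.fst := by
    intro e
    by_cases he : e.fst.1 = a
    · rcases hat e he with rfl | rfl | rfl
      · rw [rX]; exact Subtype.ext (fU.trans fX.symm)
      · rw [rY]; exact Subtype.ext (fX.trans fY.symm)
      · rw [rU]; exact Subtype.ext (fY.trans fU.symm)
    · rw [rO e he, hm.fst, h1, ← hfi]
  refine ⟨rot, rfst, ?_, ?_⟩
  · intro e e' hee
    have hee : e.fst = e'.fst := hee
    by_cases he : e.fst.1 = a
    · have sXU : SameCycle rot X U := by have := sc_step rot X; rwa [rX] at this
      have sUY : SameCycle rot U Y := by have := sc_step rot U; rwa [rU] at this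
      have base : ∀ e, e.fst.1 = a → SameCycle rot X e := by
        intro e he
        rcases hat e he with h5 | h5 | h5
        · rw [h5]
        · rw [h5]; exact sXU.trans sUY
        · rw [h5]; exact sXU
      exact (base e he).symm.trans (base e' (hee ▸ he))
    · have hT : ¬ inT a b c (i e).fst := fun hh => he ((hTi e).1 hh)
      have hfe : (i e).fst = (i e').fst := by
        have hT' : ¬ inT a b c (i e').fst := fun hh => he (hee ▸ (hTi e').1 hh)
        rw [hfi e, hfi e'] at hee
        have := congrArg Subtype.val hee
        rwa [col_out hab hac hT, col_out hab hac hT'] at this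
      obtain ⟨n, hn⟩ := (h2 _ _ hfe).exists_nat_pow_eq
      have key : ∀ n : ℕ, (rot ^ n) e = r ((σ ^ n) (i e)) := by
        intro n
        induction n with
        | zero => exact (hm.ri e).symm
        | succ n ih =>
          have hfn := rot_pow_fst σ h1 n (i e)
          rw [pow_succ', Perm.mul_apply, ih, rO, hm.ir, ← Perm.mul_apply, ← pow_succ']
          · rintro ⟨hh, -⟩
            rw [hfn] at hh
            exact hT hh
          · intro hh
            have := (hrT _).2 hh
            rw [hfn] at this
            exact hT this
      refine ⟨n, ?_⟩
      rw [zpow_natCast, key, hn, hm.ri]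
  · have hface : Nat.card (Quotient (faceSetoid (contractTriangle G a b c) rot)) = cyc (rot * α') := rfl
    have hmul : rot * α' = ρ * α' * swap (W x hx) (W y hy) * swap (W x hx) (W z hz) := by
      simp only [rot]
      rw [mul_assoc, ← eX, ← eY, ← eU, hcomm, ← mul_assoc, mul_assoc ρ, hcomm, ← mul_assoc]
    rw [hface, hmul, hc, hcyc, conn_card _ (contract_three_connected h3 h),
      cubic_dart_card _ (contract_cubic hcubic h)]
    rw [cubic_dart_card _ hcubic, hF] at hE
    have hc6 := card_ge_six h
    have hcc := contract_card (V := V) (a := a) hbc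
    omega

end TriangleContraction

/-- If `G` is a 3-connected cubic (planar) graph on more than 4
vertices and `Δ = {a,b,c}` is a triangle of `G`, then `G_Δ` is 3-connected and
cubic; hence a counterexample to Tait's conjecture containing a triangle yields a
smaller counterexample: if `G` is moreover planar and non-Hamiltonian, then `G_Δ`
is a planar, non-Hamiltonian graph on fewer vertices. -/
theorem contractTriangle_three_connected_and_smaller_Tait_counterexample
    {V : Type} [Fintype V] [DecidableEq V] (G : SimpleGraph V) [DecidableRel G.Adj]
    (h3 : ThreeConnected G) (hcubic : IsCubic G) (hplanar : IsPlanar G)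
    (a b c : V) (hab : G.Adj a b) (hbc : G.Adj b c) (hac : G.Adj a c)
    (hcard : 4 < Nat.card V) :
    ThreeConnected (contractTriangle G a b c) ∧
    IsCubic (contractTriangle G a b c) ∧
    (¬ G.IsHamiltonian →
      (IsPlanar (contractTriangle G a b c) ∧
       ¬ (contractTriangle G a b c).IsHamiltonian ∧
       Nat.card {x : V // x ≠ b ∧ x ≠ c} < Nat.card V)) := by
  obtain ⟨out, h⟩ := exists_triData G h3 hcubic a b c hab hbc hac hcard
  refine ⟨contract_three_connected h3 h, contract_cubic hcubic h, fun hH =>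
    ⟨contract_planar h3 hcubic h hplanar, fun hh => hH (contract_ham h hh), ?_⟩⟩
  have := contract_card (V := V) (a := a) hbc.ne
  omega
end

section
/- A minimum counterexample to Tutte's conjecture has girth at least 6; i.e., if G is a 3-connected, cubic, bipartite, non-Hamiltonian graph of minimum order, then G contains no cycle of length 4. -/
set_option linter.unusedSectionVars false

open Classical in
/-- Number of adjacent ordered pairs in `A × B`. -/
noncomputable def eCnt {V : Type} (G : SimpleGraph V) (A B : Finset V) : ℕ :=
  ∑ a ∈ A, ∑ b ∈ B, if G.Adj a b then 1 else 0

section counting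
variable {V : Type} [DecidableEq V]

lemma eCnt_comm (G : SimpleGraph V) (A B : Finset V) : eCnt G A B = eCnt G B A := by
  unfold eCnt
  rw [Finset.sum_comm]
  refine Finset.sum_congr rfl fun a _ => Finset.sum_congr rfl fun b _ => ?_
  by_cases h : G.Adj a b
  · rw [if_pos h, if_pos h.symm]
  · rw [if_neg h, if_neg (fun h' => h h'.symm)]

lemma eCnt_union_left (G : SimpleGraph V) {A B : Finset V} (C : Finset V) (h : Disjoint A B) :
    eCnt G (A ∪ B) C = eCnt G A C + eCnt G B C := by
  unfold eCnt
  rw [Finset.sum_union h]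

lemma eCnt_union_right (G : SimpleGraph V) {A B : Finset V} (C : Finset V) (h : Disjoint A B) :
    eCnt G C (A ∪ B) = eCnt G C A + eCnt G C B := by
  rw [eCnt_comm, eCnt_union_left G C h, eCnt_comm G A, eCnt_comm G B]

lemma eCnt_insert_left (G : SimpleGraph V) {a : V} {B : Finset V} (C : Finset V) (h : a ∉ B) :
    eCnt G (insert a B) C = eCnt G {a} C + eCnt G B C := by
  unfold eCnt
  rw [Finset.sum_insert h]; simp

lemma eCnt_insert_right (G : SimpleGraph V) {a : V} {B : Finset V} (C : Finset V) (h : a ∉ B) :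
    eCnt G C (insert a B) = eCnt G C {a} + eCnt G C B := by
  rw [eCnt_comm, eCnt_insert_left G C h, eCnt_comm G {a}, eCnt_comm G B]

@[simp] lemma eCnt_empty_left (G : SimpleGraph V) (C : Finset V) : eCnt G ∅ C = 0 := by
  simp [eCnt]

@[simp] lemma eCnt_empty_right (G : SimpleGraph V) (C : Finset V) : eCnt G C ∅ = 0 := by
  simp [eCnt]

lemma eCnt_singleton (G : SimpleGraph V) (a b : V) [Decidable (G.Adj a b)] :
    eCnt G {a} {b} = if G.Adj a b then 1 else 0 := by
  unfold eCnt
  rw [Finset.sum_singleton, Finset.sum_singleton]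
  congr

lemma eCnt_mono (G : SimpleGraph V) {A A' B B' : Finset V} (h : A ⊆ A') (h' : B ⊆ B') :
    eCnt G A B ≤ eCnt G A' B' := by
  unfold eCnt
  refine le_trans (Finset.sum_le_sum_of_subset h) ?_
  exact Finset.sum_le_sum fun i _ => Finset.sum_le_sum_of_subset h'

lemma eCnt_eq_zero (G : SimpleGraph V) {A B : Finset V} (h : ∀ a ∈ A, ∀ b ∈ B, ¬ G.Adj a b) :
    eCnt G A B = 0 := by
  unfold eCnt
  refine Finset.sum_eq_zero fun a ha => Finset.sum_eq_zero fun b hb => ?_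
  rw [if_neg (h a ha b hb)]

lemma eCnt_pos (G : SimpleGraph V) {A B : Finset V} {a b : V} (ha : a ∈ A) (hb : b ∈ B)
    (h : G.Adj a b) : 1 ≤ eCnt G A B := by
  classical
  have := eCnt_mono G (A := {a}) (B := {b}) (A' := A) (B' := B) (by simpa) (by simpa)
  rwa [eCnt_singleton, if_pos h] at this

/-- Splitting a set along a subset. -/
lemma eCnt_split_left (G : SimpleGraph V) {A B : Finset V} (C : Finset V) (h : A ⊆ B) :
    eCnt G B C = eCnt G A C + eCnt G (B \ A) C := by
  rw [← eCnt_union_left G C Finset.disjoint_sdiff, Finset.union_sdiff_of_subset h]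

lemma eCnt_split_right (G : SimpleGraph V) {A B : Finset V} (C : Finset V) (h : A ⊆ B) :
    eCnt G C B = eCnt G C A + eCnt G C (B \ A) := by
  rw [← eCnt_union_right G C Finset.disjoint_sdiff, Finset.union_sdiff_of_subset h]

/-- Count towards a vertex with three known neighbours. -/
lemma eCnt_nbr (G : SimpleGraph V) {u a b c : V} (hab : a ≠ b) (hac : a ≠ c) (hbc : b ≠ c)
    (h : ∀ y, G.Adj u y ↔ y = a ∨ y = b ∨ y = c) (A : Finset V) :
    eCnt G A {u} = (if a ∈ A then 1 else 0) + (if b ∈ A then 1 else 0)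
      + (if c ∈ A then 1 else 0) := by
  classical
  have : ∀ y, (if G.Adj y u then 1 else 0) = (if a = y then 1 else 0) + (if b = y then 1 else 0)
      + (if c = y then 1 else 0) := by
    intro y
    rw [G.adj_comm, show G.Adj u y ↔ (y = a ∨ y = b ∨ y = c) from h y]
    grind
  unfold eCnt
  simp only [Finset.sum_singleton]
  rw [Finset.sum_congr (g := fun y => (if a = y then 1 else 0) + (if b = y then 1 else 0)
    + (if c = y then 1 else 0)) rfl]
  · simp [Finset.sum_add_distrib]
  · intro y _
    rw [← this y]

lemma eCnt_edge (G : SimpleGraph V) {p q : V} (hpq : p ≠ q) (h : ¬ G.Adj p q) (A B : Finset V) :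
    eCnt (G ⊔ SimpleGraph.edge p q) A B = eCnt G A B + (if p ∈ A ∧ q ∈ B then 1 else 0)
      + (if q ∈ A ∧ p ∈ B then 1 else 0) := by
  classical
  have h1 : ∀ a b, (if (G ⊔ SimpleGraph.edge p q).Adj a b then 1 else 0) =
      (if G.Adj a b then 1 else 0) + (if p = a then (if q = b then 1 else 0) else 0)
       + (if q = a then (if p = b then 1 else 0) else 0) := by
    intro a b
    have h2 := G.adj_comm p q
    simp only [SimpleGraph.sup_adj, SimpleGraph.edge_adj]
    grind
  have h3 : eCnt (G ⊔ SimpleGraph.edge p q) A B = ∑ a ∈ A, ∑ b ∈ B, ((if G.Adj a b then 1 else 0) +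
      (if p = a then (if q = b then 1 else 0) else 0)
       + (if q = a then (if p = b then 1 else 0) else 0)) := by
    unfold eCnt
    refine Finset.sum_congr rfl fun a _ => Finset.sum_congr rfl fun b _ => ?_
    rw [← h1]
    congr
  rw [h3]
  simp only [Finset.sum_add_distrib]
  have h4 : ∀ p q : V, (∑ a ∈ A, ∑ b ∈ B, (if p = a then (if q = b then 1 else 0) else 0))
      = if p ∈ A ∧ q ∈ B then 1 else 0 := by
    intro p q
    rw [Finset.sum_congr rfl (g := fun a => if p = a then (if q ∈ B then 1 else 0) else 0)]
    · rw [Finset.sum_ite_eq]; grind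
    · intro a _
      by_cases h : p = a <;> simp [h]
  rw [h4, h4]
  congr 3

/-- Edge-connectivity (every cut has at least 3 edges) prevents small vertex separators. -/
lemma no_separator (R : SimpleGraph V) (S P Q T : Finset V) (hP : P.Nonempty) (hQ : Q.Nonempty)
    (hPQ : Disjoint P Q) (hPT : Disjoint P T) (hQT : Disjoint Q T) (hS : S = P ∪ Q ∪ T)
    (hT : T.card ≤ 2) (hno : ∀ a ∈ P, ∀ b ∈ Q, ¬ R.Adj a b)
    (hdeg : ∀ y ∈ S, eCnt R {y} S = 3)
    (hcut : ∀ Z ⊆ S, Z.Nonempty → (S \ Z).Nonempty → 3 ≤ eCnt R Z (S \ Z)) : False := by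
  classical
  have e0 : eCnt R P Q = 0 := eCnt_eq_zero R hno
  have e0' : eCnt R Q P = 0 := by rw [eCnt_comm]; exact e0
  have hself : ∀ y, eCnt R {y} {y} = 0 := fun y => by simp [eCnt_singleton]
  obtain ⟨p0, hp0⟩ := hP
  obtain ⟨q0, hq0⟩ := hQ
  rw [Finset.disjoint_left] at hPQ hPT hQT
  have cP := hcut P (by grind) ⟨p0, hp0⟩ ⟨q0, by grind⟩
  have cQ := hcut Q (by grind) ⟨q0, hq0⟩ ⟨p0, by grind⟩
  have hPc : S \ P = Q ∪ T := by ext; grind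
  have hQc : S \ Q = P ∪ T := by ext; grind
  have dPQ : Disjoint P Q := Finset.disjoint_left.2 hPQ
  have dPT : Disjoint P T := Finset.disjoint_left.2 hPT
  have dQT : Disjoint Q T := Finset.disjoint_left.2 hQT
  have dPQT : Disjoint (P ∪ Q) T := Finset.disjoint_left.2 (by grind)
  rw [hPc, eCnt_union_right R P dQT, e0, eCnt_comm R P T] at cP
  rw [hQc, eCnt_union_right R Q dPT, e0', eCnt_comm R Q T] at cQ
  have hT' : T.card = 0 ∨ T.card = 1 ∨ T.card = 2 := by omega
  rcases hT' with hT' | hT' | hT'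
  · rw [Finset.card_eq_zero] at hT'
    subst hT'
    simp at cP
  · obtain ⟨s, rfl⟩ := Finset.card_eq_one.1 hT'
    have hs := hdeg s (by grind)
    rw [hS, eCnt_union_right R _ dPQT, eCnt_union_right R _ dPQ] at hs
    omega
  · obtain ⟨s, t, hst, rfl⟩ := Finset.card_eq_two.1 hT'
    have hs := hdeg s (by grind)
    have ht := hdeg t (by grind)
    have hst' : s ∉ ({t} : Finset V) := by simpa
    rw [hS, eCnt_union_right R _ dPQT, eCnt_union_right R _ dPQ, eCnt_insert_right R _ hst',
      hself] at hs ht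
    rw [eCnt_insert_left R _ hst'] at cP cQ
    have sP : s ∉ P := by grind
    have tP : t ∉ P := by grind
    have sQ : s ∉ Q := by grind
    have tQ : t ∉ Q := by grind
    have c1 := hcut (insert s P) (by grind) ⟨p0, by grind⟩ ⟨q0, by grind⟩
    have c2 := hcut (insert t P) (by grind) ⟨p0, by grind⟩ ⟨q0, by grind⟩
    have h1 : S \ insert s P = insert t Q := by ext; grind
    have h2 : S \ insert t P = insert s Q := by ext; grind
    rw [h1, eCnt_insert_left R _ sP, eCnt_insert_right R _ tQ, eCnt_insert_right R _ tQ, e0,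
      eCnt_comm R P {t}] at c1
    rw [h2, eCnt_insert_left R _ tP, eCnt_insert_right R _ sQ, eCnt_insert_right R _ sQ, e0,
      eCnt_comm R P {s}] at c2
    rw [eCnt_comm R {t} {s}] at ht c2
    omega

end counting

section conn
variable {V : Type} [Fintype V] [DecidableEq V]

lemma eCnt_univ_of_cubic {G : SimpleGraph V} (hc : IsCubic G) (y : V) :
    eCnt G {y} Finset.univ = 3 := by
  classical
  have := hc y
  rw [← this, Set.ncard_eq_toFinset_card']
  simp only [eCnt, Finset.sum_singleton]
  rw [Finset.sum_boole]
  simp only [Nat.cast_id]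
  congr 1
  ext z; simp

/-- Every nontrivial edge cut of a 3-connected cubic graph has at least 3 edges. -/
lemma cut_of_threeConnected {G : SimpleGraph V} (hc : IsCubic G) (h3 : ThreeConnected G)
    (X : Finset V) (hX : X.Nonempty) (hX' : Xᶜ.Nonempty) : 3 ≤ eCnt G X Xᶜ := by
  classical
  by_contra hlt
  have hself : ∀ y, eCnt G {y} {y} = 0 := fun y => by simp [eCnt_singleton]
  have hdeg := eCnt_univ_of_cubic hc
  let S : Finset V := X.filter (fun a => ∃ b ∈ Xᶜ, G.Adj a b)
  have hSX : S ⊆ X := Finset.filter_subset _ _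
  have hScard : S.card ≤ eCnt G X Xᶜ := by
    refine le_trans ?_ (eCnt_mono G hSX subset_rfl)
    rw [Finset.card_eq_sum_ones]
    unfold eCnt
    refine Finset.sum_le_sum fun a ha => ?_
    obtain ⟨b, hb, hab⟩ := (Finset.mem_filter.1 ha).2
    have := eCnt_pos G (A := {a}) (by simp) hb hab
    simpa [eCnt] using this
  obtain ⟨y, hy⟩ := hX'
  have hyX : y ∉ X := by simpa using hy
  by_cases hne : (X \ S).Nonempty
  · obtain ⟨x, hx⟩ := hne
    have hcon := h3.2 (S : Set V) (by rw [Set.ncard_coe_finset]; omega)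
    have hxX : x ∈ X := (Finset.mem_sdiff.1 hx).1
    have hr := hcon.preconnected ⟨x, by simpa using (Finset.mem_sdiff.1 hx).2⟩
      ⟨y, by simpa using fun h => hyX (hSX h)⟩
    obtain ⟨p⟩ := hr
    have key : ∀ (a b : ((S : Set V)ᶜ : Set V)) (p : (G.induce (S : Set V)ᶜ).Walk a b),
        (a : V) ∈ X → (b : V) ∈ X := by
      intro a b p
      induction p with
      | nil => exact id
      | @cons a b c hadj p ih =>
        intro ha
        apply ih
        by_contra hb
        apply a.2
        have : (a : V) ∈ S := Finset.mem_filter.2 ⟨ha, b, by simpa using hb, by simpa using hadj⟩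
        simpa using this
    exact hyX (key _ _ p hxX)
  · have hXS : X = S := by
      apply Finset.Subset.antisymm _ hSX
      rw [← Finset.sdiff_eq_empty_iff_subset]
      simpa using hne
    have hXcard : X.card ≤ 2 := by rw [hXS]; omega
    have hpos := hX.card_pos
    have hs : ∀ a, eCnt G {a} X + eCnt G {a} Xᶜ = 3 := by
      intro a
      rw [← hdeg a, ← eCnt_union_right G _ disjoint_compl_right, Finset.union_compl]
    have : X.card = 1 ∨ X.card = 2 := by omega
    rcases this with h | h
    · obtain ⟨a, rfl⟩ := Finset.card_eq_one.1 h
      have := hs a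
      rw [hself] at this
      omega
    · obtain ⟨a, b, hab, hX2⟩ := Finset.card_eq_two.1 h
      have ha := hs a
      have hb := hs b
      have hab' : a ∉ ({b} : Finset V) := by simpa
      have hle : eCnt G {a} {b} ≤ 1 := by rw [eCnt_singleton]; split_ifs <;> omega
      have e1 : eCnt G {a} X = eCnt G {a} {b} := by
        rw [hX2, eCnt_insert_right G _ hab', hself]; omega
      have e2 : eCnt G {b} X = eCnt G {a} {b} := by
        rw [hX2, eCnt_insert_right G _ hab', hself, eCnt_comm]; omega
      have e3 : eCnt G X Xᶜ = eCnt G {a} Xᶜ + eCnt G {b} Xᶜ := by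
        conv_lhs => rw [hX2, eCnt_insert_left G _ hab', ← hX2]
      omega

/-- Cyclic chains. -/
def Cyc (R : V → V → Prop) (L : List V) : Prop :=
  L.IsChain R ∧ ∀ a ∈ L.getLast?, ∀ b ∈ L.head?, R a b

/-- Applying the minimality hypothesis to a graph on a proper subset of the vertices. -/
lemma reduce
    (hmin : ∀ (m : ℕ) (H : SimpleGraph (Fin m)),
      m < Nat.card V → ThreeConnected H → IsCubic H → H.Colorable 2 → H.IsHamiltonian)
    (R : SimpleGraph V) (S : Finset V) (hne : S.Nonempty) (hS : Sᶜ.Nonempty)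
    (hdeg : ∀ y ∈ S, eCnt R {y} S = 3)
    (f : V → Fin 2) (hf : ∀ y ∈ S, ∀ z ∈ S, R.Adj y z → f y ≠ f z)
    (hcut : ∀ Z ⊆ S, Z.Nonempty → (S \ Z).Nonempty → 3 ≤ eCnt R Z (S \ Z)) :
    ∃ L : List V, L.Nodup ∧ (∀ y, y ∈ L ↔ y ∈ S) ∧ Cyc R.Adj L := by
  classical
  let φ : Fin S.card → V := fun i => (S.equivFin.symm i : V)
  have hφS : ∀ i, φ i ∈ S := fun i => (S.equivFin.symm i).2
  have hφinj : Function.Injective φ := fun i j h => S.equivFin.symm.injective (Subtype.ext h)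
  have hφsurj : ∀ y ∈ S, ∃ i, φ i = y := fun y hy => ⟨S.equivFin ⟨y, hy⟩, by simp [φ]⟩
  let H : SimpleGraph (Fin S.card) := R.comap φ
  have hHadj : ∀ i j, H.Adj i j ↔ R.Adj (φ i) (φ j) := fun i j => Iff.rfl
  have himg : Finset.univ.image φ = S := by
    ext y; simp only [Finset.mem_image, Finset.mem_univ, true_and]
    exact ⟨fun ⟨i, hi⟩ => hi ▸ hφS i, hφsurj y⟩
  have hcub : IsCubic H := by
    intro i
    rw [← hdeg _ (hφS i)]
    conv_rhs => rw [← himg]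
    unfold eCnt
    rw [Finset.sum_singleton, Finset.sum_image (fun a _ b _ h => hφinj h), Finset.sum_boole,
      Set.ncard_eq_toFinset_card']
    simp only [Nat.cast_id]
    congr 1
    ext j
    simp [hHadj]
  have hcard4 : 4 ≤ S.card := by
    obtain ⟨y, hy⟩ := hne
    have h1 := hdeg y hy
    have h2 : eCnt R {y} S ≤ (S.erase y).card := by
      unfold eCnt
      rw [Finset.sum_singleton, Finset.sum_boole, Nat.cast_id]
      apply Finset.card_le_card
      intro z hz
      rw [Finset.mem_filter] at hz
      exact Finset.mem_erase.2 ⟨hz.2.ne', hz.1⟩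
    rw [Finset.card_erase_of_mem hy] at h2
    omega
  have hlt : S.card < Nat.card V := by
    rw [Nat.card_eq_fintype_card, ← Finset.card_compl_add_card S]
    have := hS.card_pos
    omega
  have hcol : H.Colorable 2 :=
    ⟨SimpleGraph.Coloring.mk (fun i => f (φ i)) (fun {i j} h => hf _ (hφS i) _ (hφS j) h)⟩
  have h3c : ThreeConnected H := by
    refine ⟨by simpa using hcard4, fun T hT => ?_⟩
    have hTc : (Tᶜ).Nonempty := by
      by_contra h
      rw [Set.not_nonempty_iff_eq_empty, Set.compl_empty_iff] at h
      rw [h, Set.ncard_univ] at hT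
      simp at hT; omega
    have : Nonempty (Tᶜ : Set (Fin S.card)) := hTc.to_subtype
    refine ⟨fun x y => ?_⟩
    by_contra hxy
    let T' : Finset V := (T.toFinset).image φ
    let P : Finset V := Finset.univ.filter
      (fun z => ∃ i : (Tᶜ : Set (Fin S.card)), φ i = z ∧ (H.induce Tᶜ).Reachable x i)
    let Q : Finset V := Finset.univ.filter
      (fun z => ∃ i : (Tᶜ : Set (Fin S.card)), φ i = z ∧ ¬ (H.induce Tᶜ).Reachable x i)
    have hPm : ∀ i : Fin S.card, φ i ∈ P ↔ ∃ h : i ∈ Tᶜ, (H.induce Tᶜ).Reachable x ⟨i, h⟩ := by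
      intro i
      simp only [P, Finset.mem_filter, Finset.mem_univ, true_and]
      constructor
      · rintro ⟨j, hj, hr⟩
        have := hφinj hj
        subst this
        exact ⟨j.2, hr⟩
      · rintro ⟨h, hr⟩
        exact ⟨⟨i, h⟩, rfl, hr⟩
    have hQm : ∀ i : Fin S.card, φ i ∈ Q ↔ ∃ h : i ∈ Tᶜ, ¬ (H.induce Tᶜ).Reachable x ⟨i, h⟩ := by
      intro i
      simp only [Q, Finset.mem_filter, Finset.mem_univ, true_and]
      constructor
      · rintro ⟨j, hj, hr⟩
        have := hφinj hj
        subst this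
        exact ⟨j.2, hr⟩
      · rintro ⟨h, hr⟩
        exact ⟨⟨i, h⟩, rfl, hr⟩
    have hTm : ∀ i : Fin S.card, φ i ∈ T' ↔ i ∈ T := by
      intro i
      simp [T', hφinj.eq_iff]
    have hPS : ∀ z ∈ P, ∃ i, φ i = z := by
      intro z hz
      obtain ⟨i, hi, _⟩ := (Finset.mem_filter.1 hz).2
      exact ⟨i, hi⟩
    have hQS : ∀ z ∈ Q, ∃ i, φ i = z := by
      intro z hz
      obtain ⟨i, hi, _⟩ := (Finset.mem_filter.1 hz).2
      exact ⟨i, hi⟩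
    have hTS : ∀ z ∈ T', ∃ i, φ i = z := by
      intro z hz
      obtain ⟨i, _, hi⟩ := Finset.mem_image.1 hz
      exact ⟨i, hi⟩
    refine no_separator R S P Q T' ⟨φ x, (hPm _).2 ⟨x.2, SimpleGraph.Reachable.refl _⟩⟩
      ⟨φ y, (hQm _).2 ⟨y.2, hxy⟩⟩ ?_ ?_ ?_ ?_ ?_ ?_ hdeg hcut
    · rw [Finset.disjoint_left]
      intro z hz hz'
      obtain ⟨i, rfl⟩ := hPS z hz
      obtain ⟨_, h1⟩ := (hPm i).1 hz
      obtain ⟨_, h2⟩ := (hQm i).1 hz'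
      exact h2 h1
    · rw [Finset.disjoint_left]
      intro z hz hz'
      obtain ⟨i, rfl⟩ := hPS z hz
      obtain ⟨h, h1⟩ := (hPm i).1 hz
      exact h ((hTm i).1 hz')
    · rw [Finset.disjoint_left]
      intro z hz hz'
      obtain ⟨i, rfl⟩ := hQS z hz
      obtain ⟨h, h1⟩ := (hQm i).1 hz
      exact h ((hTm i).1 hz')
    · ext z
      simp only [Finset.mem_union]
      constructor
      · intro hz
        obtain ⟨i, rfl⟩ := hφsurj z hz
        rw [hPm, hQm, hTm]
        by_cases h : i ∈ T
        · exact Or.inr h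
        · left
          by_cases hr : (H.induce Tᶜ).Reachable x ⟨i, h⟩
          · exact Or.inl ⟨h, hr⟩
          · exact Or.inr ⟨h, hr⟩
      · rintro ((h | h) | h)
        · obtain ⟨i, rfl⟩ := hPS z h
          exact hφS i
        · obtain ⟨i, rfl⟩ := hQS z h
          exact hφS i
        · obtain ⟨i, rfl⟩ := hTS z h
          exact hφS i
    · refine Finset.card_image_le.trans ?_
      rwa [← Set.ncard_eq_toFinset_card']
    · intro a ha b hb hab
      obtain ⟨i, rfl⟩ := hPS a ha
      obtain ⟨j, rfl⟩ := hQS b hb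
      obtain ⟨hi, h1⟩ := (hPm i).1 ha
      obtain ⟨hj, h2⟩ := (hQm j).1 hb
      apply h2
      refine h1.trans (SimpleGraph.Adj.reachable ?_)
      exact hab
  obtain ⟨a, c, hc⟩ := hmin S.card H hlt h3c hcub hcol (by simp; omega)
  -- extract the list
  have htail := hc.isHamiltonian_tail
  cases c with
  | nil => exact absurd rfl hc.isCycle.ne_nil
  | @cons _ b _ hadj p =>
    simp only [SimpleGraph.Walk.tail_cons] at htail
    have hp : p.IsHamiltonian := by
      intro v
      simpa using htail v
    refine ⟨p.support.map φ, ?_, ?_, ?_, ?_⟩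
    · exact hp.isPath.support_nodup.map hφinj
    · intro y
      rw [List.mem_map]
      exact ⟨fun ⟨i, _, hi⟩ => hi ▸ hφS i, fun hy => by
        obtain ⟨i, hi⟩ := hφsurj y hy
        exact ⟨i, hp.mem_support i, hi⟩⟩
    · rw [List.isChain_map]
      exact p.isChain_adj_support
    · intro s hs t ht
      rw [List.getLast?_map, List.getLast?_eq_getLast_of_ne_nil (by simp)] at hs
      rw [List.head?_map, List.head?_eq_some_head (by simp)] at ht
      simp at hs ht
      subst hs ht
      exact hadj

/-- A cyclic list through all the vertices gives Hamiltonicity. -/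
lemma hamiltonian_of_list (G : SimpleGraph V) (L : List V) (hn : L.Nodup) (hm : ∀ y, y ∈ L)
    (hlen : 3 ≤ L.length) (hc : Cyc G.Adj L) : G.IsHamiltonian := by
  intro _
  have hne : L ≠ [] := by rintro rfl; simp at hlen
  obtain ⟨h1, h2⟩ := hc
  let p := SimpleGraph.Walk.ofSupport L hne h1
  have hps : p.support = L := SimpleGraph.Walk.support_ofSupport hne h1
  have hadj : G.Adj (L.getLast hne) (L.head hne) :=
    h2 _ (by simp [List.getLast?_eq_getLast_of_ne_nil hne]) _ (by simp [List.head?_eq_some_head hne])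
  have hp : p.IsPath := by rw [SimpleGraph.Walk.isPath_def, hps]; exact hn
  refine ⟨_, SimpleGraph.Walk.cons hadj p, ?_⟩
  refine ⟨?_, ?_⟩
  · rw [SimpleGraph.Walk.isCycle_iff_isPath_tail_and_le_length]
    refine ⟨?_, ?_⟩
    · simp only [SimpleGraph.Walk.tail_cons]
      simpa using hp
    · have := SimpleGraph.Walk.length_ofSupport hne h1
      simp only [SimpleGraph.Walk.length_cons, p]
      omega
  · intro v
    have h5 : p.support.count v = 1 := by
      rw [hps]
      exact List.count_eq_one_of_mem hn (hm v)
    simpa using h5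

end conn

section lists
variable {V : Type} [Fintype V] [DecidableEq V]

/-- `L` is a chain from `a` to `b`. -/
def PL (R : V → V → Prop) (a b : V) (L : List V) : Prop :=
  L.IsChain R ∧ L.head? = some a ∧ L.getLast? = some b

lemma PL.join {R : V → V → Prop} {a b c d : V} {L M : List V} (h : PL R a b L) (h' : PL R c d M)
    (hbc : R b c) : PL R a d (L ++ M) := by
  obtain ⟨h1, h2, h3⟩ := h
  obtain ⟨h4, h5, h6⟩ := h'
  refine ⟨List.isChain_append.2 ⟨h1, h4, ?_⟩, ?_, ?_⟩
  · intro y hy z hz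
    simp_all
  · simp [h2]
  · simp [h6]

lemma PL.rev {R : V → V → Prop} (hR : ∀ a b, R a b → R b a) {a b : V} {L : List V}
    (h : PL R a b L) : PL R b a L.reverse := by
  obtain ⟨h1, h2, h3⟩ := h
  refine ⟨?_, by simpa using h3, by simpa using h2⟩
  rw [List.isChain_reverse]
  exact h1.imp fun a b => hR a b

lemma PL.cyc {R : V → V → Prop} {a b : V} {L : List V} (h : PL R a b L) (hba : R b a) :
    Cyc R L := by
  obtain ⟨h1, h2, h3⟩ := h
  refine ⟨h1, ?_⟩
  simp_all

lemma PL.mono {R Q : V → V → Prop} {a b : V} {L : List V} (h : PL R a b L)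
    (hQ : ∀ a ∈ L, ∀ b ∈ L, R a b → Q a b) : PL Q a b L := by
  obtain ⟨h1, h2, h3⟩ := h
  exact ⟨h1.imp_of_mem_imp (fun a b ha hb => hQ a ha b hb), h2, h3⟩

/-- Two-part decomposition. -/
lemma PL.split {R : V → V → Prop} {a b : V} {L M : List V} (h : PL R a b (L ++ M))
    (hL : L ≠ []) (hM : M ≠ []) : ∃ c d, PL R a c L ∧ PL R d b M ∧ R c d := by
  obtain ⟨h1, h2, h3⟩ := h
  rw [List.isChain_append] at h1
  obtain ⟨h4, h5, h6⟩ := h1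
  refine ⟨L.getLast hL, M.head hM, ⟨h4, ?_, ?_⟩, ⟨h5, ?_, ?_⟩, ?_⟩
  · rw [List.head?_append_of_ne_nil _ hL] at h2; exact h2
  · exact List.getLast?_eq_getLast_of_ne_nil hL
  · exact List.head?_eq_some_head hM
  · rw [List.getLast?_append_of_ne_nil _ hM] at h3; exact h3
  · apply h6 <;> simp [List.getLast?_eq_getLast_of_ne_nil hL, List.head?_eq_some_head hM]

lemma Cyc.toPL {R : V → V → Prop} {L : List V} (h : Cyc R L) (hL : L ≠ []) :
    ∃ a b, PL R a b L ∧ R b a := by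
  refine ⟨L.head hL, L.getLast hL, ⟨h.1, List.head?_eq_some_head hL,
    List.getLast?_eq_getLast_of_ne_nil hL⟩, ?_⟩
  apply h.2 <;> simp [List.getLast?_eq_getLast_of_ne_nil hL, List.head?_eq_some_head hL]

/-- Rotation. -/
lemma Cyc.rot {R : V → V → Prop} {L M : List V} (h : Cyc R (L ++ M)) : Cyc R (M ++ L) := by
  by_cases hL : L = []
  · simpa [hL] using h
  by_cases hM : M = []
  · simpa [hM] using h
  obtain ⟨a, b, h1, h2⟩ := h.toPL (by simp [hL])
  obtain ⟨c, d, h3, h4, h5⟩ := h1.split hL hM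
  exact (h4.join h3 h2).cyc h5

lemma PL.mem {R : V → V → Prop} {a b : V} {L : List V} (h : PL R a b L) : a ∈ L ∧ b ∈ L :=
  ⟨List.mem_of_head? h.2.1, List.mem_of_getLast? h.2.2⟩

/-- The cyclic list uses a `¬ Q` pair: rotate so that this pair closes the cycle. -/
lemma Cyc.exists_bad {R Q : V → V → Prop} {L : List V} (h : Cyc R L) (hQ : ¬ Cyc Q L) :
    ∃ M a b, PL R b a M ∧ R a b ∧ ¬ Q a b ∧ (∀ y, y ∈ M ↔ y ∈ L) ∧ (L.Nodup → M.Nodup) ∧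
      M.length = L.length := by
  have hL : L ≠ [] := by
    rintro rfl
    exact hQ ⟨List.IsChain.nil, by simp⟩
  by_cases hc : L.IsChain Q
  · obtain ⟨a, b, h1, h2⟩ := h.toPL hL
    refine ⟨L, b, a, h1, h2, ?_, by simp, id, rfl⟩
    intro h3
    exact hQ (PL.cyc ⟨hc, h1.2⟩ h3)
  · rw [List.isChain_iff_forall_rel_of_append_cons_cons] at hc
    push Not at hc
    obtain ⟨a, b, A, B, rfl, hab⟩ := hc
    have h1 : Cyc R ((A ++ [a]) ++ (b :: B)) := by simpa using h
    have h2 := h1.rot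
    obtain ⟨c, d, h3, h4⟩ := h2.toPL (by simp)
    have hcb : c = b := by
      have := h3.2.1
      simpa [eq_comm] using this
    have hda : d = a := by
      have := h3.2.2
      rw [← List.append_assoc, List.getLast?_append] at this
      simpa [eq_comm] using this
    subst hcb hda
    refine ⟨_, d, c, h3, h4, hab, ?_, ?_, ?_⟩
    · intro y; simp only [List.mem_append, List.mem_cons]; tauto
    · intro hn
      have : (c :: B ++ (A ++ [d])).Perm (A ++ d :: c :: B) := by
        refine List.perm_append_comm.trans ?_
        simp
      exact this.nodup_iff.2 hn
    · simp; omega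

/-- A 4-cycle `u v w x` together with the outside neighbours, in a properly 2-coloured cubic
graph. -/
structure Cfg (G : SimpleGraph V) (f : V → Fin 2) (u v w x u' v' w' x' : V) : Prop where
  hf : ∀ a b, G.Adj a b → f a ≠ f b
  hu : ∀ y, G.Adj u y ↔ y = v ∨ y = x ∨ y = u'
  hv : ∀ y, G.Adj v y ↔ y = u ∨ y = w ∨ y = v'
  hw : ∀ y, G.Adj w y ↔ y = v ∨ y = x ∨ y = w'
  hx : ∀ y, G.Adj x y ↔ y = u ∨ y = w ∨ y = x'
  uw : u ≠ w
  vx : v ≠ x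
  u'v : u' ≠ v
  u'x : u' ≠ x
  w'v : w' ≠ v
  w'x : w' ≠ x
  v'u : v' ≠ u
  v'w : v' ≠ w
  x'u : x' ≠ u
  x'w : x' ≠ w
  cw : f w = f u
  cv' : f v' = f u
  cx' : f x' = f u
  cx : f x = f v
  cu' : f u' = f v
  cw' : f w' = f v
  cc : f u ≠ f v

variable {G : SimpleGraph V} {f : V → Fin 2} {u v w x u' v' w' x' : V}

lemma Cfg.swapUW (h : Cfg G f u v w x u' v' w' x') : Cfg G f w v u x w' v' u' x' := by
  obtain ⟨hf, hu, hv, hw, hx, h1, h2, h3, h4, h5, h6, h7, h8, h9, h10, c1, c2, c3, c4, c5, c6, c7⟩ := h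
  constructor <;> grind

lemma Cfg.swapVX (h : Cfg G f u v w x u' v' w' x') : Cfg G f u x w v u' x' w' v' := by
  obtain ⟨hf, hu, hv, hw, hx, h1, h2, h3, h4, h5, h6, h7, h8, h9, h10, c1, c2, c3, c4, c5, c6, c7⟩ := h
  constructor <;> grind

lemma Cfg.rot (h : Cfg G f u v w x u' v' w' x') : Cfg G f v w x u v' w' x' u' := by
  obtain ⟨hf, hu, hv, hw, hx, h1, h2, h3, h4, h5, h6, h7, h8, h9, h10, c1, c2, c3, c4, c5, c6, c7⟩ := h
  constructor <;> grind

/-- All distinctness facts. -/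
lemma Cfg.ne (h : Cfg G f u v w x u' v' w' x') :
    (u ≠ v ∧ u ≠ w ∧ u ≠ x ∧ v ≠ w ∧ v ≠ x ∧ w ≠ x) ∧
    (u' ≠ u ∧ u' ≠ v ∧ u' ≠ w ∧ u' ≠ x) ∧ (v' ≠ u ∧ v' ≠ v ∧ v' ≠ w ∧ v' ≠ x) ∧
    (w' ≠ u ∧ w' ≠ v ∧ w' ≠ w ∧ w' ≠ x) ∧ (x' ≠ u ∧ x' ≠ v ∧ x' ≠ w ∧ x' ≠ x) ∧
    (u' ≠ v' ∧ u' ≠ x' ∧ w' ≠ v' ∧ w' ≠ x') := by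
  obtain ⟨hf, hu, hv, hw, hx, h1, h2, h3, h4, h5, h6, h7, h8, h9, h10, c1, c2, c3, c4, c5, c6, c7⟩ := h
  grind

/-- `G` has a Hamiltonian cyclic list. -/
def HL (G : SimpleGraph V) : Prop :=
  ∃ L : List V, L.Nodup ∧ (∀ y, y ∈ L) ∧ Cyc G.Adj L

lemma lift_one (h : Cfg G f u v w x u' v' w' x') {M : List V} (hM : PL G.Adj v' u' M)
    (hn : M.Nodup) (hm : ∀ y, y ∈ M ↔ y ≠ u ∧ y ≠ v ∧ y ≠ w ∧ y ≠ x) : HL G := by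
  have hne := h.ne
  have p1 : PL G.Adj u v [u, x, w, v] := by
    refine ⟨?_, by simp, by simp⟩
    simp [h.hu, h.hx, h.hw]
  have hu := h.hu
  have hv := h.hv
  refine ⟨M ++ [u, x, w, v], ?_, ?_, ?_⟩
  · rw [List.nodup_append]
    refine ⟨hn, ?_, ?_⟩
    · simp; grind
    · intro a ha b hb
      have := (hm a).1 ha
      grind
  · intro y
    have := hm y
    grind
  · exact (hM.join p1 ((G.adj_comm _ _).2 ((h.hu _).2 (by simp)))).cyc ((h.hv _).2 (by simp))

/-- Two passages through the 4-cycle. -/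
lemma lift_two (h : Cfg G f u v w x u' v' w' x') {M N : List V} (hM : PL G.Adj v' w' M)
    (hN : PL G.Adj x' u' N)
    (hn : (M ++ N).Nodup) (hm : ∀ y, y ∈ M ++ N ↔ y ≠ u ∧ y ≠ v ∧ y ≠ w ∧ y ≠ x) : HL G := by
  have hne := h.ne
  have p1 : PL G.Adj u v [u, v] := by
    refine ⟨?_, by simp, by simp⟩
    simp [h.hu]
  have p2 : PL G.Adj w x [w, x] := by
    refine ⟨?_, by simp, by simp⟩
    simp [h.hw]
  refine ⟨M ++ [w, x] ++ N ++ [u, v], ?_, ?_, ?_⟩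
  · have : (M ++ [w, x] ++ N ++ [u, v]).Perm ((M ++ N) ++ [w, x, u, v]) := by
      simp only [List.append_assoc]
      refine List.Perm.append_left _ ?_
      have := (List.perm_append_comm (l₁ := [w, x]) (l₂ := N)).append_right [u, v]
      simpa using this
    rw [this.nodup_iff, List.nodup_append]
    refine ⟨hn, ?_, ?_⟩
    · simp; grind
    · intro a ha b hb
      have := (hm a).1 ha
      grind
  · intro y
    have := hm y
    grind
  · refine (((hM.join p2 ?_).join hN ?_).join p1 ?_).cyc ?_
    · exact ((G.adj_comm _ _).2 ((h.hw _).2 (by simp)))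
    · exact (h.hx _).2 (by simp)
    · exact ((G.adj_comm _ _).2 ((h.hu _).2 (by simp)))
    · exact (h.hv _).2 (by simp)

lemma lift_two' (h : Cfg G f u v w x u' v' w' x') {M N : List V} (hM : PL G.Adj v' x' M)
    (hN : PL G.Adj w' u' N)
    (hn : (M ++ N).Nodup) (hm : ∀ y, y ∈ M ++ N ↔ y ≠ u ∧ y ≠ v ∧ y ≠ w ∧ y ≠ x) : HL G := by
  have hne := h.ne
  have p1 : PL G.Adj u v [u, v] := by
    refine ⟨?_, by simp, by simp⟩
    simp [h.hu]
  have p2 : PL G.Adj x w [x, w] := by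
    refine ⟨?_, by simp, by simp⟩
    simp [h.hx]
  refine ⟨M ++ [x, w] ++ N ++ [u, v], ?_, ?_, ?_⟩
  · have : (M ++ [x, w] ++ N ++ [u, v]).Perm ((M ++ N) ++ [x, w, u, v]) := by
      simp only [List.append_assoc]
      refine List.Perm.append_left _ ?_
      have := (List.perm_append_comm (l₁ := [x, w]) (l₂ := N)).append_right [u, v]
      simpa using this
    rw [this.nodup_iff, List.nodup_append]
    refine ⟨hn, ?_, ?_⟩
    · simp; grind
    · intro a ha b hb
      have := (hm a).1 ha
      grind
  · intro y
    have := hm y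
    grind
  · refine (((hM.join p2 ?_).join hN ?_).join p1 ?_).cyc ?_
    · exact ((G.adj_comm _ _).2 ((h.hx _).2 (by simp)))
    · exact (h.hw _).2 (by simp)
    · exact ((G.adj_comm _ _).2 ((h.hu _).2 (by simp)))
    · exact (h.hv _).2 (by simp)

/-- Adjacency after deleting the 4-cycle and adding two outside edges. -/
def RH (G : SimpleGraph V) (u' v' w' x' : V) (a b : V) : Prop :=
  G.Adj a b ∨ (a = u' ∧ b = v') ∨ (a = v' ∧ b = u') ∨ (a = w' ∧ b = x') ∨ (a = x' ∧ b = w')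

lemma lift_H_core (h : Cfg G f u v w x u' v' w' x') {M : List V}
    (hM : PL (RH G u' v' w' x') v' u' M) (hlen : 3 ≤ M.length)
    (hn : M.Nodup) (hm : ∀ y, y ∈ M ↔ y ≠ u ∧ y ≠ v ∧ y ≠ w ∧ y ≠ x) : HL G := by
  by_cases hc : M.IsChain G.Adj
  · exact lift_one h ⟨hc, hM.2⟩ hn hm
  rw [List.isChain_iff_forall_rel_of_append_cons_cons] at hc
  push Not at hc
  obtain ⟨a, b, A, B, rfl, hab⟩ := hc
  have e : A ++ a :: b :: B = (A ++ [a]) ++ (b :: B) := by simp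
  rw [e] at hM hn hm hlen
  obtain ⟨c, d, h1, h2, h3⟩ := hM.split (by simp) (by simp)
  have hca : c = a := by
    have := h1.2.2
    simpa [eq_comm] using this
  have hdb : d = b := by
    have := h2.2.1
    simpa [eq_comm] using this
  subst hca hdb
  have hdis : ∀ y ∈ A ++ [c], y ∉ d :: B := by
    rw [List.nodup_append] at hn
    intro y hy hy'
    exact hn.2.2 y hy y hy' rfl
  have v'1 := h1.mem.1
  have c1 := h1.mem.2
  have d2 := h2.mem.1
  have u'2 := h2.mem.2
  have f1 := hdis _ v'1
  have f2 : u' ∉ A ++ [c] := fun hh => hdis _ hh u'2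
  have f3 := hdis _ c1
  have f4 : d ∉ A ++ [c] := fun hh => hdis _ hh d2
  rcases h3 with h3 | ⟨rfl, rfl⟩ | ⟨rfl, rfl⟩ | ⟨rfl, rfl⟩ | ⟨rfl, rfl⟩
  · exact absurd h3 hab
  · exact absurd d2 f1
  · exfalso
    have hA : A = [] := by
      cases A with
      | nil => rfl
      | cons y A =>
        have h5 := h1.2.1
        simp at h5
        subst h5
        simp [List.nodup_append] at hn
    have hB : B = [] := by
      cases B using List.reverseRecOn with
      | nil => rfl
      | append_singleton B y =>
        have h5 := h2.2.2
        rw [← List.cons_append, List.getLast?_append] at h5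
        simp at h5
        subst h5
        simp [List.nodup_append] at hn
    subst hA hB
    simp at hlen
  · refine lift_two h (h1.mono ?_) (h2.mono ?_) hn hm
    · intro y hy z hz hyz
      rcases hyz with hyz | ⟨rfl, rfl⟩ | ⟨rfl, rfl⟩ | ⟨rfl, rfl⟩ | ⟨rfl, rfl⟩ <;> first | exact hyz | contradiction
    · intro y hy z hz hyz
      rcases hyz with hyz | ⟨rfl, rfl⟩ | ⟨rfl, rfl⟩ | ⟨rfl, rfl⟩ | ⟨rfl, rfl⟩ <;> first | exact hyz | contradiction
  · refine lift_two' h (h1.mono ?_) (h2.mono ?_) hn hm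
    · intro y hy z hz hyz
      rcases hyz with hyz | ⟨rfl, rfl⟩ | ⟨rfl, rfl⟩ | ⟨rfl, rfl⟩ | ⟨rfl, rfl⟩ <;> first | exact hyz | contradiction
    · intro y hy z hz hyz
      rcases hyz with hyz | ⟨rfl, rfl⟩ | ⟨rfl, rfl⟩ | ⟨rfl, rfl⟩ | ⟨rfl, rfl⟩ <;> first | exact hyz | contradiction

lemma RH_symm {a b : V} (h : RH G u' v' w' x' a b) : RH G u' v' w' x' b a := by
  have := G.adj_comm a b
  unfold RH at *; tauto

lemma lift_H (h : Cfg G f u v w x u' v' w' x') {L : List V}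
    (hL : Cyc (RH G u' v' w' x') L) (hlen : 3 ≤ L.length) (hG : ¬ Cyc G.Adj L)
    (hn : L.Nodup) (hm : ∀ y, y ∈ L ↔ y ≠ u ∧ y ≠ v ∧ y ≠ w ∧ y ≠ x) : HL G := by
  obtain ⟨M, a, b, h1, h2, h3, h4, h5, h6⟩ := hL.exists_bad hG
  have hrev := h1.rev (fun a b => RH_symm)
  have hsw : ∀ a b, RH G u' v' w' x' a b → RH G w' x' u' v' a b := by
    intro a b; unfold RH; tauto
  rcases h2 with h2 | ⟨rfl, rfl⟩ | ⟨rfl, rfl⟩ | ⟨rfl, rfl⟩ | ⟨rfl, rfl⟩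
  · exact absurd h2 h3
  · exact lift_H_core h h1 (by omega) (h5 hn) (fun y => (h4 y).trans (hm y))
  · exact lift_H_core h hrev (by simp; omega) (List.nodup_reverse.2 (h5 hn))
      (fun y => List.mem_reverse.trans ((h4 y).trans (hm y)))
  · exact lift_H_core h.swapUW.swapVX (h1.mono fun _ _ _ _ => hsw _ _) (by omega) (h5 hn)
      (fun y => (h4 y).trans ((hm y).trans (by tauto)))
  · exact lift_H_core h.swapUW.swapVX (hrev.mono fun _ _ _ _ => hsw _ _) (by simp; omega)
      (List.nodup_reverse.2 (h5 hn))
      (fun y => List.mem_reverse.trans ((h4 y).trans ((hm y).trans (by tauto))))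

/-- Adjacency after deleting two vertices of the 4-cycle and adding two edges. -/
def RC (G : SimpleGraph V) (u v w' x' : V) (a b : V) : Prop :=
  G.Adj a b ∨ (a = x' ∧ b = v) ∨ (a = v ∧ b = x') ∨ (a = w' ∧ b = u) ∨ (a = u ∧ b = w')

lemma RC_symm {a b : V} (h : RC G u v w' x' a b) : RC G u v w' x' b a := by
  have := G.adj_comm a b
  unfold RC at *; tauto

/-- One passage with arbitrary ends. -/
lemma lift_one_gen (h : Cfg G f u v w x u' v' w' x') {M : List V} {s t : V} (hM : PL G.Adj s t M)
    (hs : s = v' ∨ s = x') (ht : t = u' ∨ t = w')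
    (hn : M.Nodup) (hm : ∀ y, y ∈ M ↔ y ≠ u ∧ y ≠ v ∧ y ≠ w ∧ y ≠ x) : HL G := by
  rcases hs with rfl | rfl <;> rcases ht with rfl | rfl
  · exact lift_one h hM hn hm
  · exact lift_one h.swapUW hM hn (fun y => (hm y).trans (by tauto))
  · exact lift_one h.swapVX hM hn (fun y => (hm y).trans (by tauto))
  · exact lift_one h.swapUW.swapVX hM hn (fun y => (hm y).trans (by tauto))

lemma lift_two_gen (h : Cfg G f u v w x u' v' w' x') {M N : List V} {s t s₂ t₂ : V}
    (hM : PL G.Adj s t M) (hN : PL G.Adj s₂ t₂ N)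
    (hs : s = u' ∨ s = w') (ht₂ : t₂ = u' ∨ t₂ = w') (hne1 : s ≠ t₂)
    (ht : t = v' ∨ t = x') (hs₂ : s₂ = v' ∨ s₂ = x') (hne2 : t ≠ s₂)
    (hn : (M ++ N).Nodup) (hm : ∀ y, y ∈ M ++ N ↔ y ≠ u ∧ y ≠ v ∧ y ≠ w ∧ y ≠ x) : HL G := by
  have hM' := hM.rev (fun a b h => G.adj_comm a b |>.1 h)
  have hp : (M.reverse ++ N).Perm (M ++ N) :=
    (List.reverse_perm M).append_right N
  have hn' := hp.nodup_iff.2 hn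
  have hm' : ∀ y, y ∈ M.reverse ++ N ↔ y ≠ u ∧ y ≠ v ∧ y ≠ w ∧ y ≠ x := by
    intro y; rw [hp.mem_iff]; exact hm y
  rcases hs with rfl | rfl <;> rcases ht₂ with rfl | rfl <;> rcases ht with rfl | rfl <;>
    rcases hs₂ with rfl | rfl <;> first | contradiction | skip
  · exact lift_two h.swapUW hM' hN hn' (fun y => (hm' y).trans (by tauto))
  · exact lift_two h.swapUW.swapVX hM' hN hn' (fun y => (hm' y).trans (by tauto))
  · exact lift_two h hM' hN hn' (fun y => (hm' y).trans (by tauto))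
  · exact lift_two h.swapVX hM' hN hn' (fun y => (hm' y).trans (by tauto))

lemma lift_C (h : Cfg G f u v w x u' v' w' x') {L : List V}
    (hL : Cyc (RC G u v w' x') L) (hlen : 3 ≤ L.length)
    (hn : L.Nodup) (hm : ∀ y, y ∈ L ↔ y ≠ w ∧ y ≠ x) : HL G := by
  have hne := h.ne
  have hu := h.hu
  have hv := h.hv
  -- facts on the reduced adjacency
  have nu : ∀ y, y ≠ w → y ≠ x → y ≠ v → RC G u v w' x' u y → y = u' ∨ y = w' := by
    intro y _ _ _ hy
    unfold RC at hy
    grind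
  have nv : ∀ y, y ≠ w → y ≠ x → y ≠ u → RC G u v w' x' v y → y = v' ∨ y = x' := by
    intro y _ _ _ hy
    unfold RC at hy
    grind
  have nG : ∀ y z, y ≠ u → y ≠ v → z ≠ u → z ≠ v → RC G u v w' x' y z → G.Adj y z := by
    intro y z _ _ _ _ hy
    unfold RC at hy
    grind
  have huL : u ∈ L := (hm u).2 (by tauto)
  obtain ⟨A, B, rfl⟩ := List.append_of_mem huL
  have hC : Cyc (RC G u v w' x') ([u] ++ (B ++ A)) := by
    have := hL.rot
    simpa using this
  have hperm : (A ++ u :: B).Perm (u :: (B ++ A)) := by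
    refine List.perm_middle.trans ?_
    exact (List.perm_append_comm).cons u
  have hn' := hperm.nodup_iff.1 hn
  have hm' : ∀ y, y ∈ u :: (B ++ A) ↔ y ≠ w ∧ y ≠ x := fun y => by
    rw [← hperm.mem_iff]; exact hm y
  rw [hperm.length_eq] at hlen
  generalize B ++ A = K at hC hn' hm' hlen
  have hvK : v ∈ K := by
    have := (hm' v).2 (by tauto)
    rw [List.mem_cons] at this
    exact this.resolve_left (by tauto)
  obtain ⟨M, N, rfl⟩ := List.append_of_mem hvK
  rw [List.nodup_cons, List.nodup_middle, List.nodup_cons] at hn'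
  obtain ⟨hn1, hn2, hn3⟩ := hn'
  have hmem : ∀ y, y ∈ M ++ N ↔ y ≠ u ∧ y ≠ v ∧ y ≠ w ∧ y ≠ x := by
    intro y
    have h1 := hm' y
    simp only [List.mem_cons, List.mem_append] at h1 hn1 hn2 ⊢
    grind
  have hMm : ∀ y ∈ M, y ≠ u ∧ y ≠ v ∧ y ≠ w ∧ y ≠ x := fun y hy =>
    (hmem y).1 (List.mem_append_left _ hy)
  have hNm : ∀ y ∈ N, y ≠ u ∧ y ≠ v ∧ y ≠ w ∧ y ≠ x := fun y hy =>
    (hmem y).1 (List.mem_append_right _ hy)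
  have hsu : ∀ s, s ≠ u ∧ s ≠ v ∧ s ≠ w ∧ s ≠ x → RC G u v w' x' u s → s = u' ∨ s = w' :=
    fun s hs h => nu s hs.2.2.1 hs.2.2.2 hs.2.1 h
  have hsv : ∀ s, s ≠ u ∧ s ≠ v ∧ s ≠ w ∧ s ≠ x → RC G u v w' x' v s → s = v' ∨ s = x' :=
    fun s hs h => nv s hs.2.2.1 hs.2.2.2 hs.1 h
  have toG : ∀ (K : List V) s t, (∀ y ∈ K, y ≠ u ∧ y ≠ v ∧ y ≠ w ∧ y ≠ x) →
      PL (RC G u v w' x') s t K → PL G.Adj s t K := by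
    intro K s t hK hP
    refine hP.mono fun y hy z hz => nG y z (hK y hy).1 (hK y hy).2.1 (hK z hz).1 (hK z hz).2.1
  obtain ⟨a, b, p1, p2⟩ := hC.toPL (by simp)
  have hau : a = u := by
    have := p1.2.1
    simpa [eq_comm] using this
  subst hau
  by_cases hMe : M = []
  · subst hMe
    by_cases hNe : N = []
    · subst hNe; simp at hlen
    have p1' : PL (RC G a v w' x') a b ([a, v] ++ N) := by simpa using p1
    obtain ⟨c, d, q1, q2, q3⟩ := p1'.split (by simp) hNe
    have hcv : c = v := by
      have := q1.2.2
      simpa [eq_comm] using this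
    subst hcv
    refine lift_one_gen h (toG N _ _ hNm q2) (hsv _ (hNm _ q2.mem.1) q3)
      (hsu _ (hNm _ q2.mem.2) (RC_symm p2)) (by simpa using hn3) (by simpa using hmem)
  · by_cases hNe : N = []
    · subst hNe
      have p1' : PL (RC G a v w' x') a b ([a] ++ (M ++ [v])) := by simpa using p1
      obtain ⟨c, d, q1, q2, q3⟩ := p1'.split (by simp) (by simp)
      obtain ⟨e, g, r1, r2, r3⟩ := q2.split hMe (by simp)
      have hca : c = a := by
        have := q1.2.2
        simpa [eq_comm] using this
      have hgv : g = v := by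
        have := r2.2.1
        simpa [eq_comm] using this
      subst hca hgv
      refine lift_one_gen h ((toG M _ _ hMm r1).rev (fun a b h => G.adj_comm a b |>.1 h))
        (hsv _ (hMm _ r1.mem.2) (RC_symm r3))
        (hsu _ (hMm _ r1.mem.1) q3) (by simpa using hn3) (by simpa using hmem)
    · have p1' : PL (RC G a v w' x') a b ([a] ++ (M ++ ([v] ++ N))) := by simpa using p1
      obtain ⟨c, d, q1, q2, q3⟩ := p1'.split (by simp) (by simp)
      obtain ⟨e, g, r1, r2, r3⟩ := q2.split hMe (by simp)
      obtain ⟨i, j, s1, s2, s3⟩ := r2.split (by simp) hNe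
      have hca : c = a := by
        have := q1.2.2
        simpa [eq_comm] using this
      have hgv : g = v := by
        have := s1.2.1
        simpa [eq_comm] using this
      have hiv : i = v := by
        have := s1.2.2
        simpa [eq_comm] using this
      subst hca hgv hiv
      have hdis : ∀ y ∈ M, ∀ z ∈ N, y ≠ z := (List.nodup_append.1 hn3).2.2
      exact lift_two_gen h (toG M _ _ hMm r1) (toG N _ _ hNm s2)
        (hsu _ (hMm _ r1.mem.1) q3) (hsu _ (hNm _ s2.mem.2) (RC_symm p2))
        (hdis _ r1.mem.1 _ s2.mem.2)
        (hsv _ (hMm _ r1.mem.2) (RC_symm r3)) (hsv _ (hNm _ s2.mem.1) s3)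
        (hdis _ r1.mem.2 _ s2.mem.1) hn3 hmem

end lists

section main
variable {V : Type} [Fintype V] [DecidableEq V]
variable {G : SimpleGraph V} {f : V → Fin 2} {u v w x u' v' w' x' : V}

lemma Cfg.eCnt_C (h : Cfg G f u v w x u' v' w' x') (A : Finset V)
    (hA : A ⊆ ({u, v, w, x} : Finset V)ᶜ) :
    eCnt G A {u} = (if u' ∈ A then 1 else 0) ∧ eCnt G A {v} = (if v' ∈ A then 1 else 0) ∧
    eCnt G A {w} = (if w' ∈ A then 1 else 0) ∧ eCnt G A {x} = (if x' ∈ A then 1 else 0) := by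
  have hne := h.ne
  have hu : u ∉ A := fun hh => by have := hA hh; simp at this
  have hv : v ∉ A := fun hh => by have := hA hh; simp at this
  have hw : w ∉ A := fun hh => by have := hA hh; simp at this
  have hx : x ∉ A := fun hh => by have := hA hh; simp at this
  refine ⟨?_, ?_, ?_, ?_⟩
  · rw [eCnt_nbr G h.vx h.u'v.symm h.u'x.symm h.hu]; simp [hv, hx]
  · rw [eCnt_nbr G h.uw h.v'u.symm h.v'w.symm h.hv]; simp [hu, hw]
  · rw [eCnt_nbr G h.vx h.w'v.symm h.w'x.symm h.hw]; simp [hv, hx]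
  · rw [eCnt_nbr G h.uw h.x'u.symm h.x'w.symm h.hx]; simp [hu, hw]

lemma Cfg.eCnt_C_sum (h : Cfg G f u v w x u' v' w' x') (A : Finset V)
    (hA : A ⊆ ({u, v, w, x} : Finset V)ᶜ) :
    eCnt G A {u, v, w, x} = (if u' ∈ A then 1 else 0) + (if v' ∈ A then 1 else 0) +
      (if w' ∈ A then 1 else 0) + (if x' ∈ A then 1 else 0) := by
  have hne := h.ne
  obtain ⟨h1, h2, h3, h4⟩ := h.eCnt_C A hA
  rw [eCnt_insert_right G _ (by grind), eCnt_insert_right G _ (by grind),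
    eCnt_insert_right G _ (by grind), h1, h2, h3, h4]
  omega

/-- Cut condition inside the complement of the 4-cycle. -/
lemma Cfg.gcut (h : Cfg G f u v w x u' v' w' x')
    (hcut : ∀ X : Finset V, X.Nonempty → Xᶜ.Nonempty → 3 ≤ eCnt G X Xᶜ)
    (A : Finset V) (hA : A ⊆ ({u, v, w, x} : Finset V)ᶜ) (hne : A.Nonempty) :
    3 ≤ (if u' ∈ A then 1 else 0) + (if v' ∈ A then 1 else 0) +
      (if w' ∈ A then 1 else 0) + (if x' ∈ A then 1 else 0) +
      eCnt G A (({u, v, w, x} : Finset V)ᶜ \ A) := by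
  have hu : u ∉ A := fun hh => by have := hA hh; simp at this
  have h1 := hcut A hne ⟨u, by simpa using hu⟩
  have h2 : Aᶜ = ({u, v, w, x} : Finset V) ∪ (({u, v, w, x} : Finset V)ᶜ \ A) := by
    ext y
    have := @hA y
    simp only [Finset.mem_compl, Finset.mem_union, Finset.mem_sdiff] at this ⊢
    tauto
  have h3 : Disjoint ({u, v, w, x} : Finset V) (({u, v, w, x} : Finset V)ᶜ \ A) := by
    rw [Finset.disjoint_left]
    intro y hy hy'
    simp only [Finset.mem_sdiff, Finset.mem_compl] at hy'
    exact hy'.1 hy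
  rw [h2, eCnt_union_right G _ h3, h.eCnt_C_sum A hA] at h1
  exact h1

lemma Cfg.deg (h : Cfg G f u v w x u' v' w' x')
    (hdeg : ∀ y, eCnt G {y} Finset.univ = 3) (y : V)
    (hy : y ∈ ({u, v, w, x} : Finset V)ᶜ) :
    3 = (if u' = y then 1 else 0) + (if v' = y then 1 else 0) +
      (if w' = y then 1 else 0) + (if x' = y then 1 else 0) +
      eCnt G {y} (({u, v, w, x} : Finset V)ᶜ) := by
  have h1 := hdeg y
  rw [← Finset.union_compl ({u, v, w, x} : Finset V), eCnt_union_right G _ disjoint_compl_right,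
    h.eCnt_C_sum {y} (by simpa using hy)] at h1
  simp only [Finset.mem_singleton] at h1
  exact h1.symm

lemma Cfg.primes (h : Cfg G f u v w x u' v' w' x') :
    u' ∈ ({u, v, w, x} : Finset V)ᶜ ∧ v' ∈ ({u, v, w, x} : Finset V)ᶜ ∧
    w' ∈ ({u, v, w, x} : Finset V)ᶜ ∧ x' ∈ ({u, v, w, x} : Finset V)ᶜ := by
  have hne := h.ne
  simp only [Finset.mem_compl, Finset.mem_insert, Finset.mem_singleton]
  tauto

/-- Doubly degenerate case: the graph is `K_{3,3}`. -/
lemma deg_case (h : Cfg G f u v w x u' v' w' x')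
    (hdeg : ∀ y, eCnt G {y} Finset.univ = 3)
    (hcut : ∀ X : Finset V, X.Nonempty → Xᶜ.Nonempty → 3 ≤ eCnt G X Xᶜ)
    (h1 : u' = w') (h2 : v' = x') : HL G := by
  subst h1 h2
  have hne := h.ne
  obtain ⟨pu, pv, -, -⟩ := h.primes
  have du := h.deg hdeg u' pu
  have dv := h.deg hdeg v' pv
  have hg := h.gcut hcut
  have n1 : u' ≠ v' := by tauto
  simp only [n1, n1.symm, if_true, if_false] at du dv
  set S := ({u, v, w, x} : Finset V)ᶜ with hS
  have hsub : ({u', v'} : Finset V) ⊆ S := by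
    intro y; simp only [Finset.mem_insert, Finset.mem_singleton]; rintro (rfl | rfl) <;> assumption
  have n2 : u' ∉ ({v'} : Finset V) := by simpa
  rw [eCnt_split_right G _ hsub, eCnt_insert_right G _ n2] at du dv
  have hs : eCnt G {u'} {u'} = 0 := by classical simp [eCnt_singleton]
  have hs' : eCnt G {v'} {v'} = 0 := by classical simp [eCnt_singleton]
  have hall : S \ {u', v'} = ∅ := by
    by_contra hcon
    have h3 := hg (S \ {u', v'}) Finset.sdiff_subset (Finset.nonempty_iff_ne_empty.2 hcon)
    rw [Finset.sdiff_sdiff_eq_self hsub, eCnt_comm, eCnt_insert_left G _ n2] at h3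
    simp at h3
    omega
  rw [hall] at du
  simp only [eCnt_empty_right, hs] at du
  have hadj : G.Adj u' v' := by
    classical
    by_contra hcon
    rw [eCnt_singleton, if_neg hcon] at du
    omega
  refine lift_one h (M := [v', u']) ⟨by simpa using hadj.symm, by simp, by simp⟩ (by simpa using n1.symm) ?_
  intro y
  have h3 : y ∈ S ↔ y ∈ ({u', v'} : Finset V) :=
    ⟨fun hy => by_contra fun hy' => by
      have : y ∈ S \ {u', v'} := Finset.mem_sdiff.2 ⟨hy, hy'⟩
      rw [hall] at this; simp at this, fun hy => hsub hy⟩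
  rw [hS] at h3
  simp only [Finset.mem_compl, Finset.mem_insert, Finset.mem_singleton] at h3
  simp only [List.mem_cons, List.not_mem_nil, or_false]
  tauto

/-- Data of the 3-edge cut structure around the 4-cycle. -/
structure CutS (G : SimpleGraph V) (u v w x u' v' w' x' : V) (X Y : Finset V) : Prop where
  un : X ∪ Y = ({u, v, w, x} : Finset V)ᶜ
  dis : Disjoint X Y
  mu : u' ∈ X
  mw : w' ∈ X
  mv : v' ∈ Y
  mx : x' ∈ Y
  one : eCnt G X Y = 1

lemma CutS.swap {X Y : Finset V} (hc : CutS G u v w x u' v' w' x' X Y) :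
    CutS G v u x w v' u' x' w' Y X := by
  obtain ⟨h1, h2, h3, h4, h5, h6, h7⟩ := hc
  refine ⟨?_, h2.symm, h5, h6, h3, h4, by rwa [eCnt_comm]⟩
  rw [Finset.union_comm, h1]; congr 1; ext y; simp; tauto

lemma CutS.swap2 {X Y : Finset V} (hc : CutS G u v w x u' v' w' x' X Y) :
    CutS G w x u v w' x' u' v' X Y := by
  obtain ⟨h1, h2, h3, h4, h5, h6, h7⟩ := hc
  refine ⟨?_, h2, h4, h3, h6, h5, h7⟩
  rw [h1]; congr 1; ext y; simp; tauto

lemma cut_adj {X Y : Finset V} (h : Cfg G f u v w x u' v' w' x')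
    (hc : CutS G u v w x u' v' w' x' X Y)
    (hdeg : ∀ y, eCnt G {y} Finset.univ = 3)
    (hcut : ∀ X : Finset V, X.Nonempty → Xᶜ.Nonempty → 3 ≤ eCnt G X Xᶜ)
    (hadj : G.Adj u' v') : u' = w' := by
  by_contra hne
  have hg := h.gcut hcut
  have du := h.deg hdeg u' h.primes.1
  have hn := h.ne
  obtain ⟨un, dis, mu, mw, mv, mx, one⟩ := hc
  rw [← un] at hg du
  have hd := Finset.disjoint_left.1 dis
  have hXe : X = insert u' (X.erase u') := (Finset.insert_erase mu).symm
  have n1 : u' ∉ X.erase u' := by simp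
  have h1 := hg (X.erase u') (fun y hy => Finset.mem_union_left _ (Finset.mem_of_mem_erase hy))
    ⟨w', by simp [mw, Ne.symm hne]⟩
  have n2 : u' ∉ Y := hd mu
  have e1 : (X ∪ Y) \ X.erase u' = insert u' Y := by
    ext y
    have := @hd y
    simp only [Finset.mem_sdiff, Finset.mem_union, Finset.mem_erase, Finset.mem_insert]
    grind
  have m1 : v' ∉ X := fun hh => hd hh mv
  have m2 : x' ∉ X := fun hh => hd hh mx
  rw [e1, eCnt_insert_right G _ n2] at h1
  rw [eCnt_union_right G _ dis, hXe, eCnt_insert_right G _ n1] at du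
  have o : eCnt G {u'} Y + eCnt G (X.erase u') Y = 1 := by
    rw [← one]; conv_rhs => rw [hXe, eCnt_insert_left G _ n1]
  have p := eCnt_pos G (A := {u'}) (by simp) mv hadj
  rw [eCnt_comm G _ {u'}] at h1
  simp [m1, m2, mw, Ne.symm hne] at h1 
  simp at du
  have : w' ≠ u' := Ne.symm hne
  grind

lemma cross {R : V → V → Prop} {X : Finset V} : ∀ (M : List V) (a b : V),
    List.IsChain R (a :: (M ++ [b])) → a ∈ X → b ∉ X →
    ∃ p ∈ a :: M, ∃ q ∈ M ++ [b], R p q ∧ p ∈ X ∧ q ∉ X := by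
  intro M
  induction M with
  | nil =>
    intro a b h ha hb
    exact ⟨a, by simp, b, by simp, by simpa using h, ha, hb⟩
  | cons m M ih =>
    intro a b h ha hb
    rw [List.cons_append, List.isChain_cons_cons] at h
    by_cases hm : m ∈ X
    · obtain ⟨p, hp, q, hq, h1, h2, h3⟩ := ih m b h.2 hm hb
      exact ⟨p, List.mem_cons_of_mem _ hp, q, by
        rw [List.cons_append]; exact List.mem_cons_of_mem _ hq, h1, h2, h3⟩
    · exact ⟨a, by simp, m, by simp, h.1, ha, hm⟩

lemma eCnt_one_unique {X Y : Finset V} (h : eCnt G X Y = 1) {p q p' q' : V} (hp : p ∈ X)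
    (hq : q ∈ Y) (hp' : p' ∈ X) (hq' : q' ∈ Y) (h1 : G.Adj p q) (h2 : G.Adj p' q') :
    p = p' ∧ q = q' := by
  have key : ∀ (X Y : Finset V) (p q p' q' : V), eCnt G X Y = 1 → p ∈ X → q ∈ Y → p' ∈ X →
      q' ∈ Y → G.Adj p q → G.Adj p' q' → p = p' := by
    intro X Y p q p' q' h hp hq hp' hq' h1 h2
    by_contra hne
    have e : X = insert p (X.erase p) := (Finset.insert_erase hp).symm
    rw [e, eCnt_insert_left G _ (by simp)] at h
    have a1 := eCnt_pos G (A := {p}) (by simp) hq h1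
    have a2 := eCnt_pos G (A := X.erase p) (Finset.mem_erase.2 ⟨Ne.symm hne, hp'⟩) hq' h2
    omega
  exact ⟨key X Y p q p' q' h hp hq hp' hq' h1 h2,
    key Y X q p q' p' (by rwa [eCnt_comm]) hq hp hq' hp' h1.symm h2.symm⟩

lemma not_cyc {X Y : Finset V} (h : Cfg G f u v w x u' v' w' x')
    (hc : CutS G u v w x u' v' w' x' X Y) (hadj : ¬ G.Adj u' v') (L : List V) (hn : L.Nodup)
    (hm : ∀ y, y ∈ L ↔ y ∈ ({u, v, w, x} : Finset V)ᶜ) : ¬ Cyc G.Adj L := by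
  intro hL
  obtain ⟨un, dis, mu, mw, mv, mx, one⟩ := hc
  have hd := Finset.disjoint_left.1 dis
  have hne := h.ne
  have huL : u' ∈ L := (hm u').2 h.primes.1
  obtain ⟨A, B, rfl⟩ := List.append_of_mem huL
  have hC : Cyc G.Adj ([u'] ++ (B ++ A)) := by
    have := hL.rot
    simpa using this
  have hperm : (A ++ u' :: B).Perm (u' :: (B ++ A)) := by
    refine List.perm_middle.trans ?_
    exact (List.perm_append_comm).cons u'
  have hn' := hperm.nodup_iff.1 hn
  have hm' : ∀ y, y ∈ u' :: (B ++ A) ↔ y ∈ X ∪ Y := fun y => by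
    rw [← hperm.mem_iff, un]; exact hm y
  generalize B ++ A = K at hC hn' hm'
  have hvK : v' ∈ K := by
    have := (hm' v').2 (Finset.mem_union_right _ mv)
    rw [List.mem_cons] at this
    exact this.resolve_left (by tauto)
  obtain ⟨M, N, rfl⟩ := List.append_of_mem hvK
  rw [List.nodup_cons, List.nodup_middle, List.nodup_cons] at hn'
  obtain ⟨hn1, hn2, hn3⟩ := hn'
  obtain ⟨a, b, p1, p2⟩ := hC.toPL (by simp)
  have hau : a = u' := by
    have := p1.2.1
    simpa [eq_comm] using this
  subst hau
  have p3 := (p1.join (c := a) (d := a) (M := [a]) ⟨by simp, by simp, by simp⟩ p2).1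
  have p4 : List.IsChain G.Adj ((a :: M) ++ v' :: (N ++ [a])) := by simpa using p3
  rw [List.isChain_split] at p4
  obtain ⟨q1, q2⟩ := p4
  have hXY : ∀ y ∈ a :: (M ++ v' :: N), y ∉ X → y ∈ Y := by
    intro y hy hy'
    have := (hm' y).1 hy
    rw [Finset.mem_union] at this
    exact this.resolve_left hy'
  have hYX : ∀ y ∈ a :: (M ++ v' :: N), y ∉ Y → y ∈ X := by
    intro y hy hy'
    have := (hm' y).1 hy
    rw [Finset.mem_union] at this
    exact this.resolve_right hy'
  obtain ⟨p, hp, q, hq, r1, r2, r3⟩ := cross (X := X) M a v' q1 mu (fun hh => hd hh mv)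
  obtain ⟨q', hq', p', hp', s1, s2, s3⟩ := cross (X := Y) N v' a q2 mv (hd mu)
  have t1 : q ∈ Y := hXY q (by simp at hq ⊢; tauto) r3
  have t2 : p' ∈ X := hYX p' (by simp at hp' ⊢; tauto) s3
  obtain ⟨rfl, rfl⟩ := eCnt_one_unique one r2 t1 t2 s2 r1 s1.symm
  have hdis : ∀ y ∈ M, ∀ z ∈ N, y ≠ z := (List.nodup_append.1 hn3).2.2
  have e1 : p = a := by
    simp only [List.mem_cons, List.mem_append, List.not_mem_nil, or_false] at hp hp' hn1
    rcases hp with hp | hp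
    · exact hp
    · rcases hp' with hp' | hp'
      · exact absurd rfl (hdis _ hp _ hp')
      · exact hp'
  have e2 : q = v' := by
    simp only [List.mem_cons, List.mem_append, List.not_mem_nil, or_false] at hq hq'
    rcases hq with hq | hq
    · rcases hq' with hq' | hq'
      · exact hq'
      · exact absurd rfl (hdis _ hq _ hq')
    · exact hq
  subst e1 e2
  exact hadj r1

end main
section main2
variable {V : Type} [Fintype V] [DecidableEq V]
variable {G : SimpleGraph V} {f : V → Fin 2} {u v w x u' v' w' x' : V}

lemma three_le_length {L : List V} {a b c : V} (ha : a ∈ L) (hb : b ∈ L) (hc : c ∈ L)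
    (h1 : a ≠ b) (h2 : a ≠ c) (h3 : b ≠ c) : 3 ≤ L.length := by
  have : ({a, b, c} : Finset V) ⊆ L.toFinset := by
    intro y; simp only [Finset.mem_insert, Finset.mem_singleton, List.mem_toFinset]
    rintro (rfl | rfl | rfl) <;> assumption
  have h4 := Finset.card_le_card this
  rw [Finset.card_eq_three.2 ⟨a, b, c, h1, h2, h3, rfl⟩] at h4
  exact h4.trans (List.toFinset_card_le L)

lemma Cyc.imp' {R R' : V → V → Prop} (h : ∀ a b, R a b → R' a b) {L : List V} (hL : Cyc R L) :
    Cyc R' L :=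
  ⟨hL.1.imp h, fun a ha b hb => h _ _ (hL.2 a ha b hb)⟩

lemma bit_and {P Q : Prop} [Decidable P] [Decidable Q] :
    (if P then 1 else 0) + (if Q then 1 else 0) ≤ 1 + (if P ∧ Q then 1 else 0) := by
  by_cases P <;> by_cases Q <;> simp [*]

lemma bit_part {A Z : Finset V} {p : V} (hp : p ∈ A) :
    (if p ∈ A ∩ Z then 1 else 0) + (if p ∈ A \ Z then 1 else 0) = 1 := by
  by_cases h : p ∈ Z <;> simp [hp, h]

set_option maxHeartbeats 4000000 in
lemma cut_cut {X Y : Finset V} (h : Cfg G f u v w x u' v' w' x')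
    (hc : CutS G u v w x u' v' w' x' X Y)
    (hcut : ∀ X : Finset V, X.Nonempty → Xᶜ.Nonempty → 3 ≤ eCnt G X Xᶜ)
    (Z : Finset V) (hZ : Z ⊆ X ∪ Y) (hZne : Z.Nonempty) (hZ' : ((X ∪ Y) \ Z).Nonempty) :
    3 ≤ eCnt G Z ((X ∪ Y) \ Z) + (if u' ∈ Z ∧ v' ∈ (X ∪ Y) \ Z then 1 else 0)
      + (if v' ∈ Z ∧ u' ∈ (X ∪ Y) \ Z then 1 else 0)
      + (if w' ∈ Z ∧ x' ∈ (X ∪ Y) \ Z then 1 else 0)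
      + (if x' ∈ Z ∧ w' ∈ (X ∪ Y) \ Z then 1 else 0) := by
  have hg := h.gcut hcut
  obtain ⟨un, dis, mu, mw, mv, mx, one⟩ := hc
  rw [← un] at hg
  have hd := Finset.disjoint_left.1 dis
  have hd' := Finset.disjoint_right.1 dis
  have eZ : Z = (X ∩ Z) ∪ (Y ∩ Z) := by
    ext y; have := @hZ y; simp only [Finset.mem_union, Finset.mem_inter] at *; tauto
  have eZ' : (X ∪ Y) \ Z = (X \ Z) ∪ (Y \ Z) := by
    ext y; simp only [Finset.mem_union, Finset.mem_sdiff]; tauto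
  have d1 : Disjoint (X ∩ Z) (Y ∩ Z) := dis.mono Finset.inter_subset_left Finset.inter_subset_left
  have d2 : Disjoint (X \ Z) (Y \ Z) := dis.mono Finset.sdiff_subset Finset.sdiff_subset
  have eX : X = (X ∩ Z) ∪ (X \ Z) := by
    ext y; simp only [Finset.mem_union, Finset.mem_inter, Finset.mem_sdiff]; tauto
  have eY : Y = (Y ∩ Z) ∪ (Y \ Z) := by
    ext y; simp only [Finset.mem_union, Finset.mem_inter, Finset.mem_sdiff]; tauto
  have dX : Disjoint (X ∩ Z) (X \ Z) := by
    rw [Finset.disjoint_left]; intro y; simp only [Finset.mem_inter, Finset.mem_sdiff]; tauto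
  have dY : Disjoint (Y ∩ Z) (Y \ Z) := by
    rw [Finset.disjoint_left]; intro y; simp only [Finset.mem_inter, Finset.mem_sdiff]; tauto
  have c1 : eCnt G Z ((X ∪ Y) \ Z) = eCnt G (X ∩ Z) (X \ Z) + eCnt G (X ∩ Z) (Y \ Z)
      + eCnt G (Y ∩ Z) (X \ Z) + eCnt G (Y ∩ Z) (Y \ Z) := by
    rw [eZ']
    conv_lhs => rw [eCnt_union_right G _ d2]
    conv_lhs => enter [1]; rw [show eCnt G Z (X \ Z) = eCnt G (X ∩ Z ∪ Y ∩ Z) (X \ Z) by rw [← eZ]]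
    conv_lhs => enter [2]; rw [show eCnt G Z (Y \ Z) = eCnt G (X ∩ Z ∪ Y ∩ Z) (Y \ Z) by rw [← eZ]]
    rw [eCnt_union_left G _ d1, eCnt_union_left G _ d1]
    omega
  have c2 : eCnt G (X ∩ Z) (Y ∩ Z) + eCnt G (X ∩ Z) (Y \ Z) + eCnt G (X \ Z) (Y ∩ Z)
      + eCnt G (X \ Z) (Y \ Z) = 1 := by
    rw [← one, show eCnt G X Y = eCnt G (X ∩ Z ∪ X \ Z) (Y ∩ Z ∪ Y \ Z) by rw [← eX, ← eY],
      eCnt_union_left G _ dX, eCnt_union_right G _ dY, eCnt_union_right G _ dY]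
    omega
  have disj3 : ∀ {A B C : Finset V}, A ⊆ X → B ⊆ X → C ⊆ Y → (Disjoint B C) :=
    fun _ hB hC => dis.mono hB hC
  -- the four local cut conditions
  have g1 : X ∩ Z = ∅ ∨ 3 ≤ (if u' ∈ X ∩ Z then 1 else 0) + (if w' ∈ X ∩ Z then 1 else 0)
      + (eCnt G (X ∩ Z) (X \ Z) + (eCnt G (X ∩ Z) (Y ∩ Z) + eCnt G (X ∩ Z) (Y \ Z))) := by
    rcases Finset.eq_empty_or_nonempty (X ∩ Z) with h0 | h0
    · exact Or.inl h0
    right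
    have := hg (X ∩ Z) (fun y hy => Finset.mem_union_left _ (Finset.inter_subset_left hy)) h0
    have e : (X ∪ Y) \ (X ∩ Z) = (X \ Z) ∪ Y := by
      ext y; have := @hd y; simp only [Finset.mem_union, Finset.mem_inter, Finset.mem_sdiff]; tauto
    rw [e, eCnt_union_right G _ (dis.mono_left Finset.sdiff_subset)] at this
    rw [show eCnt G (X ∩ Z) Y = eCnt G (X ∩ Z) (Y ∩ Z ∪ Y \ Z) by rw [← eY],
      eCnt_union_right G _ dY] at this
    rw [if_neg (c := v' ∈ X ∩ Z) (fun hh => hd (Finset.inter_subset_left hh) mv),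
      if_neg (c := x' ∈ X ∩ Z) (fun hh => hd (Finset.inter_subset_left hh) mx)] at this
    omega
  have g2 : X \ Z = ∅ ∨ 3 ≤ (if u' ∈ X \ Z then 1 else 0) + (if w' ∈ X \ Z then 1 else 0)
      + (eCnt G (X ∩ Z) (X \ Z) + (eCnt G (X \ Z) (Y ∩ Z) + eCnt G (X \ Z) (Y \ Z))) := by
    rcases Finset.eq_empty_or_nonempty (X \ Z) with h0 | h0
    · exact Or.inl h0
    right
    have := hg (X \ Z) (fun y hy => Finset.mem_union_left _ (Finset.sdiff_subset hy)) h0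
    have e : (X ∪ Y) \ (X \ Z) = (X ∩ Z) ∪ Y := by
      ext y; have := @hd y; simp only [Finset.mem_union, Finset.mem_inter, Finset.mem_sdiff]; tauto
    rw [e, eCnt_union_right G _ (dis.mono_left Finset.inter_subset_left)] at this
    rw [show eCnt G (X \ Z) Y = eCnt G (X \ Z) (Y ∩ Z ∪ Y \ Z) by rw [← eY],
      eCnt_union_right G _ dY, eCnt_comm G (X \ Z) (X ∩ Z)] at this
    rw [if_neg (c := v' ∈ X \ Z) (fun hh => hd (Finset.sdiff_subset hh) mv),
      if_neg (c := x' ∈ X \ Z) (fun hh => hd (Finset.sdiff_subset hh) mx)] at this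
    omega
  have g3 : Y ∩ Z = ∅ ∨ 3 ≤ (if v' ∈ Y ∩ Z then 1 else 0) + (if x' ∈ Y ∩ Z then 1 else 0)
      + (eCnt G (Y ∩ Z) (Y \ Z) + (eCnt G (X ∩ Z) (Y ∩ Z) + eCnt G (X \ Z) (Y ∩ Z))) := by
    rcases Finset.eq_empty_or_nonempty (Y ∩ Z) with h0 | h0
    · exact Or.inl h0
    right
    have := hg (Y ∩ Z) (fun y hy => Finset.mem_union_right _ (Finset.inter_subset_left hy)) h0
    have e : (X ∪ Y) \ (Y ∩ Z) = X ∪ (Y \ Z) := by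
      ext y; have := @hd y; simp only [Finset.mem_union, Finset.mem_inter, Finset.mem_sdiff]; tauto
    rw [e, eCnt_union_right G _ (dis.mono_right Finset.sdiff_subset)] at this
    rw [eCnt_comm G (Y ∩ Z) X, show eCnt G X (Y ∩ Z) = eCnt G (X ∩ Z ∪ X \ Z) (Y ∩ Z) by rw [← eX],
      eCnt_union_left G _ dX] at this
    rw [if_neg (c := u' ∈ Y ∩ Z) (fun hh => hd mu (Finset.inter_subset_left hh)),
      if_neg (c := w' ∈ Y ∩ Z) (fun hh => hd mw (Finset.inter_subset_left hh))] at this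
    omega
  have g4 : Y \ Z = ∅ ∨ 3 ≤ (if v' ∈ Y \ Z then 1 else 0) + (if x' ∈ Y \ Z then 1 else 0)
      + (eCnt G (Y ∩ Z) (Y \ Z) + (eCnt G (X ∩ Z) (Y \ Z) + eCnt G (X \ Z) (Y \ Z))) := by
    rcases Finset.eq_empty_or_nonempty (Y \ Z) with h0 | h0
    · exact Or.inl h0
    right
    have := hg (Y \ Z) (fun y hy => Finset.mem_union_right _ (Finset.sdiff_subset hy)) h0
    have e : (X ∪ Y) \ (Y \ Z) = X ∪ (Y ∩ Z) := by
      ext y; have := @hd y; simp only [Finset.mem_union, Finset.mem_inter, Finset.mem_sdiff]; tauto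
    rw [e, eCnt_union_right G _ (dis.mono_right Finset.inter_subset_left)] at this
    rw [eCnt_comm G (Y \ Z) X, show eCnt G X (Y \ Z) = eCnt G (X ∩ Z ∪ X \ Z) (Y \ Z) by rw [← eX],
      eCnt_union_left G _ dX, eCnt_comm G (Y \ Z) (Y ∩ Z)] at this
    rw [if_neg (c := u' ∈ Y \ Z) (fun hh => hd mu (Finset.sdiff_subset hh)),
      if_neg (c := w' ∈ Y \ Z) (fun hh => hd mw (Finset.sdiff_subset hh))] at this
    omega
  have bu := bit_part (Z := Z) mu
  have bw := bit_part (Z := Z) mw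
  have bv := bit_part (Z := Z) mv
  have bx := bit_part (Z := Z) mx
  have k : ∀ p ∈ X, (p ∈ X ∩ Z ↔ p ∈ Z) ∧ (p ∈ X \ Z ↔ p ∈ (X ∪ Y) \ Z) := by
    intro p hp; simp [hp]
  have k' : ∀ p ∈ Y, (p ∈ Y ∩ Z ↔ p ∈ Z) ∧ (p ∈ Y \ Z ↔ p ∈ (X ∪ Y) \ Z) := by
    intro p hp; simp [hp]
  have b1 := bit_and (P := u' ∈ X ∩ Z) (Q := v' ∈ Y \ Z)
  have b2 := bit_and (P := v' ∈ Y ∩ Z) (Q := u' ∈ X \ Z)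
  have b3 := bit_and (P := w' ∈ X ∩ Z) (Q := x' ∈ Y \ Z)
  have b4 := bit_and (P := x' ∈ Y ∩ Z) (Q := w' ∈ X \ Z)
  rw [c1]
  simp only [← (k _ mu).1, ← (k _ mu).2, ← (k _ mw).1, ← (k _ mw).2, ← (k' _ mv).1, ← (k' _ mv).2,
    ← (k' _ mx).1, ← (k' _ mx).2]
  have n1 : ¬ (X ∩ Z = ∅ ∧ Y ∩ Z = ∅) := by
    rintro ⟨q1, q2⟩; rw [q1, q2] at eZ; simp at eZ; simp [eZ] at hZne
  have n2 : ¬ (X \ Z = ∅ ∧ Y \ Z = ∅) := by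
    rintro ⟨q1, q2⟩; rw [q1, q2] at eZ'; simp [eZ'] at hZ'
  have z1 : X ∩ Z = ∅ → eCnt G (X ∩ Z) (X \ Z) = 0 ∧ eCnt G (X ∩ Z) (Y ∩ Z) = 0 ∧
      eCnt G (X ∩ Z) (Y \ Z) = 0 ∧ (if u' ∈ X ∩ Z then 1 else 0) = 0 ∧
      (if w' ∈ X ∩ Z then 1 else 0) = 0 := by intro q; rw [q]; simp
  have z2 : X \ Z = ∅ → eCnt G (X ∩ Z) (X \ Z) = 0 ∧ eCnt G (X \ Z) (Y ∩ Z) = 0 ∧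
      eCnt G (X \ Z) (Y \ Z) = 0 ∧ (if u' ∈ X \ Z then 1 else 0) = 0 ∧
      (if w' ∈ X \ Z then 1 else 0) = 0 := by intro q; rw [q]; simp
  have z3 : Y ∩ Z = ∅ → eCnt G (Y ∩ Z) (Y \ Z) = 0 ∧ eCnt G (X ∩ Z) (Y ∩ Z) = 0 ∧
      eCnt G (X \ Z) (Y ∩ Z) = 0 ∧ (if v' ∈ Y ∩ Z then 1 else 0) = 0 ∧
      (if x' ∈ Y ∩ Z then 1 else 0) = 0 := by intro q; rw [q]; simp
  have z4 : Y \ Z = ∅ → eCnt G (Y ∩ Z) (Y \ Z) = 0 ∧ eCnt G (X ∩ Z) (Y \ Z) = 0 ∧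
      eCnt G (X \ Z) (Y \ Z) = 0 ∧ (if v' ∈ Y \ Z then 1 else 0) = 0 ∧
      (if x' ∈ Y \ Z then 1 else 0) = 0 := by intro q; rw [q]; simp
  rw [eCnt_comm G (Y ∩ Z) (X \ Z)]
  generalize (if u' ∈ X ∩ Z ∧ v' ∈ Y \ Z then 1 else 0) = s1 at *
  generalize (if v' ∈ Y ∩ Z ∧ u' ∈ X \ Z then 1 else 0) = s2 at *
  generalize (if w' ∈ X ∩ Z ∧ x' ∈ Y \ Z then 1 else 0) = s3 at *
  generalize (if x' ∈ Y ∩ Z ∧ w' ∈ X \ Z then 1 else 0) = s4 at *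
  generalize (if u' ∈ X ∩ Z then 1 else 0) = u1 at *
  generalize (if u' ∈ X \ Z then 1 else 0) = u2 at *
  generalize (if w' ∈ X ∩ Z then 1 else 0) = w1 at *
  generalize (if w' ∈ X \ Z then 1 else 0) = w2 at *
  generalize (if v' ∈ Y ∩ Z then 1 else 0) = v1 at *
  generalize (if v' ∈ Y \ Z then 1 else 0) = v2 at *
  generalize (if x' ∈ Y ∩ Z then 1 else 0) = x1 at *
  generalize (if x' ∈ Y \ Z then 1 else 0) = x2 at *
  generalize eCnt G (X ∩ Z) (X \ Z) = e1 at *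
  generalize eCnt G (X ∩ Z) (Y ∩ Z) = e2 at *
  generalize eCnt G (X ∩ Z) (Y \ Z) = e3 at *
  generalize eCnt G (X \ Z) (Y ∩ Z) = e4 at *
  generalize eCnt G (X \ Z) (Y \ Z) = e5 at *
  generalize eCnt G (Y ∩ Z) (Y \ Z) = e6 at *
  clear hg c1 k k' disj3 dX dY eX eY d1 d2 eZ eZ' hd hd' hZne hZ' hZ
  have q1 := g1.imp_left fun q => (⟨Finset.card_eq_zero.2 q, z1 q⟩ : _ ∧ _)
  have q2 := g2.imp_left fun q => (⟨Finset.card_eq_zero.2 q, z2 q⟩ : _ ∧ _)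
  have q3 := g3.imp_left fun q => (⟨Finset.card_eq_zero.2 q, z3 q⟩ : _ ∧ _)
  have q4 := g4.imp_left fun q => (⟨Finset.card_eq_zero.2 q, z4 q⟩ : _ ∧ _)
  rw [← Finset.card_eq_zero, ← Finset.card_eq_zero] at n1 n2
  clear z1 z2 z3 z4 g1 g2 g3 g4
  generalize (X ∩ Z).card = a1 at *
  generalize (X \ Z).card = a2 at *
  generalize (Y ∩ Z).card = a3 at *
  generalize (Y \ Z).card = a4 at *
  rcases q1 with q1 | q1 <;> rcases q2 with q2 | q2 <;> rcases q3 with q3 | q3 <;>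
    rcases q4 with q4 | q4 <;> omega

lemma cut_case {X Y : Finset V} (h : Cfg G f u v w x u' v' w' x')
    (hmin : ∀ (m : ℕ) (H : SimpleGraph (Fin m)),
      m < Nat.card V → ThreeConnected H → IsCubic H → H.Colorable 2 → H.IsHamiltonian)
    (hc : CutS G u v w x u' v' w' x' X Y)
    (hdeg : ∀ y, eCnt G {y} Finset.univ = 3)
    (hcut : ∀ X : Finset V, X.Nonempty → Xᶜ.Nonempty → 3 ≤ eCnt G X Xᶜ) : HL G := by
  by_cases hb : u' = w' ∧ v' = x'
  · exact deg_case h hdeg hcut hb.1 hb.2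
  have hne := h.ne
  have na : ¬ G.Adj u' v' := fun ha =>
    hb ⟨cut_adj h hc hdeg hcut ha, cut_adj h.rot.swapVX hc.swap hdeg hcut ha.symm⟩
  have nb : ¬ G.Adj w' x' := fun ha =>
    hb ⟨(cut_adj h.swapUW.swapVX hc.swap2 hdeg hcut ha).symm,
      (cut_adj h.swapUW.swapVX.rot.swapVX hc.swap2.swap hdeg hcut ha.symm).symm⟩
  have nuv : u' ≠ v' := by tauto
  have nwx : w' ≠ x' := by tauto
  have nb' : ¬ (G ⊔ SimpleGraph.edge u' v').Adj w' x' := by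
    rw [SimpleGraph.sup_adj, SimpleGraph.edge_adj]
    rintro (h1 | ⟨⟨h1, h2⟩ | ⟨h1, h2⟩, -⟩)
    · exact nb h1
    · exact hb ⟨h1.symm, h2.symm⟩
    · subst h1; tauto
  have hR : ∀ a b, (G ⊔ SimpleGraph.edge u' v' ⊔ SimpleGraph.edge w' x').Adj a b →
      RH G u' v' w' x' a b := by
    intro a b
    simp only [SimpleGraph.sup_adj, SimpleGraph.edge_adj, RH]
    grind
  have hE : ∀ A B, eCnt (G ⊔ SimpleGraph.edge u' v' ⊔ SimpleGraph.edge w' x') A B = _ := fun A B => by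
    rw [eCnt_edge _ nwx nb', eCnt_edge _ nuv na]
  obtain ⟨pu, pv, pw, px⟩ := h.primes
  obtain ⟨L, l1, l2, l3⟩ := reduce hmin (G ⊔ SimpleGraph.edge u' v' ⊔ SimpleGraph.edge w' x')
    ({u, v, w, x} : Finset V)ᶜ ⟨u', pu⟩ ⟨u, by simp⟩ (by
      intro y hy
      have := h.deg hdeg y hy
      rw [hE]
      simp only [Finset.mem_singleton, pu, pv, pw, px, and_true]
      omega) f (by
      intro y _ z _ hyz
      have c1 := h.hf y z
      have c2 := h.cu'
      have c3 := h.cv'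
      have c4 := h.cw'
      have c5 := h.cx'
      have c6 := h.cc
      have := hR y z hyz
      unfold RH at this
      grind) (by
      intro Z hZ h1 h2
      rw [← hc.un] at hZ h2 ⊢
      rw [hE]
      exact cut_cut h hc hcut Z hZ h1 h2)
  have hm : ∀ y, y ∈ L ↔ y ≠ u ∧ y ≠ v ∧ y ≠ w ∧ y ≠ x := by
    intro y; rw [l2]; simp
  refine lift_H h (l3.imp' hR) ?_ (not_cyc h hc na L l1 l2) l1 hm
  by_cases huw : u' = w'
  · exact three_le_length ((l2 u').2 pu) ((l2 v').2 pv) ((l2 x').2 px) (by tauto) (by tauto)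
      (by tauto)
  · exact three_le_length ((l2 u').2 pu) ((l2 v').2 pv) ((l2 w').2 pw) (by tauto) (by tauto)
      (by tauto)

end main2
section main3
variable {V : Type} [Fintype V] [DecidableEq V]
variable {G : SimpleGraph V} {f : V → Fin 2} {u v w x u' v' w' x' : V}

/-- Edge counts in the reduced graph `G_{u,v}`. -/
lemma eCnt_red (h : Cfg G f u v w x u' v' w' x') (huw : u' ≠ w') (hvx : v' ≠ x') (A B : Finset V) :
    eCnt (G ⊔ SimpleGraph.edge x' v ⊔ SimpleGraph.edge w' u) A B =
      eCnt G A B + (if x' ∈ A ∧ v ∈ B then 1 else 0) + (if v ∈ A ∧ x' ∈ B then 1 else 0)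
      + (if w' ∈ A ∧ u ∈ B then 1 else 0) + (if u ∈ A ∧ w' ∈ B then 1 else 0) := by
  have hne := h.ne
  have n1 : ¬ G.Adj x' v := fun ha => by
    have := (h.hv x').1 ha.symm
    tauto
  have n2 : ¬ (G ⊔ SimpleGraph.edge x' v).Adj w' u := by
    rw [SimpleGraph.sup_adj, SimpleGraph.edge_adj]
    rintro (h1 | ⟨⟨h1, h2⟩ | ⟨h1, h2⟩, -⟩)
    · have := (h.hu w').1 h1.symm
      tauto
    · tauto
    · tauto
  rw [eCnt_edge _ (by tauto) n2, eCnt_edge _ (by tauto) n1]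

lemma red_cutA (h : Cfg G f u v w x u' v' w' x') (huw : u' ≠ w') (hvx : v' ≠ x')
    (hcut : ∀ X : Finset V, X.Nonempty → Xᶜ.Nonempty → 3 ≤ eCnt G X Xᶜ)
    (A B : Finset V) (hAB : A ∪ B = ({u, v, w, x} : Finset V)ᶜ) (dis : Disjoint A B)
    (hA : A.Nonempty) :
    3 ≤ eCnt (G ⊔ SimpleGraph.edge x' v ⊔ SimpleGraph.edge w' u) A (insert u (insert v B)) := by
  have hne := h.ne
  have hd := Finset.disjoint_left.1 dis
  have hAs : A ⊆ ({u, v, w, x} : Finset V)ᶜ := hAB ▸ Finset.subset_union_left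
  have hBs : B ⊆ ({u, v, w, x} : Finset V)ᶜ := hAB ▸ Finset.subset_union_right
  have hg := h.gcut hcut A hAs hA
  have e : ({u, v, w, x} : Finset V)ᶜ \ A = B := by
    rw [← hAB]; ext y; have := @hd y; simp only [Finset.mem_sdiff, Finset.mem_union]; tauto
  rw [e] at hg
  have hu : u ∉ insert v B := by
    intro hh
    rcases Finset.mem_insert.1 hh with hh | hh
    · tauto
    · have := hBs hh; simp at this
  have hv : v ∉ B := fun hh => by have := hBs hh; simp at this
  obtain ⟨c1, c2, -, -⟩ := h.eCnt_C A hAs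
  rw [eCnt_red h huw hvx, eCnt_insert_right G _ hu, eCnt_insert_right G _ hv, c1, c2]
  simp only [Finset.mem_insert, true_or, or_true, and_true]
  omega

set_option maxHeartbeats 4000000 in
lemma red_cutB (h : Cfg G f u v w x u' v' w' x') (huw : u' ≠ w') (hvx : v' ≠ x')
    (hcut : ∀ X : Finset V, X.Nonempty → Xᶜ.Nonempty → 3 ≤ eCnt G X Xᶜ)
    (A B : Finset V) (hAB : A ∪ B = ({u, v, w, x} : Finset V)ᶜ) (dis : Disjoint A B) :
    3 ≤ eCnt (G ⊔ SimpleGraph.edge x' v ⊔ SimpleGraph.edge w' u) (insert u A) (insert v B) ∨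
      CutS G u v w x u' v' w' x' A B := by
  have hne := h.ne
  have hd := Finset.disjoint_left.1 dis
  have hAs : A ⊆ ({u, v, w, x} : Finset V)ᶜ := hAB ▸ Finset.subset_union_left
  have hBs : B ⊆ ({u, v, w, x} : Finset V)ᶜ := hAB ▸ Finset.subset_union_right
  have e : ({u, v, w, x} : Finset V)ᶜ \ A = B := by
    rw [← hAB]; ext y; have := @hd y; simp only [Finset.mem_sdiff, Finset.mem_union]; tauto
  have e' : ({u, v, w, x} : Finset V)ᶜ \ B = A := by
    rw [← hAB]; ext y; have := @hd y; simp only [Finset.mem_sdiff, Finset.mem_union]; tauto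
  have hgA := h.gcut hcut A hAs
  have hgB := h.gcut hcut B hBs
  rw [e] at hgA
  rw [e', eCnt_comm] at hgB
  have huA : u ∉ A := fun hh => by have := hAs hh; simp at this
  have huB : u ∉ B := fun hh => by have := hBs hh; simp at this
  have hvA : v ∉ A := fun hh => by have := hAs hh; simp at this
  have hvB : v ∉ B := fun hh => by have := hBs hh; simp at this
  obtain ⟨-, c2, -, -⟩ := h.eCnt_C A hAs
  obtain ⟨c1, -, -, -⟩ := h.eCnt_C B hBs
  have c0 : eCnt G {u} {v} = 1 := by
    classical rw [eCnt_singleton, if_pos ((h.hu v).2 (Or.inl rfl))]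
  obtain ⟨pu, pv, pw, px⟩ := h.primes
  rw [← hAB, Finset.mem_union] at pu pv pw px
  have du := @hd u'
  have dv := @hd v'
  have dw := @hd w'
  have dx := @hd x'
  have key : eCnt (G ⊔ SimpleGraph.edge x' v ⊔ SimpleGraph.edge w' u) (insert u A) (insert v B)
      = 1 + (if u' ∈ B then 1 else 0) + (if v' ∈ A then 1 else 0) + eCnt G A B
        + (if x' ∈ A then 1 else 0) + (if w' ∈ B then 1 else 0) := by
    rw [eCnt_red h huw hvx, eCnt_insert_left G _ huA, eCnt_insert_right G _ hvB,
      eCnt_insert_right G _ hvB, c0, c2, eCnt_comm G {u} B, c1]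
    have t1 : u ≠ v := hne.1.1
    have t2 : x' ≠ u := h.x'u
    have t3 : w' ≠ v := h.w'v
    clear pu pv pw px du dv dw dx hgA hgB hne
    simp only [Finset.mem_insert, t1, t1.symm, t2, t3, huB, hvA, false_or, true_or, or_false,
      and_true, and_false, false_and, true_and, if_false]
    omega
  rw [key]
  by_contra hcon
  rw [not_or] at hcon
  obtain ⟨k1, k2⟩ := hcon
  have hnA : A.Nonempty := by
    rw [Finset.nonempty_iff_ne_empty]; rintro rfl
    simp only [Finset.notMem_empty, false_or] at pu pw
    simp only [pu, pw, if_true] at k1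
    clear hgA hgB hne pv px du dv dw dx
    omega
  have hnB : B.Nonempty := by
    rw [Finset.nonempty_iff_ne_empty]; rintro rfl
    simp only [Finset.notMem_empty, or_false] at pv px
    simp only [pv, px, if_true] at k1
    clear hgA hgB hne pu pw du dv dw dx
    omega
  replace hgA := hgA hnA
  replace hgB := hgB hnB
  have bits : ∀ p, (p ∈ A ∨ p ∈ B) → (p ∈ A → p ∉ B) → (p ∈ A ∧ p ∉ B) ∨ (p ∉ A ∧ p ∈ B) := by
    intro p h1 h2
    by_cases hp : p ∈ A
    · exact Or.inl ⟨hp, h2 hp⟩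
    · exact Or.inr ⟨hp, h1.resolve_left hp⟩
  replace pu := bits u' pu du
  replace pv := bits v' pv dv
  replace pw := bits w' pw dw
  replace px := bits x' px dx
  clear du dv dw dx bits key hne
  rcases pu with ⟨a1, a2⟩ | ⟨a1, a2⟩ <;> rcases pv with ⟨b1, b2⟩ | ⟨b1, b2⟩ <;>
  rcases pw with ⟨d1, d2⟩ | ⟨d1, d2⟩ <;> rcases px with ⟨f1, f2⟩ | ⟨f1, f2⟩ <;>
  simp only [a1, a2, b1, b2, d1, d2, f1, f2, if_true, if_false] at k1 hgA hgB <;>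
  first
  | omega
  | exact k2 ⟨hAB, dis, a1, d1, b2, f2, by omega⟩

lemma main_case (h : Cfg G f u v w x u' v' w' x')
    (hmin : ∀ (m : ℕ) (H : SimpleGraph (Fin m)),
      m < Nat.card V → ThreeConnected H → IsCubic H → H.Colorable 2 → H.IsHamiltonian)
    (hdeg : ∀ y, eCnt G {y} Finset.univ = 3)
    (hcut : ∀ X : Finset V, X.Nonempty → Xᶜ.Nonempty → 3 ≤ eCnt G X Xᶜ)
    (huw : u' ≠ w') (hvx : v' ≠ x') : HL G := by
  by_cases hex : ∃ X Y, CutS G u v w x u' v' w' x' X Y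
  · obtain ⟨X, Y, hc⟩ := hex
    exact cut_case h hmin hc hdeg hcut
  have hne := h.ne
  have hR : ∀ a b, (G ⊔ SimpleGraph.edge x' v ⊔ SimpleGraph.edge w' u).Adj a b →
      RC G u v w' x' a b := by
    intro a b
    simp only [SimpleGraph.sup_adj, SimpleGraph.edge_adj, RC]
    grind
  have hS : ∀ y, y ∈ ({w, x} : Finset V)ᶜ ↔ y ≠ w ∧ y ≠ x := by intro y; simp
  have su : u ∈ ({w, x} : Finset V)ᶜ := by rw [hS]; tauto
  have sv : v ∈ ({w, x} : Finset V)ᶜ := by rw [hS]; tauto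
  have sw' : w' ∈ ({w, x} : Finset V)ᶜ := by rw [hS]; tauto
  have sx' : x' ∈ ({w, x} : Finset V)ᶜ := by rw [hS]; tauto
  have su' : u' ∈ ({w, x} : Finset V)ᶜ := by rw [hS]; tauto
  obtain ⟨L, l1, l2, l3⟩ := reduce hmin (G ⊔ SimpleGraph.edge x' v ⊔ SimpleGraph.edge w' u)
    ({w, x} : Finset V)ᶜ ⟨u, su⟩ ⟨w, by simp⟩ (by
      intro y hy
      have h1 := hdeg y
      have hwx : w ∉ ({x} : Finset V) := by simp; tauto
      rw [← Finset.union_compl ({w, x} : Finset V), eCnt_union_right G _ disjoint_compl_right,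
        eCnt_insert_right G _ hwx, eCnt_nbr G h.vx h.w'v.symm h.w'x.symm h.hw,
        eCnt_nbr G h.uw h.x'u.symm h.x'w.symm h.hx] at h1
      rw [eCnt_red h huw hvx]
      have t1 : w ≠ y := by rw [hS] at hy; exact hy.1.symm
      have t2 : x ≠ y := by rw [hS] at hy; exact hy.2.symm
      simp only [Finset.mem_singleton, t1, t2, if_false] at h1
      simp only [Finset.mem_singleton, su, sv, sw', sx', and_true]
      omega) f (by
      intro y _ z _ hyz
      have c1 := h.hf y z
      have c4 := h.cw'
      have c5 := h.cx'
      have c6 := h.cc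
      have := hR y z hyz
      unfold RC at this
      grind) (by
      -- all cuts
      have caseC : ∀ Z ⊆ ({w, x} : Finset V)ᶜ, u ∈ Z → v ∉ Z → 3 ≤
          eCnt (G ⊔ SimpleGraph.edge x' v ⊔ SimpleGraph.edge w' u) Z (({w, x} : Finset V)ᶜ \ Z) := by
        intro Z hZ hu hv
        have e1 : Z = insert u (Z.erase u) := (Finset.insert_erase hu).symm
        have e2 : ({w, x} : Finset V)ᶜ \ Z = insert v ((({w, x} : Finset V)ᶜ \ Z).erase v) :=
          (Finset.insert_erase (Finset.mem_sdiff.2 ⟨sv, hv⟩)).symm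
        have := red_cutB h huw hvx hcut (Z.erase u) ((({w, x} : Finset V)ᶜ \ Z).erase v) (by
          ext y
          have := @hZ y
          simp only [Finset.mem_union, Finset.mem_erase, Finset.mem_sdiff, Finset.mem_compl,
            Finset.mem_insert, Finset.mem_singleton] at this ⊢
          grind) (by
          rw [Finset.disjoint_left]; intro y
          simp only [Finset.mem_erase, Finset.mem_sdiff]; tauto)
        rw [← e1, ← e2] at this
        exact this.resolve_right fun hh => hex ⟨_, _, hh⟩
      have caseA : ∀ Z ⊆ ({w, x} : Finset V)ᶜ, Z.Nonempty → u ∉ Z → v ∉ Z → 3 ≤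
          eCnt (G ⊔ SimpleGraph.edge x' v ⊔ SimpleGraph.edge w' u) Z (({w, x} : Finset V)ᶜ \ Z) := by
        intro Z hZ hZn hu hv
        have e2 : ({w, x} : Finset V)ᶜ \ Z =
            insert u (insert v (((({w, x} : Finset V)ᶜ \ Z).erase u).erase v)) := by
          rw [Finset.insert_erase, Finset.insert_erase]
          · exact Finset.mem_sdiff.2 ⟨su, hu⟩
          · refine Finset.mem_erase.2 ⟨by tauto, Finset.mem_sdiff.2 ⟨sv, hv⟩⟩
        have := red_cutA h huw hvx hcut Z (((({w, x} : Finset V)ᶜ \ Z).erase u).erase v) (by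
          ext y
          have := @hZ y
          simp only [Finset.mem_union, Finset.mem_erase, Finset.mem_sdiff, Finset.mem_compl,
            Finset.mem_insert, Finset.mem_singleton] at this ⊢
          grind) (by
          rw [Finset.disjoint_left]; intro y
          simp only [Finset.mem_erase, Finset.mem_sdiff]; tauto) hZn
        rwa [← e2] at this
      intro Z hZ h1 h2
      have hcc : ({w, x} : Finset V)ᶜ \ (({w, x} : Finset V)ᶜ \ Z) = Z :=
        Finset.sdiff_sdiff_eq_self hZ
      by_cases hu : u ∈ Z <;> by_cases hv : v ∈ Z
      · have := caseA (({w, x} : Finset V)ᶜ \ Z) Finset.sdiff_subset h2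
          (fun hh => (Finset.mem_sdiff.1 hh).2 hu) (fun hh => (Finset.mem_sdiff.1 hh).2 hv)
        rwa [hcc, eCnt_comm] at this
      · exact caseC Z hZ hu hv
      · have := caseC (({w, x} : Finset V)ᶜ \ Z) Finset.sdiff_subset
          (Finset.mem_sdiff.2 ⟨su, hu⟩) (fun hh => (Finset.mem_sdiff.1 hh).2 hv)
        rwa [hcc, eCnt_comm] at this
      · exact caseA Z hZ h1 hu hv)
  refine lift_C h (l3.imp' hR) ?_ l1 (fun y => (l2 y).trans (hS y))
  exact three_le_length ((l2 u).2 su) ((l2 v).2 sv) ((l2 u').2 su') (by tauto) (by tauto) (by tauto)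

lemma semi_deg (h : Cfg G f u v w x u' v' w' x')
    (hmin : ∀ (m : ℕ) (H : SimpleGraph (Fin m)),
      m < Nat.card V → ThreeConnected H → IsCubic H → H.Colorable 2 → H.IsHamiltonian)
    (hdeg : ∀ y, eCnt G {y} Finset.univ = 3)
    (hcut : ∀ X : Finset V, X.Nonempty → Xᶜ.Nonempty → 3 ≤ eCnt G X Xᶜ)
    (huw : u' = w') : HL G := by
  have hne := h.ne
  obtain ⟨pu, pv, pw, px⟩ := h.primes
  have hsub : ({u'} : Finset V) ⊆ ({u, v, w, x} : Finset V)ᶜ := by simpa using pu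
  refine cut_case (X := {u'}) (Y := ({u, v, w, x} : Finset V)ᶜ \ {u'}) h hmin ⟨?_, ?_, ?_, ?_, ?_, ?_, ?_⟩ hdeg hcut
  · exact Finset.union_sdiff_of_subset hsub
  · exact Finset.disjoint_sdiff
  · simp
  · simp [huw]
  · refine Finset.mem_sdiff.2 ⟨pv, ?_⟩
    rw [Finset.mem_singleton]; tauto
  · refine Finset.mem_sdiff.2 ⟨px, ?_⟩
    rw [Finset.mem_singleton]; tauto
  · have := h.deg hdeg u' pu
    rw [eCnt_split_right G _ hsub] at this
    have h0 : eCnt G {u'} {u'} = 0 := by classical simp [eCnt_singleton]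
    have t1 : v' ≠ u' := by tauto
    have t2 : x' ≠ u' := by tauto
    rw [h0] at this
    simp only [t1, t2, huw.symm, if_true, if_false] at this
    omega

lemma all_cases (h : Cfg G f u v w x u' v' w' x')
    (hmin : ∀ (m : ℕ) (H : SimpleGraph (Fin m)),
      m < Nat.card V → ThreeConnected H → IsCubic H → H.Colorable 2 → H.IsHamiltonian)
    (hdeg : ∀ y, eCnt G {y} Finset.univ = 3)
    (hcut : ∀ X : Finset V, X.Nonempty → Xᶜ.Nonempty → 3 ≤ eCnt G X Xᶜ) : HL G := by
  by_cases h1 : u' = w'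
  · exact semi_deg h hmin hdeg hcut h1
  by_cases h2 : v' = x'
  · exact semi_deg h.rot hmin hdeg hcut h2
  exact main_case h hmin hdeg hcut h1 h2

lemma third_nbr_s10 (hc : IsCubic G) {a b c : V} (h1 : G.Adj a b) (h2 : G.Adj a c) (hbc : b ≠ c) :
    ∃ d, d ≠ b ∧ d ≠ c ∧ ∀ y, G.Adj a y ↔ y = b ∨ y = c ∨ y = d := by
  have h := hc a
  rw [Set.ncard_eq_three] at h
  obtain ⟨p, q, r, pq, pr, qr, hs⟩ := h
  have hy : ∀ y, G.Adj a y ↔ y = p ∨ y = q ∨ y = r := by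
    intro y
    rw [← SimpleGraph.mem_neighborSet, hs]; simp
  have h1' := (hy b).1 h1
  have h2' := (hy c).1 h2
  rcases h1' with rfl | rfl | rfl <;> rcases h2' with rfl | rfl | rfl <;>
    first
    | exact absurd rfl hbc
    | exact ⟨p, by tauto, by tauto, fun y => (hy y).trans (by tauto)⟩
    | exact ⟨q, by tauto, by tauto, fun y => (hy y).trans (by tauto)⟩
    | exact ⟨r, by tauto, by tauto, fun y => (hy y).trans (by tauto)⟩

end main3

/-- A minimum counterexample to Tutte's conjecture has girth at
least 6: if `G` is a 3-connected, cubic, bipartite, non-Hamiltonian graph such that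
every smaller 3-connected, cubic, bipartite graph is Hamiltonian, then `G`
contains no cycle of length 4. -/
theorem minimum_counterexample_to_Tutte_has_no_four_cycle
    {V : Type} [Fintype V] [DecidableEq V] (G : SimpleGraph V)
    (h3 : ThreeConnected G) (hcubic : IsCubic G)
    (hbip : G.Colorable 2) (hnotham : ¬ G.IsHamiltonian)
    (hmin : ∀ (m : ℕ) (H : SimpleGraph (Fin m)),
      m < Nat.card V → ThreeConnected H → IsCubic H → H.Colorable 2 →
        H.IsHamiltonian) :
    ¬ ∃ (v : V) (c : G.Walk v v), c.IsCycle ∧ c.length = 4 := by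
  rintro ⟨u, c, hc, hlen⟩
  apply hnotham
  obtain ⟨v, w, x, huv, hvw, hwx, hxu, huw, hvx⟩ : ∃ v w x, G.Adj u v ∧ G.Adj v w ∧ G.Adj w x ∧
      G.Adj x u ∧ u ≠ w ∧ v ≠ x := by
    match c, hc, hlen with
    | .cons (v := v) a1 (.cons (v := w) a2 (.cons (v := x) a3 (.cons a4 .nil))), hc, _ =>
      refine ⟨v, w, x, a1, a2, a3, a4, ?_, ?_⟩
      · have := hc.support_nodup
        simp at this
        rintro rfl; tauto
      · have := hc.support_nodup
        simp at this
        rintro rfl; tauto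
  obtain ⟨col⟩ := hbip
  have hf : ∀ a b, G.Adj a b → col a ≠ col b := fun a b hab => col.valid hab
  obtain ⟨u', u1, u2, hu⟩ := third_nbr_s10 hcubic huv hxu.symm hvx
  obtain ⟨v', v1, v2, hv⟩ := third_nbr_s10 hcubic huv.symm hvw huw
  obtain ⟨w', w1, w2, hw⟩ := third_nbr_s10 hcubic hvw.symm hwx hvx
  obtain ⟨x', x1, x2, hx⟩ := third_nbr_s10 hcubic hxu hwx.symm huw
  have two : ∀ a b c : V, G.Adj a b → G.Adj a c → col b = col c := by
    intro a b c h1 h2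
    have := hf _ _ h1
    have := hf _ _ h2
    generalize col a = i at *
    generalize col b = j at *
    generalize col c = k at *
    revert i j k; decide
  have au' : G.Adj u u' := (hu u').2 (by tauto)
  have av' : G.Adj v v' := (hv v').2 (by tauto)
  have aw' : G.Adj w w' := (hw w').2 (by tauto)
  have ax' : G.Adj x x' := (hx x').2 (by tauto)
  have cfg : Cfg G col u v w x u' v' w' x' :=
    ⟨hf, hu, hv, hw, hx, huw, hvx, u1, u2, w1, w2, v1, v2, x1, x2,
      two v _ _ hvw huv.symm, two v _ _ av' huv.symm, two x _ _ ax' hxu,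
      two u _ _ hxu.symm huv, two u _ _ au' huv, two w _ _ aw' hvw.symm, hf _ _ huv⟩
  obtain ⟨L, l1, l2, l3⟩ := all_cases cfg hmin (eCnt_univ_of_cubic hcubic)
    (cut_of_threeConnected hcubic h3)
  exact hamiltonian_of_list G L l1 l2
    (three_le_length (l2 u) (l2 v) (l2 w) huv.ne huw hvw.ne) l3
end
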